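/- arXiv:1202.5557 — 4 statements merged into one kernel-verified Lean document; each statement's English description precedes it below -/
import Mathlib

section
/- Let F be a field with algebraic closure F̄, and let φ ∈ F(z) be a rational function of degree d ≥ 2. Then Aut_φ(F̄) = {s ∈ PGL₂(F̄) : s ∘ φ ∘ s⁻¹ = φ} is a finite group; in particular Aut_φ(E) is finite for every field extension E of F. -/
open MvPolynomial

noncomputable section

/-- `PGL₂(R)`: the projective general linear group of 2×2 matrices. -/
abbrev PGL2 (R : Type*) [CommRing R] : Type _ :=
  GL (Fin 2) R ⧸ Subgroup.center (GL (Fin 2) R)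

/-- The class of an invertible matrix in `PGL₂`. -/
def PGL2.mk {R : Type*} [CommRing R] (M : GL (Fin 2) R) : PGL2 R :=
  QuotientGroup.mk M

/-- The pair of linear forms attached to a 2×2 matrix. -/
def linForms {R : Type*} [CommRing R] (M : Matrix (Fin 2) (Fin 2) R) :
    Fin 2 → MvPolynomial (Fin 2) R :=
  fun i => C (M i 0) * X 0 + C (M i 1) * X 1

/-- The matrix `M` conjugates the pair of binary forms `Φ` to `Ψ`,
i.e. `S ∘ Φ = λ · (Ψ ∘ S)` for some scalar `λ`, where `S` is the pair of
linear forms of `M`.  This is the homogeneous form of `s ∘ φ ∘ s⁻¹ = ψ`. -/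
def MatConj {R : Type*} [CommRing R] (Φ Ψ : Fin 2 → MvPolynomial (Fin 2) R)
    (M : GL (Fin 2) R) : Prop :=
  ∃ c : Rˣ, ∀ i,
    bind₁ Φ (linForms (M : Matrix (Fin 2) (Fin 2) R) i) =
      C (c : R) * bind₁ (linForms (M : Matrix (Fin 2) (Fin 2) R)) (Ψ i)

/-- `Conj_{φ,ψ}(R)`: the set of elements of `PGL₂(R)` conjugating `φ` to `ψ`. -/
def ConjSet {R : Type*} [CommRing R] (Φ Ψ : Fin 2 → MvPolynomial (Fin 2) R) :
    Set (PGL2 R) :=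
  {s | ∃ M : GL (Fin 2) R, PGL2.mk M = s ∧ MatConj Φ Ψ M}

/-- `Aut_φ(R)`: the automorphism group of `φ` inside `PGL₂(R)`. -/
def AutSet {R : Type*} [CommRing R] (Φ : Fin 2 → MvPolynomial (Fin 2) R) :
    Set (PGL2 R) :=
  ConjSet Φ Φ



namespace AutFin

/-- Restriction of a form to the line `t ↦ t P + Q`. -/
lemma exists_restrict {K : Type*} [Field K] {n : ℕ} (H : MvPolynomial (Fin 2) K)
    (hH : H.IsHomogeneous n) (P Q : Fin 2 → K) :
    ∃ h : Polynomial K, (∀ t, h.eval t = eval (fun i => t * P i + Q i) H) ∧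
      h.natDegree ≤ n ∧ h.coeff n = eval P H := by
  classical
  let L : Fin 2 → Polynomial K := fun i => Polynomial.C (P i) * Polynomial.X + Polynomial.C (Q i)
  have hL : ∀ i, (L i).natDegree ≤ 1 := fun i => by
    simp only [L]; compute_degree
  have hLc : ∀ i, (L i).coeff 1 = P i := fun i => by simp [L]
  have hmon : ∀ m ∈ H.support,
      (Polynomial.C (H.coeff m) * ∏ i, L i ^ m i).natDegree ≤ n ∧
      (Polynomial.C (H.coeff m) * ∏ i, L i ^ m i).coeff n = H.coeff m * ∏ i, P i ^ m i := by
    intro m hm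
    have hn : n = m 0 + m 1 := by
      rw [hH.degree_eq_sum_deg_support hm, ← Finsupp.degree_apply, Finsupp.degree_eq_sum]
      simp
    have hp : ∀ i, (L i ^ m i).natDegree ≤ m i := fun i => by
      simpa using Polynomial.natDegree_pow_le_of_le (m i) (hL i)
    have hpc : ∀ i, (L i ^ m i).coeff (m i) = P i ^ m i := fun i => by
      have := Polynomial.coeff_pow_of_natDegree_le (m := m i) (hL i)
      simpa [hLc] using this
    rw [Fin.prod_univ_two, Fin.prod_univ_two, hn]
    constructor
    · refine (Polynomial.natDegree_C_mul_le _ _).trans ?_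
      exact Polynomial.natDegree_mul_le_of_le (hp 0) (hp 1)
    · rw [Polynomial.coeff_C_mul, Polynomial.coeff_mul_add_eq_of_natDegree_le (hp 0) (hp 1),
        hpc, hpc]
  refine ⟨∑ m ∈ H.support, Polynomial.C (H.coeff m) * ∏ i, L i ^ m i, ?_, ?_, ?_⟩
  · intro t
    rw [Polynomial.eval_finsetSum, eval_eq']
    refine Finset.sum_congr rfl fun m _ => ?_
    simp [L, mul_comm t]
  · exact Polynomial.natDegree_sum_le_of_forall_le _ _ fun m hm => (hmon m hm).1
  · rw [Polynomial.finsetSum_coeff, eval_eq']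
    exact Finset.sum_congr rfl fun m hm => (hmon m hm).2

lemma eval_smul {K : Type*} [Field K] {n : ℕ} (H : MvPolynomial (Fin 2) K)
    (hH : H.IsHomogeneous n) (c : K) (v : Fin 2 → K) :
    eval (fun i => c * v i) H = c ^ n * eval v H := by
  rw [eval_eq', eval_eq', Finset.mul_sum]
  refine Finset.sum_congr rfl fun m hm => ?_
  have hn : n = m 0 + m 1 := by
    rw [hH.degree_eq_sum_deg_support hm, ← Finsupp.degree_apply, Finsupp.degree_eq_sum]
    simp
  rw [hn]; simp only [Fin.prod_univ_two]; ring

lemma no_common_zero {F K : Type*} [Field F] [Field K] (j : F →+* K)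
    (d : ℕ) (hd : 2 ≤ d) (Φ : Fin 2 → MvPolynomial (Fin 2) F)
    (hhom : ∀ i, (Φ i).IsHomogeneous d) (hrel : IsRelPrime (Φ 0) (Φ 1))
    (v : Fin 2 → K) (hv : ∀ i, eval v (map j (Φ i)) = 0) : v = 0 := by
  classical
  have hXu : ∀ k : Fin 2, ¬ IsUnit (X k : MvPolynomial (Fin 2) F) := fun k h => by
    have := h.map (eval (0 : Fin 2 → F))
    simp at this
  let p : Fin 2 → Polynomial F := fun i => aeval ![Polynomial.X, 1] (Φ i)
  have hp : ∀ i, (p i).homogenize d = Φ i := fun i =>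
    Polynomial.homogenize_eq_of_isHomogeneous (hhom i) rfl
  have hdeg : ∀ i, (p i).natDegree ≤ d := by
    intro i
    have : p i = ∑ m ∈ (Φ i).support, Polynomial.C ((Φ i).coeff m) * Polynomial.X ^ (m 0) := by
      simp only [p]
      conv_lhs => rw [(Φ i).as_sum]
      rw [map_sum]
      refine Finset.sum_congr rfl fun m _ => ?_
      rw [aeval_monomial, Finsupp.prod_fintype _ _ (by simp)]
      simp
    rw [this]
    refine Polynomial.natDegree_sum_le_of_forall_le _ _ fun m hm => ?_
    have hn : d = m 0 + m 1 := by
      rw [(hhom i).degree_eq_sum_deg_support hm, ← Finsupp.degree_apply, Finsupp.degree_eq_sum]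
      simp
    exact (Polynomial.natDegree_C_mul_X_pow_le _ _).trans (by omega)
  have hcop : IsCoprime (p 0) (p 1) := by
    apply IsRelPrime.isCoprime
    intro h h0 h1
    have hne : h ≠ 0 := by
      rintro rfl
      rw [zero_dvd_iff] at h0 h1
      refine hXu 0 (hrel ?_ ?_)
      · rw [← hp, h0]; simp
      · rw [← hp, h1]; simp
    have key : ∀ i, h ∣ p i → h.homogenize h.natDegree ∣ Φ i := by
      rintro i ⟨r, hr⟩
      rw [← hp i]
      by_cases hr0 : r = 0
      · rw [hr, hr0]; simp
      have h1 := hdeg i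
      rw [hr, Polynomial.natDegree_mul hne hr0] at h1
      refine ⟨r.homogenize (d - h.natDegree), ?_⟩
      rw [← Polynomial.homogenize_mul _ _ le_rfl (by omega), ← hr]
      congr 1; omega
    have hu := hrel (key 0 h0) (key 1 h1)
    have := hu.map (aeval ![(Polynomial.X : Polynomial F), 1])
    rwa [Polynomial.aeval_homogenize_X_one _ le_rfl] at this
  have hev : ∀ (w : Fin 2 → K) i, eval w (map j (Φ i)) = eval₂ j w ((p i).homogenize d) := by
    intro w i
    rw [hp, eval_map]
  by_cases h1 : v 1 = 0
  · by_contra hne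
    have h0 : v 0 ≠ 0 := fun h0 => hne (by ext i; fin_cases i <;> simp [h0, h1])
    have hc : ∀ i, (p i).coeff d = 0 := by
      intro i
      have := hv i
      rw [hev, Polynomial.homogenize, eval₂_sum, Finset.sum_eq_single (d, 0)] at this
      · rw [eval₂_monomial, Finsupp.prod_fintype _ _ (by simp)] at this
        simpa [h0] using this
      · rintro ⟨a, b⟩ hab hne
        have hb : b ≠ 0 := by
          rintro rfl
          simp at hab; simp [hab] at hne
        rw [eval₂_monomial, Finsupp.prod_fintype _ _ (by simp)]
        simp [h1, hb]
      · simp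
    have hX : ∀ i, X 1 ∣ Φ i := by
      intro i
      have hlt : (p i).natDegree ≤ d - 1 := by
        have h2 := hdeg i
        rcases Nat.lt_or_ge (p i).natDegree d with h | h
        · omega
        · have h3 : (p i).natDegree = d := le_antisymm h2 h
          have h4 := hc i
          rw [← h3] at h4
          have : p i = 0 := by simpa using h4
          simp [this]
      have := Polynomial.homogenize_mul (p i) 1 hlt (n := 1) (by simp)
      rw [mul_one, show d - 1 + 1 = d by omega, hp, Polynomial.homogenize_one, pow_one] at this
      exact ⟨_, this.trans (mul_comm _ _)⟩
    exact hXu 1 (hrel (hX 0) (hX 1))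
  · exfalso
    have hz : ∀ i, (p i).eval₂ j ((v 1)⁻¹ * v 0) = 0 := by
      intro i
      have h2 := eval_smul (map j (Φ i)) ((hhom i).map j) (v 1)⁻¹ v
      rw [hv, hev, Polynomial.eval₂_homogenize_of_eq_one (hdeg i) _ _ (by simp [h1])] at h2
      simpa using h2
    obtain ⟨a, b, hab⟩ := hcop
    have := congrArg (Polynomial.eval₂ j ((v 1)⁻¹ * v 0)) hab
    simp [Polynomial.eval₂_add, Polynomial.eval₂_mul, hz] at this

/-- The cross product of two plane vectors. -/
def cr {K : Type*} [Field K] (v w : Fin 2 → K) : K := v 0 * w 1 - v 1 * w 0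

/-- The polynomial map of the plane. -/
def ev {K : Type*} [Field K] (Ψ : Fin 2 → MvPolynomial (Fin 2) K) (v : Fin 2 → K) : Fin 2 → K :=
  fun i => eval v (Ψ i)

section
variable {K : Type*} [Field K]

lemma vec_eq_zero {v : Fin 2 → K} (h0 : v 0 = 0) (h1 : v 1 = 0) : v = 0 := by
  ext i; fin_cases i <;> simp [h0, h1]

lemma cr_self (v : Fin 2 → K) : cr v v = 0 := by simp [cr]; ring

lemma cr_symm (v w : Fin 2 → K) : cr v w = - cr w v := by simp [cr]; ring

lemma cr_symm_zero {v w : Fin 2 → K} (h : cr v w = 0) : cr w v = 0 := by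
  rw [cr_symm, h, neg_zero]

lemma exists_cr_ne {w : Fin 2 → K} (hw : w ≠ 0) : ∃ Q, cr w Q ≠ 0 := by
  by_contra! h
  apply hw
  apply vec_eq_zero
  · simpa [cr] using h ![0, 1]
  · simpa [cr] using h ![1, 0]

lemma ne_zero_of_cr_left {v w : Fin 2 → K} (h : cr v w ≠ 0) : v ≠ 0 := by
  rintro rfl; simp [cr] at h

lemma ne_zero_of_cr_right {v w : Fin 2 → K} (h : cr v w ≠ 0) : w ≠ 0 := by
  rintro rfl; simp [cr] at h

lemma exists_smul {v w : Fin 2 → K} (hw : w ≠ 0) (h : cr v w = 0) :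
    ∃ c : K, v = fun i => c * w i := by
  obtain ⟨Q, hQ⟩ := exists_cr_ne hw
  refine ⟨cr v Q / cr w Q, ?_⟩
  have h2 : v 0 * w 1 - v 1 * w 0 = 0 := h
  ext i
  rw [div_mul_eq_mul_div, eq_div_iff hQ]
  fin_cases i <;> simp only [cr, Fin.zero_eta, Fin.mk_one, Fin.isValue]
  · linear_combination (-Q 0) * h2
  · linear_combination (-Q 1) * h2

lemma cr_trans {u v w : Fin 2 → K} (hv : v ≠ 0) (h1 : cr u v = 0) (h2 : cr v w = 0) :
    cr u w = 0 := by
  obtain ⟨c, rfl⟩ := exists_smul hv h1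
  obtain ⟨c', rfl⟩ := exists_smul hv (cr_symm_zero h2)
  simp [cr]; ring

lemma eq_zero_of_cr {v P Q : Fin 2 → K} (hPQ : cr P Q ≠ 0) (h1 : cr v P = 0) (h2 : cr v Q = 0) :
    v = 0 := by
  by_contra hv
  exact hPQ (cr_trans hv (cr_symm_zero h1) h2)

lemma exists_root [IsAlgClosed K] {h : Polynomial K} {n : ℕ} (hn : 1 ≤ n) (hc : h.coeff n ≠ 0) :
    ∃ t, h.eval t = 0 := by
  have h1 : n ≤ h.natDegree := Polynomial.le_natDegree_of_ne_zero hc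
  apply IsAlgClosed.exists_root h
  intro h0
  have := Polynomial.natDegree_eq_of_degree_eq_some (n := 0) (by simpa using h0)
  omega

lemma eq_C_of_no_root [IsAlgClosed K] {h : Polynomial K} (hc : ∀ t, h.eval t ≠ 0) :
    ∃ b : K, b ≠ 0 ∧ h = Polynomial.C b := by
  have h0 : h.degree = 0 := by
    by_contra hne
    obtain ⟨t, ht⟩ := IsAlgClosed.exists_root h hne
    exact hc t ht
  have := Polynomial.eq_C_of_degree_eq_zero h0
  refine ⟨_, ?_, this⟩
  intro hb
  rw [hb] at this
  exact hc 0 (by rw [this]; simp)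

lemma exists_zero [IsAlgClosed K] {n : ℕ} (hn : 1 ≤ n) (H : MvPolynomial (Fin 2) K)
    (hH : H.IsHomogeneous n) : ∃ v : Fin 2 → K, v ≠ 0 ∧ eval v H = 0 := by
  obtain ⟨h, h1, h2, h3⟩ := exists_restrict H hH ![1, 0] ![0, 1]
  by_cases hP : eval ![1, 0] H = 0
  · exact ⟨![1, 0], fun h => by simpa using congrFun h 0, hP⟩
  · rw [← h3] at hP
    obtain ⟨t, ht⟩ := exists_root hn hP
    rw [h1] at ht
    exact ⟨_, fun h => by simpa using congrFun h 1, ht⟩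

/-- Finitely many classes up to proportionality. -/
def FinCl (A : Set (Fin 2 → K)) : Prop :=
  ∃ T : Set (Fin 2 → K), T.Finite ∧ (∀ w ∈ T, w ≠ 0) ∧ ∀ v ∈ A, ∃ w ∈ T, cr v w = 0

lemma finCl_zeros {n : ℕ} (H : MvPolynomial (Fin 2) K)
    (hH : H.IsHomogeneous n) {w : Fin 2 → K} (hw : w ≠ 0) (hHw : eval w H ≠ 0) :
    FinCl {v | v ≠ 0 ∧ eval v H = 0} := by
  classical
  obtain ⟨Q, hQ⟩ := exists_cr_ne hw
  obtain ⟨h, h1, h2, h3⟩ := exists_restrict H hH w Q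
  have hne : h ≠ 0 := by rintro rfl; exact hHw (by rw [← h3]; simp)
  refine ⟨(fun t => fun i => t * w i + Q i) '' {t | h.IsRoot t},
    (Polynomial.finite_setOfPred_isRoot hne).image _, ?_, ?_⟩
  · rintro _ ⟨t, -, rfl⟩
    apply ne_zero_of_cr_right (v := w)
    convert hQ using 1
    simp [cr]; ring
  · rintro v ⟨hv, hv0⟩
    have hwv : cr w v ≠ 0 := by
      intro h0
      obtain ⟨c, rfl⟩ := exists_smul hw (cr_symm_zero h0)
      rw [eval_smul H hH] at hv0
      have hc : c ≠ 0 := by rintro rfl; exact hv (by ext i; simp)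
      exact mul_ne_zero (pow_ne_zero _ hc) hHw hv0
    have hEq : (fun i => cr v Q / cr w v * w i + Q i) = fun i => (cr w Q / cr w v) * v i := by
      ext i
      field_simp
      simp only [cr]
      fin_cases i <;> simp only [Fin.zero_eta, Fin.mk_one, Fin.isValue] <;> ring
    refine ⟨_, ⟨cr v Q / cr w v, ?_, rfl⟩, ?_⟩
    · change h.eval _ = 0
      rw [h1, hEq, eval_smul H hH, hv0, mul_zero]
    · simp only [hEq]
      simp [cr]; ring

section maps
variable {d : ℕ} {Ψ : Fin 2 → MvPolynomial (Fin 2) K}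

lemma ev_smul (hhom : ∀ i, (Ψ i).IsHomogeneous d) (c : K) (v : Fin 2 → K) :
    ev Ψ (fun i => c * v i) = fun i => c ^ d * ev Ψ v i := by
  ext i; exact eval_smul _ (hhom i) _ _

lemma ev_cr (hhom : ∀ i, (Ψ i).IsHomogeneous d) {v w : Fin 2 → K} (hw : w ≠ 0)
    (h : cr v w = 0) : cr (ev Ψ v) (ev Ψ w) = 0 := by
  obtain ⟨c, rfl⟩ := exists_smul hw h
  rw [ev_smul hhom]; simp [cr]; ring

/-- the form `v ↦ Ψ(v) × w` -/
lemma crForm (hhom : ∀ i, (Ψ i).IsHomogeneous d) (w : Fin 2 → K) :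
    ∃ H : MvPolynomial (Fin 2) K, H.IsHomogeneous d ∧ ∀ v, eval v H = cr (ev Ψ v) w := by
  refine ⟨C (w 1) * Ψ 0 - C (w 0) * Ψ 1, ((hhom 0).C_mul _).sub ((hhom 1).C_mul _), fun v => ?_⟩
  simp [cr, ev]; ring

/-- the form `v ↦ v × Ψ(v)` -/
lemma fixForm (hhom : ∀ i, (Ψ i).IsHomogeneous d) :
    ∃ H : MvPolynomial (Fin 2) K, H.IsHomogeneous (1 + d) ∧ ∀ v, eval v H = cr v (ev Ψ v) := by
  refine ⟨X 0 * Ψ 1 - X 1 * Ψ 0, ((isHomogeneous_X _ 0).mul (hhom 1)).sub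
    ((isHomogeneous_X _ 1).mul (hhom 0)), fun v => ?_⟩
  simp [cr, ev]

variable [IsAlgClosed K]

lemma exists_preimage (hd : 2 ≤ d) (hhom : ∀ i, (Ψ i).IsHomogeneous d) (w : Fin 2 → K) :
    ∃ v, v ≠ 0 ∧ cr (ev Ψ v) w = 0 := by
  obtain ⟨H, hH, hHe⟩ := crForm hhom w
  obtain ⟨v, hv, h⟩ := exists_zero (by omega) H hH
  exact ⟨v, hv, by rw [← hHe, h]⟩

lemma finCl_preimage_pt (hd : 2 ≤ d) (hhom : ∀ i, (Ψ i).IsHomogeneous d)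
    (hnz : ∀ v, ev Ψ v = 0 → v = 0) {w : Fin 2 → K} (hw : w ≠ 0) :
    FinCl {v | v ≠ 0 ∧ cr (ev Ψ v) w = 0} := by
  obtain ⟨H, hH, hHe⟩ := crForm hhom w
  obtain ⟨Q, hQ⟩ := exists_cr_ne hw
  obtain ⟨v, hv, h⟩ := exists_preimage hd hhom Q
  have := finCl_zeros H hH hv (by
    rw [hHe]; intro h0; exact hv (hnz v (eq_zero_of_cr hQ h0 h)))
  simpa only [hHe] using this

lemma finCl_preimage (hd : 2 ≤ d) (hhom : ∀ i, (Ψ i).IsHomogeneous d)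
    (hnz : ∀ v, ev Ψ v = 0 → v = 0) {A : Set (Fin 2 → K)} (hA : FinCl A) :
    FinCl {v | v ≠ 0 ∧ ev Ψ v ∈ A} := by
  obtain ⟨T, hT, hT0, hTA⟩ := hA
  have h : ∀ w : T, FinCl {v | v ≠ 0 ∧ cr (ev Ψ v) w = 0} := fun w =>
    finCl_preimage_pt hd hhom hnz (hT0 w w.2)
  choose U hU hU0 hUA using h
  have : Finite T := hT
  refine ⟨⋃ w, U w, Set.finite_iUnion hU, ?_, ?_⟩
  · intro w hw
    obtain ⟨i, hi⟩ := Set.mem_iUnion.1 hw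
    exact hU0 i w hi
  · rintro v ⟨hv, hvA⟩
    obtain ⟨w, hw, hvw⟩ := hTA _ hvA
    obtain ⟨u, hu, h⟩ := hUA ⟨w, hw⟩ v ⟨hv, hvw⟩
    exact ⟨u, Set.mem_iUnion.2 ⟨_, hu⟩, h⟩

lemma exists_not_fixed (hd : 2 ≤ d) (hhom : ∀ i, (Ψ i).IsHomogeneous d)
    (hnz : ∀ v, ev Ψ v = 0 → v = 0) : ∃ v, v ≠ 0 ∧ cr v (ev Ψ v) ≠ 0 := by
  by_contra! hfix
  obtain ⟨a, a1, a2, a3⟩ := exists_restrict (Ψ 0) (hhom 0) ![1, 0] ![0, 1]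
  obtain ⟨b, b1, b2, b3⟩ := exists_restrict (Ψ 1) (hhom 1) ![1, 0] ![0, 1]
  have hab : a = Polynomial.X * b := by
    apply Polynomial.funext
    intro t
    have := hfix (fun i => t * (![1, 0] : Fin 2 → K) i + (![0, 1] : Fin 2 → K) i)
      (fun h => by simpa using congrFun h 1)
    simp only [cr, ev, ← a1, ← b1] at this
    simp at this
    simp
    linear_combination -this
  have hP : (![1, 0] : Fin 2 → K) ≠ 0 := fun h => by simpa using congrFun h 0
  have h1 := hfix _ hP
  have hb : eval (![1, 0] : Fin 2 → K) (Ψ 1) = 0 := by simpa [cr, ev] using h1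
  have ha : eval (![1, 0] : Fin 2 → K) (Ψ 0) ≠ 0 := fun h => hP (hnz _ (vec_eq_zero h hb))
  rw [← a3, hab, show d = (d - 1) + 1 by omega, Polynomial.coeff_X_mul] at ha
  obtain ⟨t, ht⟩ := exists_root (by omega) ha
  have hat : a.eval t = 0 := by rw [hab]; simp [ht]
  rw [a1] at hat
  rw [b1] at ht
  have := hnz _ (vec_eq_zero hat ht)
  simpa using congrFun this 1

lemma exists_fixed (hhom : ∀ i, (Ψ i).IsHomogeneous d) : ∃ v, v ≠ 0 ∧ cr v (ev Ψ v) = 0 := by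
  obtain ⟨H, hH, hHe⟩ := fixForm hhom
  obtain ⟨v, hv, h⟩ := exists_zero (by omega) H hH
  exact ⟨v, hv, by rw [← hHe, h]⟩

lemma finCl_fixed (hd : 2 ≤ d) (hhom : ∀ i, (Ψ i).IsHomogeneous d)
    (hnz : ∀ v, ev Ψ v = 0 → v = 0) : FinCl {v | v ≠ 0 ∧ cr v (ev Ψ v) = 0} := by
  obtain ⟨H, hH, hHe⟩ := fixForm hhom
  obtain ⟨v, hv, h⟩ := exists_not_fixed hd hhom hnz
  have := finCl_zeros H hH hv (by rwa [hHe])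
  simpa only [hHe] using this

/-- A fixed point whose only preimage is itself is not the only fixed point; and two such
points are not the only fixed points. -/
lemma exists_other_fixed (hd : 2 ≤ d) (hhom : ∀ i, (Ψ i).IsHomogeneous d)
    (hnz : ∀ v, ev Ψ v = 0 → v = 0) {P Q : Fin 2 → K} (hPQ : cr P Q ≠ 0)
    (hP : cr (ev Ψ P) P = 0) (hPpre : ∀ v, v ≠ 0 → cr (ev Ψ v) P = 0 → cr v P = 0) :
    (∃ v, cr v P ≠ 0 ∧ cr v (ev Ψ v) = 0) ∧
    (cr (ev Ψ Q) Q = 0 → (∀ v, v ≠ 0 → cr (ev Ψ v) Q = 0 → cr v Q = 0) →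
      ∃ v, cr v P ≠ 0 ∧ cr v Q ≠ 0 ∧ cr v (ev Ψ v) = 0) := by
  obtain ⟨HA, hHA, hHAe⟩ := crForm hhom Q
  obtain ⟨HB, hHB, hHBe⟩ := crForm hhom P
  obtain ⟨a, a1, a2, a3⟩ := exists_restrict HA hHA P Q
  obtain ⟨b, b1, b2, b3⟩ := exists_restrict HB hHB P Q
  let L : K → Fin 2 → K := fun t i => t * P i + Q i
  have hLP : ∀ t, cr (L t) P ≠ 0 := fun t h => hPQ (by
    rw [cr_symm, ← neg_zero, ← h]; simp [cr, L]; ring)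
  have hLQ : ∀ t, cr (L t) Q = t * cr P Q := fun t => by simp [cr, L]; ring
  have hfix : ∀ t, a.eval t + t * b.eval t = 0 → cr (L t) (ev Ψ (L t)) = 0 := by
    intro t ht
    rw [a1, b1, hHAe, hHBe] at ht
    change cr (ev Ψ (L t)) Q + t * cr (ev Ψ (L t)) P = 0 at ht
    rw [← neg_zero, ← ht]
    generalize ev Ψ (L t) = w
    simp [cr, L]; ring
  obtain ⟨b0, hb0, rfl⟩ : ∃ c : K, c ≠ 0 ∧ b = Polynomial.C c := by
    apply eq_C_of_no_root
    intro t ht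
    rw [b1, hHBe] at ht
    exact hLP t (hPpre _ (ne_zero_of_cr_left (hLP t)) ht)
  have had : a.coeff d ≠ 0 := by
    rw [a3, hHAe]
    intro h
    exact ne_zero_of_cr_left hPQ (hnz _ (eq_zero_of_cr hPQ hP h))
  constructor
  · have : (a + Polynomial.X * Polynomial.C b0).coeff d ≠ 0 := by
      rw [show d = (d - 2 + 1) + 1 by omega] at had ⊢
      simpa [Polynomial.coeff_X_mul, Polynomial.coeff_C] using had
    obtain ⟨t, ht⟩ := exists_root (by omega) this
    exact ⟨L t, hLP t, hfix t (by rw [Polynomial.eval_add, Polynomial.eval_mul, Polynomial.eval_X] at ht; exact ht)⟩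
  · intro hQ hQpre
    have ha0 : a.eval 0 = 0 := by
      rw [a1, hHAe]; simpa using hQ
    obtain ⟨a', rfl⟩ : Polynomial.X ∣ a := by
      rw [Polynomial.X_dvd_iff, Polynomial.coeff_zero_eq_eval_zero, ha0]
    rw [show d = (d - 2 + 1) + 1 by omega, Polynomial.coeff_X_mul] at had
    have ha'0 : a'.eval 0 = 0 := by
      obtain ⟨r, hr⟩ := exists_root (by omega) had
      have h1 : (Polynomial.X * a').eval r = 0 := by simp [hr]
      rw [a1, hHAe] at h1
      have h2 := hQpre _ (ne_zero_of_cr_left (hLP r)) h1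
      change cr (L r) Q = 0 at h2
      rw [hLQ] at h2
      have : r = 0 := by simpa [hPQ] using h2
      rwa [this] at hr
    have : (a' + Polynomial.C b0).coeff (d - 2 + 1) ≠ 0 := by
      simpa [Polynomial.coeff_C] using had
    obtain ⟨t, ht⟩ := exists_root (by omega) this
    refine ⟨L t, hLP t, ?_, hfix t ?_⟩
    · rw [hLQ]
      refine mul_ne_zero ?_ hPQ
      rintro rfl
      simp [ha'0] at ht
      exact hb0 ht
    · simp at ht ⊢
      linear_combination t * ht

/-- Three pairwise distinct points in the second preimage of the fixed point set. -/
lemma exists_three (hd : 2 ≤ d) (hhom : ∀ i, (Ψ i).IsHomogeneous d)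
    (hnz : ∀ v, ev Ψ v = 0 → v = 0) :
    ∃ u : Fin 3 → Fin 2 → K,
      cr (u 0) (u 1) ≠ 0 ∧ cr (u 0) (u 2) ≠ 0 ∧ cr (u 1) (u 2) ≠ 0 ∧
      ∀ i, cr (ev Ψ (ev Ψ (u i))) (ev Ψ (ev Ψ (ev Ψ (u i)))) = 0 := by
  by_contra hcon
  have hne : ∀ {v}, v ≠ 0 → ev Ψ v ≠ 0 := fun hv h => hv (hnz _ h)
  -- fixed points are in both preimages
  have up : ∀ {v}, v ≠ 0 → cr v (ev Ψ v) = 0 → cr (ev Ψ v) (ev Ψ (ev Ψ v)) = 0 :=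
    fun {v} hv h => ev_cr hhom (hne hv) h
  have fixOf : ∀ {v w}, v ≠ 0 → w ≠ 0 → cr v w = 0 → cr w (ev Ψ w) = 0 → cr v (ev Ψ v) = 0 := by
    intro v w hv hw hvw hf
    exact cr_trans hw hvw (cr_trans (hne hw) hf (cr_symm_zero (ev_cr hhom hw hvw)))
  obtain ⟨P, hP0, hP⟩ := exists_fixed hhom
  have hcon' : ∀ Q R, cr P Q ≠ 0 → Q ≠ 0 → R ≠ 0 →
      cr (ev Ψ (ev Ψ Q)) (ev Ψ (ev Ψ (ev Ψ Q))) = 0 →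
      cr (ev Ψ (ev Ψ R)) (ev Ψ (ev Ψ (ev Ψ R))) = 0 → cr R P = 0 ∨ cr R Q = 0 := by
    intro Q R hPQ hQ hR h1 h2
    by_contra! h
    refine hcon ⟨![P, Q, R], hPQ, ?_, ?_, ?_⟩
    · exact fun h0 => h.1 (cr_symm_zero h0)
    · exact fun h0 => h.2 (cr_symm_zero h0)
    · intro i
      fin_cases i
      · exact up (hne hP0) (up hP0 hP)
      · exact h1
      · exact h2
  by_cases hex : ∃ Q, cr P Q ≠ 0 ∧ cr (ev Ψ Q) (ev Ψ (ev Ψ Q)) = 0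
  · obtain ⟨Q, hPQ, hQ⟩ := hex
    have hQ0 := ne_zero_of_cr_right hPQ
    have hQ2 := up (hne hQ0) hQ
    obtain ⟨R, hR0, hRQ⟩ := exists_preimage hd hhom Q
    -- Q is a fixed point
    have hQfix : cr Q (ev Ψ Q) = 0 := by
      have hR2 : cr (ev Ψ (ev Ψ R)) (ev Ψ (ev Ψ (ev Ψ R))) = 0 := by
        refine fixOf (hne (hne hR0)) (hne hQ0) (ev_cr hhom hQ0 hRQ) hQ
      rcases hcon' Q R hPQ hQ0 hR0 hQ2 hR2 with h | h
      · exfalso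
        apply hPQ
        have h1 := ev_cr hhom hP0 h
        have h2 := cr_trans (hne hP0) h1 (cr_symm_zero hP)
        exact cr_trans (hne hR0) (cr_symm_zero h2) hRQ
      · exact cr_symm_zero (cr_trans (hne hR0) (cr_symm_zero (ev_cr hhom hQ0 h)) hRQ)
    obtain ⟨v, h1, h2, h3⟩ := (exists_other_fixed hd hhom hnz hPQ (cr_symm_zero hP) (by
        intro v hv hvP
        have hf := fixOf (hne hv) hP0 hvP hP
        rcases hcon' Q v hPQ hQ0 hv hQ2 (up (hne hv) hf) with h | h
        · exact h
        · exfalso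
          have h1 := cr_trans (hne hQ0) (ev_cr hhom hQ0 h) (cr_symm_zero hQfix)
          exact hPQ (cr_trans (hne hv) (cr_symm_zero hvP) h1))).2 (cr_symm_zero hQfix) (by
        intro v hv hvQ
        have hf := fixOf (hne hv) hQ0 hvQ hQfix
        rcases hcon' Q v hPQ hQ0 hv hQ2 (up (hne hv) hf) with h | h
        · exfalso
          have h1 := cr_trans (hne hP0) (ev_cr hhom hP0 h) (cr_symm_zero hP)
          exact hPQ (cr_trans (hne hv) (cr_symm_zero h1) hvQ)
        · exact h)
    have hv := ne_zero_of_cr_left h1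
    rcases hcon' Q v hPQ hQ0 hv hQ2 (up (hne hv) (up hv h3)) with h | h
    · exact h1 h
    · exact h2 h
  · push Not at hex
    have hex' : ∀ v, v ≠ 0 → cr (ev Ψ v) (ev Ψ (ev Ψ v)) = 0 → cr v P = 0 := by
      intro v hv h
      by_contra h0
      exact hex v (fun h1 => h0 (cr_symm_zero h1)) h
    obtain ⟨Q, hPQ⟩ := exists_cr_ne hP0
    obtain ⟨v, h1, h2⟩ := (exists_other_fixed hd hhom hnz hPQ (cr_symm_zero hP) (by
      intro v hv hvP
      exact hex' v hv (fixOf (hne hv) hP0 hvP hP))).1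
    have hv := ne_zero_of_cr_left h1
    exact h1 (hex' v hv (up hv h2))

end maps
end

section
variable {K : Type*} [Field K]

lemma cr_mulVec (N : Matrix (Fin 2) (Fin 2) K) (v w : Fin 2 → K) :
    cr (N.mulVec v) (N.mulVec w) = N.det * cr v w := by
  simp [cr, Matrix.mulVec, dotProduct, Fin.sum_univ_two, Matrix.det_fin_two]; ring

lemma mulVec_ne_zero {N : Matrix (Fin 2) (Fin 2) K} (hN : N.det ≠ 0) {v : Fin 2 → K}
    (hv : v ≠ 0) : N.mulVec v ≠ 0 := by
  obtain ⟨Q, hQ⟩ := exists_cr_ne hv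
  apply ne_zero_of_cr_left (w := N.mulVec Q)
  rw [cr_mulVec]
  exact mul_ne_zero hN hQ

/-- A matrix fixing three points of the projective line is scalar. -/
lemma scalar_of_three (N : Matrix (Fin 2) (Fin 2) K) (u : Fin 3 → Fin 2 → K)
    (h01 : cr (u 0) (u 1) ≠ 0) (h02 : cr (u 0) (u 2) ≠ 0) (h12 : cr (u 1) (u 2) ≠ 0)
    (h : ∀ i, cr (N.mulVec (u i)) (u i) = 0) :
    N 1 0 = 0 ∧ N 0 1 = 0 ∧ N 0 0 = N 1 1 := by
  have hD := mul_ne_zero (mul_ne_zero h01 h02) h12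
  have q0 := h 0
  have q1 := h 1
  have q2 := h 2
  simp only [cr, Matrix.mulVec, dotProduct, Fin.sum_univ_two] at q0 q1 q2 hD
  refine ⟨?_, ?_, ?_⟩
  · apply (mul_eq_zero.1 (?_ : N 1 0 * _ = 0)).resolve_right hD
    linear_combination (-(u 1 1 * u 2 1 * (u 1 0 * u 2 1 - u 1 1 * u 2 0))) * q0
      + (u 0 1 * u 2 1 * (u 0 0 * u 2 1 - u 0 1 * u 2 0)) * q1
      - (u 0 1 * u 1 1 * (u 0 0 * u 1 1 - u 0 1 * u 1 0)) * q2
  · apply (mul_eq_zero.1 (?_ : N 0 1 * _ = 0)).resolve_right hD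
    linear_combination (u 1 0 * u 2 0 * (u 1 0 * u 2 1 - u 1 1 * u 2 0)) * q0
      - (u 0 0 * u 2 0 * (u 0 0 * u 2 1 - u 0 1 * u 2 0)) * q1
      + (u 0 0 * u 1 0 * (u 0 0 * u 1 1 - u 0 1 * u 1 0)) * q2
  · apply sub_eq_zero.1
    apply (mul_eq_zero.1 (?_ : (N 0 0 - N 1 1) * _ = 0)).resolve_right hD
    linear_combination (-(u 1 0 ^ 2 * u 2 1 ^ 2 - u 1 1 ^ 2 * u 2 0 ^ 2)) * q0
      + (u 0 0 ^ 2 * u 2 1 ^ 2 - u 0 1 ^ 2 * u 2 0 ^ 2) * q1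
      - (u 0 0 ^ 2 * u 1 1 ^ 2 - u 0 1 ^ 2 * u 1 0 ^ 2) * q2

lemma fixed_of_proportional {d : ℕ} {Ψ : Fin 2 → MvPolynomial (Fin 2) K}
    (hhom : ∀ i, (Ψ i).IsHomogeneous d) (hnz : ∀ v, ev Ψ v = 0 → v = 0)
    {v w : Fin 2 → K} (hw : w ≠ 0) (hvw : cr v w = 0) (hf : cr w (ev Ψ w) = 0) :
    cr v (ev Ψ v) = 0 :=
  cr_trans hw hvw (cr_trans (fun h => hw (hnz _ h)) hf (cr_symm_zero (ev_cr hhom hw hvw)))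

/-- A matrix commuting with the map preserves the second preimage of the fixed points. -/
lemma invariant {d : ℕ} {Ψ : Fin 2 → MvPolynomial (Fin 2) K}
    (hhom : ∀ i, (Ψ i).IsHomogeneous d) (hnz : ∀ v, ev Ψ v = 0 → v = 0)
    {N : Matrix (Fin 2) (Fin 2) K} (hN : N.det ≠ 0)
    (hconj : ∀ v, cr (ev Ψ (N.mulVec v)) (N.mulVec (ev Ψ v)) = 0)
    {v : Fin 2 → K} (hv : v ≠ 0)
    (h : cr (ev Ψ (ev Ψ v)) (ev Ψ (ev Ψ (ev Ψ v))) = 0) :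
    cr (ev Ψ (ev Ψ (N.mulVec v))) (ev Ψ (ev Ψ (ev Ψ (N.mulVec v)))) = 0 := by
  have hne : ∀ {v}, v ≠ 0 → ev Ψ v ≠ 0 := fun hv h => hv (hnz _ h)
  have h1 : cr (ev Ψ (ev Ψ (N.mulVec v))) (N.mulVec (ev Ψ (ev Ψ v))) = 0 :=
    cr_trans (hne (mulVec_ne_zero hN (hne hv)))
      (ev_cr hhom (mulVec_ne_zero hN (hne hv)) (hconj v)) (hconj _)
  have hy := hne (hne hv)
  refine fixed_of_proportional hhom hnz (mulVec_ne_zero hN hy) h1 ?_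
  refine cr_trans (mulVec_ne_zero hN (hne hy)) ?_ (cr_symm_zero (hconj _))
  rw [cr_mulVec, h, mul_zero]

end

lemma conj_eval {R K : Type*} [Field R] [Field K] (k : R →+* K)
    (Φ : Fin 2 → MvPolynomial (Fin 2) R) (M : GL (Fin 2) R) (hM : MatConj Φ Φ M)
    (v : Fin 2 → K) :
    cr (ev (fun i => map k (Φ i)) ((M.val.map k).mulVec v))
      ((M.val.map k).mulVec (ev (fun i => map k (Φ i)) v)) = 0 := by
  obtain ⟨c, hc⟩ := hM
  have key : ∀ i, (M.val.map k).mulVec (ev (fun i => map k (Φ i)) v) i =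
      k c * ev (fun i => map k (Φ i)) ((M.val.map k).mulVec v) i := by
    intro i
    have h := congrArg (eval₂Hom k v) (hc i)
    have hl : (fun i => eval₂Hom k v (linForms M.val i)) = (M.val.map k).mulVec v := by
      ext i
      simp [linForms, Matrix.mulVec, dotProduct, Fin.sum_univ_two]
    rw [map_mul, eval₂Hom_bind₁, eval₂Hom_bind₁, hl] at h
    simpa [linForms, ev, Matrix.mulVec, dotProduct, Fin.sum_univ_two, eval_map] using h
  simp only [cr, key]; ring

lemma main {F R : Type*} [Field F] [Field R] [Algebra F R]
    (d : ℕ) (hd : 2 ≤ d)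
    (Φ : Fin 2 → MvPolynomial (Fin 2) F)
    (hhom : ∀ i, (Φ i).IsHomogeneous d)
    (hrel : IsRelPrime (Φ 0) (Φ 1)) :
    (AutSet (fun i => MvPolynomial.map (algebraMap F R) (Φ i))).Finite := by
  classical
  let K := AlgebraicClosure R
  let k : R →+* K := algebraMap R K
  let Φ' : Fin 2 → MvPolynomial (Fin 2) R := fun i => map (algebraMap F R) (Φ i)
  let Ψ : Fin 2 → MvPolynomial (Fin 2) K := fun i => map k (Φ' i)
  have hΨ : ∀ i, (Ψ i).IsHomogeneous d := fun i => ((hhom i).map _).map _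
  have hnz : ∀ v, ev Ψ v = 0 → v = 0 := by
    intro v hv
    apply no_common_zero (k.comp (algebraMap F R)) d hd Φ hhom hrel v
    intro i
    rw [← map_map]
    exact congrFun hv i
  have hne : ∀ {v}, v ≠ 0 → ev Ψ v ≠ 0 := fun hv h => hv (hnz _ h)
  obtain ⟨u, h01, h02, h12, hu⟩ := exists_three hd hΨ hnz
  have hu0 : ∀ i, u i ≠ 0 := by
    intro i
    fin_cases i
    · exact ne_zero_of_cr_left h01
    · exact ne_zero_of_cr_left h12
    · exact ne_zero_of_cr_right h12
  obtain ⟨T, hT, hT0, hTA⟩ := finCl_preimage hd hΨ hnz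
    (finCl_preimage hd hΨ hnz (finCl_fixed hd hΨ hnz))
  have hfin : Finite T := hT
  have hdet : ∀ M : GL (Fin 2) R, (M.val.map k).det ≠ 0 := by
    intro M
    have h1 : M.val.det ≠ 0 := (Matrix.isUnits_det_units M).ne_zero
    rw [← RingHom.mapMatrix_apply, ← RingHom.map_det]
    simpa using h1
  have hS : ∀ s : AutSet Φ', ∃ M : GL (Fin 2) R, PGL2.mk M = s.1 ∧ MatConj Φ' Φ' M :=
    fun s => s.2
  choose m hm hmc using hS
  have hcode : ∀ (s : AutSet Φ') (i : Fin 3), ∃ w : T,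
      cr (((m s).val.map k).mulVec (u i)) w = 0 := by
    intro s i
    have hNu := mulVec_ne_zero (hdet (m s)) (hu0 i)
    obtain ⟨w, hw, h⟩ := hTA (((m s).val.map k).mulVec (u i))
      ⟨hNu, hne hNu, hne (hne hNu), invariant hΨ hnz (hdet (m s))
        (conj_eval k Φ' (m s) (hmc s)) (hu0 i) (hu i)⟩
    exact ⟨⟨w, hw⟩, h⟩
  choose code hcode using hcode
  have hinj : Function.Injective code := by
    intro s t hst
    have hp : ∀ i, cr (((m t).val.map k).mulVec (u i)) (((m s).val.map k).mulVec (u i)) = 0 := by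
      intro i
      refine cr_trans (hT0 _ (code s i).2) ?_ (cr_symm_zero (hcode s i))
      rw [hst]; exact hcode t i
    let G : GL (Fin 2) R := (m s)⁻¹ * m t
    have hG : (m t).val.map k = (m s).val.map k * G.val.map k := by
      rw [← Matrix.map_mul, ← Units.val_mul, mul_inv_cancel_left]
    obtain ⟨g1, g2, g3⟩ := scalar_of_three (G.val.map k) u h01 h02 h12 (by
      intro i
      have h := hp i
      rw [hG, ← Matrix.mulVec_mulVec, cr_mulVec] at h
      exact (mul_eq_zero.1 h).resolve_left (hdet _))
    simp only [Matrix.map_apply] at g1 g2 g3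
    have g1' : G.val 1 0 = 0 := by simpa using g1
    have g2' : G.val 0 1 = 0 := by simpa using g2
    have g3' : G.val 0 0 = G.val 1 1 := k.injective g3
    apply Subtype.ext
    rw [← hm s, ← hm t]
    apply QuotientGroup.eq.2
    rw [Matrix.GeneralLinearGroup.mem_center_iff_val_mem_range_scalar]
    refine ⟨G.val 0 0, ?_⟩
    change _ = G.val
    ext i j
    fin_cases i <;> fin_cases j <;> simp [g1', g2', g3']
  have : Finite (AutSet Φ') := Finite.of_injective code hinj
  exact Set.toFinite (AutSet Φ')
end AutFin

/-- `Aut_φ(F̄)` is finite, and `Aut_φ(E)` is finite for every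
field extension `E/F`. -/
theorem autSet_finite
    {F E : Type*} [Field F] [Field E] [Algebra F E] [IsAlgClosure F E]
    (d : ℕ) (hd : 2 ≤ d)
    (Φ : Fin 2 → MvPolynomial (Fin 2) F)
    (hhom : ∀ i, (Φ i).IsHomogeneous d)
    (hrel : IsRelPrime (Φ 0) (Φ 1)) :
    (AutSet (fun i => MvPolynomial.map (algebraMap F E) (Φ i))).Finite ∧
    ∀ (E' : Type*) [Field E'] [Algebra F E'],
      (AutSet (fun i => MvPolynomial.map (algebraMap F E') (Φ i))).Finite := by
  exact ⟨AutFin.main d hd Φ hhom hrel, fun E' _ _ => AutFin.main d hd Φ hhom hrel⟩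
end
end

section
/- Let k be a field equipped with a non-Archimedean absolute value, with valuation ring 𝔬 and residue field 𝔽, and let φ, ψ ∈ k(z) be rational functions of degree at least 2, both with good reduction. Then every element of Conj_{φ,ψ}(k) has good reduction, and reduction of matrix entries modulo the maximal ideal induces a map of sets red_{φ,ψ} : Conj_{φ,ψ}(k) → Conj_{φ,ψ}(𝔽). If moreover the order of the finite group Aut_φ(k) is relatively prime to the characteristic of 𝔽, then red_{φ,ψ} is injective. -/
open MvPolynomial

noncomputable section

/-- The valuation ring of a non-Archimedean absolute value. -/
def ValSubring {k : Type*} [Field k] (v : AbsoluteValue k ℝ)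
    (hv : IsNonarchimedean v) : Subring k where
  carrier := {x | v x ≤ 1}
  one_mem' := by simp
  mul_mem' := by
    intro a b ha hb
    have h := v.nonneg a
    have h' := v.nonneg b
    have ha' : v a ≤ 1 := ha
    have hb' : v b ≤ 1 := hb
    show v (a * b) ≤ 1
    rw [v.map_mul]
    nlinarith
  zero_mem' := by simp
  add_mem' := by
    intro a b ha hb
    exact le_trans (hv a b) (max_le ha hb)
  neg_mem' := by
    intro a ha
    show v (-a) ≤ 1
    rwa [v.map_neg]

/-- An element of `PGL₂(k)` has good reduction: it is represented by a matrix
with entries in the valuation ring whose determinant is a unit there. -/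
def MatGoodRed {k : Type*} [Field k] (v : AbsoluteValue k ℝ)
    (hv : IsNonarchimedean v) (s : PGL2 k) : Prop :=
  ∃ (M : GL (Fin 2) k) (N : Matrix (Fin 2) (Fin 2) (ValSubring v hv)),
    PGL2.mk M = s ∧
    (∀ i j, (N i j : k) = (M : Matrix (Fin 2) (Fin 2) k) i j) ∧
    IsUnit N.det

theorem homog_scale {R S : Type*} [CommRing R] [CommRing S] {n : ℕ}
    {φ : MvPolynomial (Fin 2) R} (h : φ.IsHomogeneous n) (f : R →+* S) (g : Fin 2 → S) (t : S) :
    eval₂ f (fun i => t * g i) φ = t ^ n * eval₂ f g φ := by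
  rw [eval₂_eq', eval₂_eq', Finset.mul_sum]
  refine Finset.sum_congr rfl fun m hm => ?_
  have h3 : m 0 + m 1 = n := by
    have h4 := h (by simpa using hm : coeff m φ ≠ 0)
    simp [Finsupp.weight_apply, Finsupp.sum_fintype, Fin.sum_univ_two] at h4
    exact h4
  simp only [Fin.prod_univ_two]
  rw [← h3]
  ring

theorem natDegree_dehom {R : Type*} [CommRing R] {n : ℕ}
    {φ : MvPolynomial (Fin 2) R} (h : φ.IsHomogeneous n) :
    (MvPolynomial.aeval ![Polynomial.X, 1] φ : Polynomial R).natDegree ≤ n := by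
  rw [MvPolynomial.aeval_def, eval₂_eq']
  refine Polynomial.natDegree_sum_le_of_forall_le _ _ fun m hm => ?_
  have h3 : m 0 + m 1 = n := by
    have h4 := h (by simpa using hm : coeff m φ ≠ 0)
    simp [Finsupp.weight_apply, Finsupp.sum_fintype, Fin.sum_univ_two] at h4
    exact h4
  simp only [Fin.prod_univ_two]
  simp only [Matrix.cons_val_zero, Matrix.cons_val_one, one_pow, mul_one]
  refine (Polynomial.natDegree_C_mul_X_pow_le _ _).trans (by omega)

theorem X1_dvd {R S : Type*} [CommRing R] [CommRing S] {n : ℕ} (hn : 0 < n)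
    {φ : MvPolynomial (Fin 2) R} (h : φ.IsHomogeneous n) (f : R →+* S)
    (hf : Function.Injective f) (h0 : eval₂ f ![1, 0] φ = 0) : (X 1 : MvPolynomial (Fin 2) R) ∣ φ := by
  have hd := natDegree_dehom h
  have hh := Polynomial.homogenize_eq_of_isHomogeneous h rfl
  generalize (MvPolynomial.aeval ![Polynomial.X, 1] φ : Polynomial R) = p at hd hh
  subst hh
  have hc : p.coeff n = 0 := by
    rw [Polynomial.homogenize, eval₂_sum, Finset.sum_eq_single (n, 0)] at h0
    · simp [eval₂_monomial, Finsupp.prod_fintype, Fin.prod_univ_two] at h0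
      exact (map_eq_zero_iff f hf).1 h0
    · rintro ⟨a, b⟩ hab hne
      have hb : b ≠ 0 := by
        rintro rfl
        apply hne
        simpa using hab
      simp [eval₂_monomial, Finsupp.prod_fintype, Fin.prod_univ_two, hb]
    · simp
  obtain ⟨m, rfl⟩ : ∃ m, n = m + 1 := ⟨n - 1, by omega⟩
  have hd' : p.natDegree ≤ m := by
    by_contra hlt
    have h1 : p.natDegree = m + 1 := by omega
    rw [← h1] at hc
    have : p = 0 := Polynomial.leadingCoeff_eq_zero.1 hc
    simp [this] at h1
  have := Polynomial.homogenize_mul p 1 hd' (n := 1) (by simp)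
  rw [mul_one] at this
  rw [this]
  simp

theorem homogenize_dvd_of_dvd {F : Type*} [Field F] {p q : Polynomial F} {n : ℕ}
    (hq : q.natDegree ≤ n) (hq0 : q ≠ 0) (h : p ∣ q) :
    p.homogenize p.natDegree ∣ q.homogenize n := by
  obtain ⟨r, rfl⟩ := h
  have hp0 : p ≠ 0 := left_ne_zero_of_mul hq0
  have hr0 : r ≠ 0 := right_ne_zero_of_mul hq0
  rw [Polynomial.natDegree_mul hp0 hr0] at hq
  obtain ⟨m, rfl⟩ := Nat.exists_eq_add_of_le hq
  rw [add_assoc, Polynomial.homogenize_mul p r le_rfl (Nat.le_add_right _ _)]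
  exact dvd_mul_right _ _

theorem not_isUnit_homog {F : Type*} [Field F] {φ : MvPolynomial (Fin 2) F} {n : ℕ}
    (h : φ.IsHomogeneous n) (hn : 0 < n) : ¬ IsUnit φ := by
  intro hu
  have h0 : φ.IsHomogeneous 0 := by
    obtain ⟨a, ha, rfl⟩ := MvPolynomial.isUnit_iff_eq_C_of_isReduced.1 hu
    exact isHomogeneous_C _ _
  have := h.inj_right h0 hu.ne_zero
  omega

theorem no_common_zero {F L : Type*} [Field F] [Field L] (f : F →+* L) {n : ℕ} (hn : 0 < n)
    {P : Fin 2 → MvPolynomial (Fin 2) F} (hP : ∀ i, (P i).IsHomogeneous n)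
    (hrel : IsRelPrime (P 0) (P 1)) (w : Fin 2 → L) (hw : ∀ i, eval₂ f w (P i) = 0) : w = 0 := by
  by_contra hne
  have hf : Function.Injective f := f.injective
  by_cases h1 : w 1 = 0
  · have h0 : w 0 ≠ 0 := by
      intro h0
      apply hne
      ext i
      fin_cases i
      · exact h0
      · exact h1
    have hw' : ∀ i, eval₂ f ![1, 0] (P i) = 0 := by
      intro i
      have := homog_scale (hP i) f ![1, 0] (w 0)
      have e : (fun i => w 0 * (![1, 0] : Fin 2 → L) i) = w := by
        ext j
        fin_cases j <;> simp [h1]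
      rw [e, hw i] at this
      rcases mul_eq_zero.1 this.symm with h | h
      · exact absurd h (pow_ne_zero _ h0)
      · exact h
    have := hrel (X1_dvd hn (hP 0) f hf (hw' 0)) (X1_dvd hn (hP 1) f hf (hw' 1))
    exact not_isUnit_homog (isHomogeneous_X F (1 : Fin 2)) one_pos this
  · have hp : ∀ i, ∃ p : Polynomial F, p.natDegree ≤ n ∧ p.homogenize n = P i := fun i =>
      ⟨_, natDegree_dehom (hP i), Polynomial.homogenize_eq_of_isHomogeneous (hP i) rfl⟩
    choose p hpd hpP using hp
    have hroot : ∀ i, (p i).eval₂ f (w 0 / w 1) = 0 := by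
      intro i
      have := homog_scale (hP i) f ![w 0 / w 1, 1] (w 1)
      have e : (fun i => w 1 * (![w 0 / w 1, 1] : Fin 2 → L) i) = w := by
        ext j
        fin_cases j
        · simp; field_simp
        · simp
      rw [e, hw i] at this
      rcases mul_eq_zero.1 this.symm with h | h
      · exact absurd h (pow_ne_zero _ h1)
      · rw [← hpP i, Polynomial.eval₂_homogenize_of_eq_one (hpd i) f _ (by simp)] at h
        simpa using h
    have hcop : IsCoprime (p 0) (p 1) := by
      apply IsRelPrime.isCoprime
      have hz : ∀ i, p i = 0 → False := by
        intro i hi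
        have hPi : P i = 0 := by rw [← hpP i, hi]; simp
        fin_cases i
        · simp only [Fin.zero_eta] at hPi
          exact not_isUnit_homog (hP 1) hn (hrel (hPi ▸ dvd_zero _) dvd_rfl)
        · simp only [Fin.mk_one] at hPi
          exact not_isUnit_homog (hP 0) hn (hrel dvd_rfl (hPi ▸ dvd_zero _))
      intro q hq0 hq1
      have hu := hrel (hpP 0 ▸ homogenize_dvd_of_dvd (hpd 0) (hz 0) hq0)
        (hpP 1 ▸ homogenize_dvd_of_dvd (hpd 1) (hz 1) hq1)
      have hq : q.natDegree = 0 := by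
        by_contra h
        exact not_isUnit_homog (Polynomial.isHomogeneous_homogenize q) (Nat.pos_of_ne_zero h) hu
      have hqne : q ≠ 0 := fun h => hz 0 (by rw [h] at hq0; exact zero_dvd_iff.1 hq0)
      exact Polynomial.isUnit_iff_degree_eq_zero.2 ((Polynomial.degree_eq_iff_natDegree_eq hqne).2 hq)
    obtain ⟨a, b, hab⟩ := hcop
    have := congrArg (Polynomial.eval₂ f (w 0 / w 1)) hab
    simp [Polynomial.eval₂_add, Polynomial.eval₂_mul, hroot] at this

theorem bind₁_linForms {R : Type*} [CommRing R] (P : Fin 2 → MvPolynomial (Fin 2) R)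
    (M : Matrix (Fin 2) (Fin 2) R) (i : Fin 2) :
    bind₁ P (linForms M i) = C (M i 0) * P 0 + C (M i 1) * P 1 := by
  simp [linForms]

theorem linForms_mul {R : Type*} [CommRing R] (M' M : Matrix (Fin 2) (Fin 2) R) (i : Fin 2) :
    linForms (M' * M) i = bind₁ (linForms M) (linForms M' i) := by
  rw [bind₁_linForms]
  simp only [linForms, Matrix.mul_apply, Fin.sum_univ_two, C_add, C_mul]
  ring

theorem linForms_one {R : Type*} [CommRing R] (i : Fin 2) :
    linForms (1 : Matrix (Fin 2) (Fin 2) R) i = X i := by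
  obtain rfl | rfl : i = 0 ∨ i = 1 := by omega
  · simp [linForms]
  · simp [linForms]

theorem MatConj.mul {R : Type*} [CommRing R] {Φ Ψ Θ : Fin 2 → MvPolynomial (Fin 2) R}
    {M M' : GL (Fin 2) R} (h : MatConj Φ Ψ M) (h' : MatConj Ψ Θ M') : MatConj Φ Θ (M' * M) := by
  obtain ⟨c, hc⟩ := h
  obtain ⟨c', hc'⟩ := h'
  refine ⟨c * c', fun i => ?_⟩
  have e1 : bind₁ Φ (linForms ((M' * M : GL (Fin 2) R) : Matrix (Fin 2) (Fin 2) R) i) =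
      C (c : R) * bind₁ (linForms (M : Matrix (Fin 2) (Fin 2) R))
        (bind₁ Ψ (linForms (M' : Matrix (Fin 2) (Fin 2) R) i)) := by
    rw [Units.val_mul, linForms_mul, bind₁_linForms, bind₁_linForms, map_add, map_add, map_mul,
      map_mul, map_mul, map_mul, hc, hc]
    simp only [bind₁_C_right]
    ring
  rw [e1, hc' i, map_mul, bind₁_C_right, bind₁_bind₁, Units.val_mul, Units.val_mul, C_mul, mul_assoc]
  congr 4
  ext1 j
  exact (linForms_mul _ _ j).symm

theorem MatConj.inv {R : Type*} [CommRing R] {Φ Ψ : Fin 2 → MvPolynomial (Fin 2) R}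
    {M : GL (Fin 2) R} (h : MatConj Φ Ψ M) : MatConj Ψ Φ M⁻¹ := by
  obtain ⟨c, hc⟩ := h
  refine ⟨c⁻¹, fun i => ?_⟩
  set L := linForms (M : Matrix (Fin 2) (Fin 2) R) with hL
  set L' := linForms ((M⁻¹ : GL (Fin 2) R) : Matrix (Fin 2) (Fin 2) R) with hL'
  have h1 : ∀ i, bind₁ L (L' i) = X i := by
    intro i
    rw [hL, hL', ← linForms_mul, ← Units.val_mul, inv_mul_cancel, Units.val_one, linForms_one]
  have h2 : ∀ i, bind₁ L' (L i) = X i := by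
    intro i
    rw [hL, hL', ← linForms_mul, ← Units.val_mul, mul_inv_cancel, Units.val_one, linForms_one]
  have h3 : ∀ p, bind₁ L' (bind₁ L p) = p := by
    intro p
    rw [bind₁_bind₁]
    simp [h2]
  -- Φ i = c * L' applied to Ψ∘L
  have h4 : Φ i = C (c : R) * bind₁ L (bind₁ Ψ (L' i)) := by
    have e : Φ i = bind₁ Φ (bind₁ L (L' i)) := by rw [h1]; simp
    rw [e, bind₁_bind₁]
    simp only [hc]
    simp only [hL', bind₁_linForms, map_add, map_mul, bind₁_C_right]
    ring
  rw [h4, map_mul, bind₁_C_right, h3, ← mul_assoc, ← C_mul, Units.inv_mul, C_1, one_mul]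

theorem matConj_scalar {R : Type*} [CommRing R] {Φ : Fin 2 → MvPolynomial (Fin 2) R} {d : ℕ}
    (hΦ : ∀ i, (Φ i).IsHomogeneous d) (M : GL (Fin 2) R) (t : Rˣ)
    (hM : (M : Matrix (Fin 2) (Fin 2) R) = Matrix.scalar (Fin 2) (t : R)) : MatConj Φ Φ M := by
  refine ⟨t * (t⁻¹) ^ d, fun i => ?_⟩
  have hl : linForms (M : Matrix (Fin 2) (Fin 2) R) = fun i => C (t : R) * X i := by
    ext1 i
    rw [hM]
    fin_cases i <;> simp [linForms]
  have e : bind₁ (linForms (M : Matrix (Fin 2) (Fin 2) R)) (Φ i) = C (t : R) ^ d * Φ i := by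
    rw [hl]
    have := homog_scale (hΦ i) (C : R →+* MvPolynomial (Fin 2) R) X (C (t : R))
    rw [eval₂_eta] at this
    exact this
  rw [e, hl]
  simp only [map_mul, bind₁_C_right, bind₁_X_right]
  rw [← mul_assoc, ← C_pow, ← C_mul]
  congr 2
  push_cast
  rw [mul_assoc, ← mul_pow, Units.inv_mul, one_pow, mul_one]

theorem matConj_center {R : Type*} [CommRing R] {Φ : Fin 2 → MvPolynomial (Fin 2) R} {d : ℕ}
    (hΦ : ∀ i, (Φ i).IsHomogeneous d) (M : GL (Fin 2) R)
    (hM : M ∈ Subgroup.center (GL (Fin 2) R)) : MatConj Φ Φ M := by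
  rw [Matrix.GeneralLinearGroup.center_eq_range_scalar] at hM
  obtain ⟨t, rfl⟩ := hM
  exact matConj_scalar hΦ _ t rfl

theorem mk_eq_iff {R : Type*} [CommRing R] (M M' : GL (Fin 2) R) :
    PGL2.mk M = PGL2.mk M' ↔ ∃ t : Rˣ, ∀ i j,
      (M' : Matrix (Fin 2) (Fin 2) R) i j = t * (M : Matrix (Fin 2) (Fin 2) R) i j := by
  unfold PGL2.mk
  rw [QuotientGroup.eq, Matrix.GeneralLinearGroup.center_eq_range_scalar]
  constructor
  · rintro ⟨t, ht⟩
    refine ⟨t, fun i j => ?_⟩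
    have : M' = M * Matrix.GeneralLinearGroup.scalar (Fin 2) t := by rw [ht]; group
    rw [this]
    simp [mul_comm]
  · rintro ⟨t, ht⟩
    refine ⟨t, ?_⟩
    rw [eq_inv_mul_iff_mul_eq]
    ext i j
    rw [ht]
    simp [mul_comm]

theorem conjSet_rep {R : Type*} [CommRing R] {Φ Ψ : Fin 2 → MvPolynomial (Fin 2) R} {d : ℕ}
    (hΦ : ∀ i, (Φ i).IsHomogeneous d) (M : GL (Fin 2) R)
    (hM : PGL2.mk M ∈ ConjSet Φ Ψ) : MatConj Φ Ψ M := by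
  obtain ⟨M', h, hM'⟩ := hM
  have := QuotientGroup.eq.1 h
  have h2 := (matConj_center hΦ _ this).mul hM'
  simpa using h2

/-- evaluation form -/
theorem MatConj.eval {R S : Type*} [CommRing R] [CommRing S] (f : R →+* S)
    {Φ Ψ : Fin 2 → MvPolynomial (Fin 2) R} {M : Matrix (Fin 2) (Fin 2) R} {c : R}
    (h : ∀ i, bind₁ Φ (linForms M i) = C c * bind₁ (linForms M) (Ψ i)) (w : Fin 2 → S) :
    (M.map f).mulVec (fun i => eval₂ f w (Φ i)) =
      f c • fun i => eval₂ f ((M.map f).mulVec w) (Ψ i) := by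
  ext i
  have := congrArg (eval₂ f w) (h i)
  rw [bind₁_linForms] at this
  simp only [eval₂_add, eval₂_mul, eval₂_C] at this
  simp only [Matrix.mulVec, dotProduct, Fin.sum_univ_two, Matrix.map_apply, Pi.smul_apply, smul_eq_mul]
  rw [this]
  congr 1
  rw [← coe_eval₂Hom, eval₂Hom_bind₁]
  have e : (fun j => (eval₂Hom f w) (linForms M j)) = (M.map f).mulVec w := by
    ext1 j
    simp [linForms, Matrix.mulVec, dotProduct, Fin.sum_univ_two]
  rw [e]
  rfl

/-- the subgroup -/
def autSubgroup {R : Type*} [CommRing R] (Φ : Fin 2 → MvPolynomial (Fin 2) R) {d : ℕ}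
    (hΦ : ∀ i, (Φ i).IsHomogeneous d) : Subgroup (PGL2 R) where
  carrier := AutSet Φ
  mul_mem' := by
    rintro _ _ ⟨M, rfl, hM⟩ ⟨M', rfl, hM'⟩
    exact ⟨M * M', rfl, hM'.mul hM⟩
  one_mem' := ⟨1, rfl, matConj_center hΦ 1 (one_mem _)⟩
  inv_mem' := by
    rintro _ ⟨M, rfl, hM⟩
    exact ⟨M⁻¹, rfl, hM.inv⟩

section Val

variable {k 𝔽 : Type*} [Field k] [Field 𝔽] {v : AbsoluteValue k ℝ} {hv : IsNonarchimedean v}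

theorem val_isUnit_iff (x : ValSubring v hv) : IsUnit x ↔ v (x : k) = 1 := by
  constructor
  · intro h
    obtain ⟨y, hy⟩ := h.exists_right_inv
    have h1 : v (x : k) * v (y : k) = 1 := by
      rw [← map_mul, ← Subring.coe_mul, hy]; simp
    have hx : v (x : k) ≤ 1 := x.2
    have hy : v (y : k) ≤ 1 := y.2
    nlinarith [v.nonneg (x : k), v.nonneg (y : k)]
  · intro h
    have hx : (x : k) ≠ 0 := by
      intro h0
      rw [h0] at h
      simp at h
    refine IsUnit.of_mul_eq_one ⟨(x : k)⁻¹, ?_⟩ (Subtype.ext ?_)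
    · change v (x : k)⁻¹ ≤ 1
      rw [map_inv₀, h]; simp
    · simp [hx]

theorem val_pi_ne (π : ValSubring v hv →+* 𝔽)
    (hker : ∀ x : ValSubring v hv, π x = 0 ↔ v (x : k) < 1) (x : ValSubring v hv) :
    π x ≠ 0 ↔ v (x : k) = 1 := by
  rw [Ne, hker, not_lt]
  have hx : v (x : k) ≤ 1 := x.2
  exact ⟨fun h => le_antisymm hx h, fun h => h.ge⟩

theorem prim_of_prim (π : ValSubring v hv →+* 𝔽) {d : ℕ} (hd : 0 < d)
    (A : Fin 2 → MvPolynomial (Fin 2) (ValSubring v hv)) (hA : ∀ i, (A i).IsHomogeneous d)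
    (hAred : IsRelPrime (MvPolynomial.map π (A 0)) (MvPolynomial.map π (A 1)))
    (w : Fin 2 → ValSubring v hv) (hw : ∃ i, π (w i) ≠ 0) : ∃ i, π (eval w (A i)) ≠ 0 := by
  by_contra! h
  obtain ⟨i, hi⟩ := hw
  apply hi
  have := no_common_zero (RingHom.id 𝔽) hd (P := fun i => MvPolynomial.map π (A i))
    (fun i => (hA i).map π) hAred (fun i => π (w i)) (by
      intro i
      rw [eval₂_map, RingHom.id_comp, ← h i]
      exact (eval₂_comp_left π (RingHom.id _) w (A i)).symm)
  exact congrFun this i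

theorem good_core (π : ValSubring v hv →+* 𝔽)
    (hker : ∀ x : ValSubring v hv, π x = 0 ↔ v (x : k) < 1)
    {d : ℕ} (hd : 2 ≤ d)
    (A B : Fin 2 → MvPolynomial (Fin 2) (ValSubring v hv))
    (hA : ∀ i, (A i).IsHomogeneous d) (hB : ∀ i, (B i).IsHomogeneous d)
    (hAred : IsRelPrime (MvPolynomial.map π (A 0)) (MvPolynomial.map π (A 1)))
    (hBred : IsRelPrime (MvPolynomial.map π (B 0)) (MvPolynomial.map π (B 1)))
    (N : Matrix (Fin 2) (Fin 2) (ValSubring v hv)) (hN : ∃ i j, π (N i j) ≠ 0)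
    (hdet : N.det ≠ 0) (c : k)
    (h : ∀ i, bind₁ (fun i => MvPolynomial.map (ValSubring v hv).subtype (A i))
        (linForms (N.map (ValSubring v hv).subtype) i) =
      C c * bind₁ (linForms (N.map (ValSubring v hv).subtype))
        (MvPolynomial.map (ValSubring v hv).subtype (B i))) :
    IsUnit N.det ∧ v c = 1 := by
  have hd0 : 0 < d := by omega
  -- evaluated identity
  have key : ∀ (w : Fin 2 → ValSubring v hv) (i : Fin 2),
      (((N.mulVec fun i => eval w (A i)) i : ValSubring v hv) : k) =
        c * (eval (N.mulVec w) (B i) : ValSubring v hv) := by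
    intro w i
    have := congrFun (MatConj.eval (RingHom.id k)
      (Ψ := fun i => MvPolynomial.map (ValSubring v hv).subtype (B i)) h
      (fun i => (w i : k))) i
    have e : ∀ (u : Fin 2 → ValSubring v hv) (P : MvPolynomial (Fin 2) (ValSubring v hv)),
        eval₂ (RingHom.id k) (fun i => (u i : k)) (MvPolynomial.map (ValSubring v hv).subtype P) =
          ((eval u P : ValSubring v hv) : k) := by
      intro u P
      rw [eval₂_map, RingHom.id_comp]
      exact (eval₂_comp_left (ValSubring v hv).subtype (RingHom.id _) u P).symm
    have e2 : ((N.map (ValSubring v hv).subtype).map (RingHom.id k)).mulVec (fun i => (w i : k)) =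
        fun i => ((N.mulVec w i : ValSubring v hv) : k) := by
      ext i
      simp [Matrix.mulVec, dotProduct, Fin.sum_univ_two]
    rw [e2] at this
    simp only [Pi.smul_apply, e] at this
    rw [RingHom.id_apply, smul_eq_mul] at this
    rw [← this]
    simp [Matrix.mulVec, dotProduct, Fin.sum_univ_two]
  have vle : ∀ x : ValSubring v hv, v (x : k) ≤ 1 := fun x => x.2
  -- step 1
  have hc1 : v c ≤ 1 := by
    obtain ⟨i, j, hij⟩ := hN
    obtain ⟨l, hl⟩ := prim_of_prim π hd0 B hB hBred (N.mulVec (Pi.single j 1))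
      ⟨i, by simpa using hij⟩
    rw [val_pi_ne π hker] at hl
    have := congrArg v (key (Pi.single j 1) l)
    rw [map_mul, hl, mul_one] at this
    rw [← this]
    exact vle _
  -- step 2
  have hq : ∃ l q, π (N.adjugate l q) ≠ 0 := by
    obtain ⟨i, j, hij⟩ := hN
    rw [Matrix.adjugate_fin_two]
    obtain rfl | rfl : i = 0 ∨ i = 1 := by omega
    · obtain rfl | rfl : j = 0 ∨ j = 1 := by omega
      · exact ⟨1, 1, by simpa using hij⟩
      · exact ⟨0, 1, by simpa using hij⟩
    · obtain rfl | rfl : j = 0 ∨ j = 1 := by omega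
      · exact ⟨1, 0, by simpa using hij⟩
      · exact ⟨0, 0, by simpa using hij⟩
  obtain ⟨l, q, hlq⟩ := hq
  set w : Fin 2 → ValSubring v hv := N.adjugate.mulVec (Pi.single q 1) with hwdef
  obtain ⟨i, hi⟩ := prim_of_prim π hd0 A hA hAred w ⟨l, by simpa [hwdef] using hlq⟩
  rw [val_pi_ne π hker] at hi
  have hNw : N.mulVec w = fun i => N.det * (Pi.single q 1 : Fin 2 → ValSubring v hv) i := by
    rw [hwdef, Matrix.mulVec_mulVec, Matrix.mul_adjugate, Matrix.smul_mulVec, Matrix.one_mulVec]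
    rfl
  have hBw : ∀ i, eval (N.mulVec w) (B i) = N.det ^ d * eval (Pi.single q 1) (B i) := by
    intro i
    rw [hNw]
    exact homog_scale (hB i) (RingHom.id _) _ _
  have hadj : N.det * eval w (A i) =
      (N.adjugate.mulVec (N.mulVec fun i => eval w (A i))) i := by
    rw [Matrix.mulVec_mulVec, Matrix.adjugate_mul, Matrix.smul_mulVec, Matrix.one_mulVec]
    rfl
  have hfin : (N.det : k) * (eval w (A i) : ValSubring v hv) =
      c * (N.det : k) ^ d * ((N.adjugate.mulVec (fun i => eval (Pi.single q 1) (B i))) i :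
        ValSubring v hv) := by
    rw [← Subring.coe_mul, hadj]
    simp only [Matrix.mulVec, dotProduct, Fin.sum_univ_two, Subring.coe_add, Subring.coe_mul]
    have k0 := key w 0
    have k1 := key w 1
    rw [hBw] at k0 k1
    simp only [Matrix.mulVec, dotProduct, Fin.sum_univ_two, Subring.coe_add, Subring.coe_mul,
      Subring.coe_pow] at k0 k1
    rw [k0, k1]
    ring
  have hv1 := congrArg v hfin
  rw [map_mul, hi, mul_one, map_mul, map_mul, map_pow] at hv1
  have hr := vle ((N.adjugate.mulVec (fun i => eval (Pi.single q 1) (B i))) i)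
  have hr0 := v.nonneg (((N.adjugate.mulVec (fun i => eval (Pi.single q 1) (B i))) i :
    ValSubring v hv) : k)
  have hδ0 : 0 < v (N.det : k) := v.pos (by simpa using hdet)
  have hδ1 := vle N.det
  have hc0 := v.nonneg c
  rw [val_isUnit_iff]
  generalize v (N.det : k) = δ at *
  generalize v (((N.adjugate.mulVec (fun i => eval (Pi.single q 1) (B i))) i :
    ValSubring v hv) : k) = r at *
  have hle : δ ≤ v c * δ ^ d := by
    refine hv1.le.trans ?_
    exact mul_le_of_le_one_right (mul_nonneg hc0 (pow_nonneg hδ0.le _)) hr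
  have hδd : δ ^ d ≤ δ ^ 2 := pow_le_pow_of_le_one hδ0.le hδ1 hd
  have h1 : δ ≤ v c * δ ^ 2 := hle.trans (by gcongr)
  have h2 : 1 ≤ v c * δ := by
    by_contra! hlt
    nlinarith
  have h3 : 1 ≤ δ := by nlinarith
  have h4 : 1 ≤ v c := by nlinarith
  exact ⟨le_antisymm hδ1 h3, le_antisymm hc1 h4⟩

end Val

theorem mat_sq {L : Type*} [CommRing L] (M : Matrix (Fin 2) (Fin 2) L) :
    M * M = M.trace • M - M.det • (1 : Matrix (Fin 2) (Fin 2) L) := by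
  ext i j
  fin_cases i <;> fin_cases j <;>
    simp [Matrix.mul_apply, Fin.sum_univ_two, Matrix.trace_fin_two, Matrix.det_fin_two] <;> ring

theorem eig_root {L : Type*} [Field L] (M : Matrix (Fin 2) (Fin 2) L) (γ : L) :
    (∃ u, u ≠ 0 ∧ M.mulVec u = γ • u) ↔ γ ^ 2 - M.trace * γ + M.det = 0 := by
  have h1 : (M - γ • (1 : Matrix (Fin 2) (Fin 2) L)).det = γ ^ 2 - M.trace * γ + M.det := by
    simp [Matrix.trace_fin_two, Matrix.det_fin_two]
    ring
  rw [← h1, ← Matrix.exists_mulVec_eq_zero_iff]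
  simp only [Matrix.sub_mulVec, Matrix.smul_mulVec, Matrix.one_mulVec, sub_eq_zero]

theorem pow_scalar_of_eig {L : Type*} [Field L] (M : Matrix (Fin 2) (Fin 2) L) (α β : L)
    (ht : M.trace = α + β) (hD : M.det = α * β) (hne : α ≠ β) (n : ℕ) (h : α ^ n = β ^ n) :
    M ^ n = α ^ n • (1 : Matrix (Fin 2) (Fin 2) L) := by
  have hs := mat_sq M
  rw [ht, hD] at hs
  have key : ∀ n : ℕ, (α - β) • M ^ n = α ^ n • (M - β • (1 : Matrix (Fin 2) (Fin 2) L)) -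
      β ^ n • (M - α • (1 : Matrix (Fin 2) (Fin 2) L)) := by
    intro n
    induction n with
    | zero =>
      simp only [pow_zero, one_smul]
      module
    | succ n ih =>
      rw [pow_succ, ← smul_mul_assoc, ih, sub_mul, smul_mul_assoc, smul_mul_assoc, sub_mul, sub_mul,
        smul_mul_assoc, smul_mul_assoc, one_mul, hs]
      module
  have h2 := key n
  rw [← h] at h2
  have h3 : (α - β) • M ^ n = (α - β) • (α ^ n • (1 : Matrix (Fin 2) (Fin 2) L)) := by
    rw [h2]; module
  exact smul_right_injective _ (sub_ne_zero.2 hne) h3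

theorem unip_contra {L : Type*} [Field L] [CharZero L] {K : Type*} [Field K] (f : K →+* L)
    {d : ℕ} (hd : 2 ≤ d) {Φ : Fin 2 → MvPolynomial (Fin 2) K} (hΦ : ∀ i, (Φ i).IsHomogeneous d)
    (e₁ e₂ a b : Fin 2 → L)
    (h : ∀ m : ℕ, (fun i => eval₂ f (e₂ + (m : L) • e₁) (Φ i)) = a + (m : L) • b) (i : Fin 2) :
    eval₂ f e₁ (Φ i) = 0 := by
  let r : Polynomial L := eval₂ (Polynomial.C.comp f)
    (fun j => Polynomial.C (e₁ j) + Polynomial.X * Polynomial.C (e₂ j)) (Φ i)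
  have hr : ∀ t : L, r.eval t = eval₂ f (fun j => e₁ j + t * e₂ j) (Φ i) := by
    intro t
    have := eval₂_comp_left (Polynomial.evalRingHom t) (Polynomial.C.comp f)
      (fun j => Polynomial.C (e₁ j) + Polynomial.X * Polynomial.C (e₂ j)) (Φ i)
    rw [Polynomial.coe_evalRingHom] at this
    rw [this]
    congr 1
    · ext; simp
    · ext j
      simp only [Function.comp_apply, Polynomial.eval_add, Polynomial.eval_mul, Polynomial.eval_C,
        Polynomial.eval_X]
  have hz : r - Polynomial.C (a i) * Polynomial.X ^ d - Polynomial.C (b i) * Polynomial.X ^ (d - 1) = 0 := by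
    apply Polynomial.eq_zero_of_infinite_isRoot
    refine Set.infinite_of_injective_forall_mem (f := fun m : ℕ => ((m : L) + 1)⁻¹) ?_ ?_
    · intro m m' hm
      have := inv_injective hm
      simpa using this
    · intro m
      have hm : ((m : L) + 1) ≠ 0 := Nat.cast_add_one_ne_zero m
      have h1 := congrFun (h (m + 1)) i
      have h2 := homog_scale (hΦ i) f (e₂ + ((m + 1 : ℕ) : L) • e₁) (((m : L) + 1)⁻¹)
      have e : (fun j => ((m : L) + 1)⁻¹ * (e₂ + ((m + 1 : ℕ) : L) • e₁) j) =
          fun j => e₁ j + ((m : L) + 1)⁻¹ * e₂ j := by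
        ext j
        simp
        field_simp
        ring
      rw [e, ← hr, h1] at h2
      simp only [Set.mem_ofPred_eq, Polynomial.IsRoot, Polynomial.eval_sub, Polynomial.eval_mul,
        Polynomial.eval_C, Polynomial.eval_pow, Polynomial.eval_X]
      rw [h2]
      obtain ⟨e, rfl⟩ : ∃ e, d = e + 1 := ⟨d - 1, by omega⟩
      simp
      field_simp
      ring
  have h0 := congrArg (Polynomial.eval 0) hz
  have hd1 : d ≠ 0 := by omega
  have hd2 : d - 1 ≠ 0 := by omega
  simp [hr, hd1, hd2] at h0
  exact h0

theorem finite_order {K L : Type*} [Field K] [Field L] [IsAlgClosed L] [CharZero L]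
    (f : K →+* L) {d : ℕ} (hd : 2 ≤ d)
    {Φ : Fin 2 → MvPolynomial (Fin 2) K} (hΦ : ∀ i, (Φ i).IsHomogeneous d)
    (hrel : IsRelPrime (Φ 0) (Φ 1)) (M : GL (Fin 2) K) (hM : MatConj Φ Φ M) :
    ∃ n : ℕ, 0 < n ∧ ∃ t : L,
      ((M : Matrix (Fin 2) (Fin 2) K).map f) ^ n = t • (1 : Matrix (Fin 2) (Fin 2) L) := by
  obtain ⟨c₀, hc⟩ := hM
  have hev := MatConj.eval f hc
  have hc0 : f (c₀ : K) ≠ 0 := by simp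
  have hdet : ((M : Matrix (Fin 2) (Fin 2) K).map f).det ≠ 0 := by
    have : ((M : Matrix (Fin 2) (Fin 2) K).map f).det = f (M : Matrix (Fin 2) (Fin 2) K).det :=
      (RingHom.map_det f _).symm
    rw [this]
    exact (map_ne_zero f).2 (M.isUnit.map Matrix.detMonoidHom).ne_zero
  generalize (M : Matrix (Fin 2) (Fin 2) K).map f = T at *
  generalize f (c₀ : K) = c at *
  set F : (Fin 2 → L) → (Fin 2 → L) := fun w i => eval₂ f w (Φ i) with hF
  have hF0 : ∀ w, w ≠ 0 → F w ≠ 0 := by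
    intro w hw h
    exact hw (no_common_zero f (by omega) hΦ hrel w (fun i => congrFun h i))
  have hFs : ∀ (t : L) w, F (t • w) = t ^ d • F w := by
    intro t w
    ext i
    exact homog_scale (hΦ i) f w t
  have hTF : ∀ w, T.mulVec (F w) = c • F (T.mulVec w) := hev
  have heig : ∀ γ w, w ≠ 0 → T.mulVec w = γ • w →
      (c * γ ^ d) ^ 2 - T.trace * (c * γ ^ d) + T.det = 0 := by
    intro γ w hw h
    refine (eig_root T _).1 ⟨F w, hF0 w hw, ?_⟩
    rw [hTF, h, hFs, smul_smul]
  obtain ⟨α, hα⟩ : ∃ α : L, α ^ 2 - T.trace * α + T.det = 0 := by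
    obtain ⟨α, hα⟩ := IsAlgClosed.exists_root
      (Polynomial.X ^ 2 - Polynomial.C T.trace * Polynomial.X + Polynomial.C T.det : Polynomial L) (by
        have : (Polynomial.X ^ 2 - Polynomial.C T.trace * Polynomial.X + Polynomial.C T.det : Polynomial L).degree = 2 := by
          compute_degree!
        rw [this]; norm_num)
    exact ⟨α, by simpa [Polynomial.IsRoot] using hα⟩
  obtain ⟨β, hβ⟩ : ∃ β, T.trace = α + β := ⟨T.trace - α, by ring⟩
  have hD : T.det = α * β := by rw [hβ] at hα; linear_combination hα
  have hβ' : β ^ 2 - T.trace * β + T.det = 0 := by rw [hβ, hD]; ring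
  have hαβ : α * β ≠ 0 := hD ▸ hdet
  have hα0 : α ≠ 0 := left_ne_zero_of_mul hαβ
  have hβ0 : β ≠ 0 := right_ne_zero_of_mul hαβ
  obtain ⟨e₁, he₁, hTe₁⟩ := (eig_root T α).2 hα
  obtain ⟨e₂, he₂, hTe₂⟩ := (eig_root T β).2 hβ'
  have g1 := heig α e₁ he₁ hTe₁
  have g2 := heig β e₂ he₂ hTe₂
  have hroot : ∀ γ, γ ^ 2 - T.trace * γ + T.det = 0 → γ = α ∨ γ = β := by
    intro γ h
    rw [hβ, hD] at h
    have : (γ - α) * (γ - β) = 0 := by linear_combination h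
    rcases mul_eq_zero.1 this with h | h
    · exact Or.inl (sub_eq_zero.1 h)
    · exact Or.inr (sub_eq_zero.1 h)
  by_cases hne : α = β
  · subst hne
    have hcα : c * α ^ d = α := by simpa using hroot _ g1
    by_cases hTs : T = α • (1 : Matrix (Fin 2) (Fin 2) L)
    · exact ⟨1, one_pos, α, by rw [pow_one, hTs]⟩
    exfalso
    -- nilpotent part
    set n : Matrix (Fin 2) (Fin 2) L := α⁻¹ • T - 1 with hn
    have hn0 : n ≠ 0 := by
      intro h
      apply hTs
      have : α⁻¹ • T = 1 := sub_eq_zero.1 h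
      rw [← this, smul_smul, mul_inv_cancel₀ hα0, one_smul]
    have hnn : n * n = 0 := by
      have hs := mat_sq T
      rw [hβ, hD] at hs
      have : n * n = (α⁻¹ * α⁻¹) • (T * T) - (2 * α⁻¹) • T + 1 := by
        rw [hn, sub_mul, mul_sub, one_mul, mul_one, smul_mul_smul_comm]
        module
      rw [this, hs]
      have e1 : α⁻¹ * α⁻¹ * (α + α) = 2 * α⁻¹ := by field_simp; ring
      have e2 : α⁻¹ * α⁻¹ * (α * α) = 1 := by field_simp
      rw [smul_sub, smul_smul, smul_smul, e1, e2]
      module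
    have hU : ∀ w, F (w + n.mulVec w) = F w + n.mulVec (F w) := by
      intro w
      have e : ∀ w, w + n.mulVec w = α⁻¹ • T.mulVec w := by
        intro w
        rw [hn, Matrix.sub_mulVec, Matrix.smul_mulVec, Matrix.one_mulVec]
        abel
      rw [e, e, hFs, hTF, smul_smul]
      congr 1
      have : c = α / α ^ d := by rw [eq_div_iff (pow_ne_zero _ hα0), hcα]
      rw [this, inv_pow, div_eq_mul_inv, ← mul_assoc, inv_mul_cancel₀ hα0, one_mul]
    have hnn' : ∀ w, n.mulVec (n.mulVec w) = 0 := by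
      intro w
      rw [Matrix.mulVec_mulVec, hnn, Matrix.zero_mulVec]
    obtain ⟨e, he⟩ : ∃ e, n.mulVec e ≠ 0 := by
      by_contra! h
      apply hn0
      ext i j
      have := congrFun (h (Pi.single j 1)) i
      simpa using this
    have hm : ∀ m : ℕ, F (e + (m : L) • n.mulVec e) = F e + (m : L) • n.mulVec (F e) := by
      intro m
      induction m with
      | zero => simp
      | succ m ih =>
        have := hU (e + (m : L) • n.mulVec e)
        rw [ih, Matrix.mulVec_add, Matrix.mulVec_smul, hnn', Matrix.mulVec_add, Matrix.mulVec_smul,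
          hnn', smul_zero, add_zero, add_zero] at this
        push_cast
        rw [add_smul, add_smul, one_smul, one_smul, ← add_assoc, ← add_assoc]
        exact this
    exact hF0 _ he (funext fun i => unip_contra f hd hΦ (n.mulVec e) e _ _ hm i)
  · have fin : ∃ m : ℕ, 0 < m ∧ α ^ m = β ^ m := by
      obtain ⟨e, rfl⟩ : ∃ e, d = e + 1 := ⟨d - 1, by omega⟩
      have c0 : c ≠ 0 := hc0
      rcases hroot _ g1 with h1 | h1 <;> rcases hroot _ g2 with h2 | h2
      · exact ⟨e + 1, by omega, mul_left_cancel₀ c0 (h1.trans h2.symm)⟩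
      · refine ⟨e, by omega, mul_left_cancel₀ c0 ?_⟩
        have h1' : (c * α ^ e) * α = 1 * α := by rw [one_mul, mul_assoc, ← pow_succ, h1]
        have h2' : (c * β ^ e) * β = 1 * β := by rw [one_mul, mul_assoc, ← pow_succ, h2]
        rw [mul_right_cancel₀ hα0 h1', mul_right_cancel₀ hβ0 h2']
      · refine ⟨e + 2, by omega, mul_left_cancel₀ c0 ?_⟩
        calc c * α ^ (e + 2) = (c * α ^ (e + 1)) * α := by ring
          _ = (c * β ^ (e + 1)) * β := by rw [h1, h2]; ring
          _ = c * β ^ (e + 2) := by ring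
      · exact ⟨e + 1, by omega, mul_left_cancel₀ c0 (h1.trans h2.symm)⟩
    obtain ⟨m, hm, hm'⟩ := fin
    exact ⟨m, hm, _, pow_scalar_of_eig T α β hβ hD hne m hm'⟩

theorem pow_lin {R F : Type*} [CommRing R] [Field F] (π : R →+* F) (P : Matrix (Fin 2) (Fin 2) R)
    (t : F) (hP : P.map π = t • (1 : Matrix (Fin 2) (Fin 2) F)) (n : ℕ) :
    ∃ u w : R, P ^ (n + 1) = u • P + w • (1 : Matrix (Fin 2) (Fin 2) R) ∧
      π u = (n + 1) * t ^ n ∧ π w = - n * t ^ (n + 1) := by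
  have h00 : π (P 0 0) = t := by simpa using congrFun (congrFun hP 0) 0
  have h11 : π (P 1 1) = t := by simpa using congrFun (congrFun hP 1) 1
  have h01 : π (P 0 1) = 0 := by simpa using congrFun (congrFun hP 0) 1
  have h10 : π (P 1 0) = 0 := by simpa using congrFun (congrFun hP 1) 0
  induction n with
  | zero => exact ⟨1, 0, by simp, by simp, by simp⟩
  | succ n ih =>
    obtain ⟨u, w, h, hu, hw⟩ := ih
    refine ⟨u * P.trace + w, - (u * P.det), ?_, ?_, ?_⟩
    · rw [pow_succ, h, add_mul, smul_mul_assoc, smul_mul_assoc, one_mul, mat_sq]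
      module
    · rw [Matrix.trace_fin_two]
      simp only [map_add, map_mul, h00, h11, hu, hw]
      push_cast
      ring
    · rw [Matrix.det_fin_two]
      simp only [map_sub, map_mul, map_neg, h00, h11, h01, h10, hu]
      push_cast
      ring

theorem scalar_of_pow {R F : Type*} [CommRing R] [IsDomain R] [Field F] (π : R →+* F)
    (P : Matrix (Fin 2) (Fin 2) R) (t : F) (ht : t ≠ 0)
    (hP : P.map π = t • (1 : Matrix (Fin 2) (Fin 2) F)) (n : ℕ) (hn : ((n + 1 : ℕ) : F) ≠ 0)
    (h01 : (P ^ (n + 1)) 0 1 = 0) (h10 : (P ^ (n + 1)) 1 0 = 0)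
    (h00 : (P ^ (n + 1)) 0 0 = (P ^ (n + 1)) 1 1) : P 0 1 = 0 ∧ P 1 0 = 0 ∧ P 0 0 = P 1 1 := by
  obtain ⟨u, w, h, hu, -⟩ := pow_lin π P t hP n
  have hu0 : u ≠ 0 := by
    rintro rfl
    rw [map_zero] at hu
    push_cast at hn
    exact mul_ne_zero hn (pow_ne_zero n ht) hu.symm
  rw [h] at h01 h10 h00
  simp [hu0] at h01 h10 h00
  exact ⟨h01, h10, h00⟩

section Val2

variable {k 𝔽 : Type*} [Field k] [Field 𝔽] {v : AbsoluteValue k ℝ} {hv : IsNonarchimedean v}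

theorem exists_scale (π : ValSubring v hv →+* 𝔽)
    (hker : ∀ x : ValSubring v hv, π x = 0 ↔ v (x : k) < 1) (M : GL (Fin 2) k) :
    ∃ (M' : GL (Fin 2) k) (N : Matrix (Fin 2) (Fin 2) (ValSubring v hv)),
      PGL2.mk M' = PGL2.mk M ∧ (∀ i j, (N i j : k) = (M' : Matrix (Fin 2) (Fin 2) k) i j) ∧
      ∃ i j, π (N i j) ≠ 0 := by
  obtain ⟨⟨i₀, j₀⟩, hmax⟩ := Finite.exists_max
    (fun p : Fin 2 × Fin 2 => v ((M : Matrix (Fin 2) (Fin 2) k) p.1 p.2))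
  set m := (M : Matrix (Fin 2) (Fin 2) k) i₀ j₀ with hm
  have hm0 : m ≠ 0 := by
    intro h0
    have hz : (M : Matrix (Fin 2) (Fin 2) k) = 0 := by
      ext i j
      have := hmax (i, j)
      simp only [h0, map_zero] at this
      exact v.eq_zero.1 (le_antisymm this (v.nonneg _))
    exact M.ne_zero hz
  have hvm : 0 < v m := v.pos hm0
  let t : kˣ := (Units.mk0 m hm0)⁻¹
  let M' : GL (Fin 2) k := Matrix.GeneralLinearGroup.scalar (Fin 2) t * M
  have hM' : ∀ i j, (M' : Matrix (Fin 2) (Fin 2) k) i j = m⁻¹ * (M : Matrix (Fin 2) (Fin 2) k) i j := by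
    intro i j
    have e : (M' : Matrix (Fin 2) (Fin 2) k) =
        Matrix.diagonal (fun _ => (t : k)) * (M : Matrix (Fin 2) (Fin 2) k) := rfl
    rw [e, Matrix.diagonal_mul]
    simp [t]
  refine ⟨M', fun i j => ⟨(M' : Matrix (Fin 2) (Fin 2) k) i j, ?_⟩, ?_, fun i j => rfl, i₀, j₀, ?_⟩
  · change v _ ≤ 1
    rw [hM', map_mul, map_inv₀, inv_mul_le_one₀ hvm]
    exact hmax (i, j)
  · symm
    rw [mk_eq_iff]
    refine ⟨t, fun i j => ?_⟩
    rw [hM']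
    simp [t]
  · rw [val_pi_ne π hker]
    change v ((M' : Matrix (Fin 2) (Fin 2) k) i₀ j₀) = 1
    rw [hM', map_mul, map_inv₀]
    exact inv_mul_cancel₀ hvm.ne'

theorem prim_of_unit (π : ValSubring v hv →+* 𝔽) (N : Matrix (Fin 2) (Fin 2) (ValSubring v hv))
    (h : IsUnit N.det) : ∃ i j, π (N i j) ≠ 0 := by
  by_contra! h0
  have := (h.map π).ne_zero
  rw [Matrix.det_fin_two] at this
  simp [h0] at this

theorem red_wd (π : ValSubring v hv →+* 𝔽) (M₁ M₂ : GL (Fin 2) k)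
    (N₁ N₂ : Matrix (Fin 2) (Fin 2) (ValSubring v hv)) (hM : PGL2.mk M₁ = PGL2.mk M₂)
    (h₁ : ∀ i j, (N₁ i j : k) = (M₁ : Matrix (Fin 2) (Fin 2) k) i j)
    (h₂ : ∀ i j, (N₂ i j : k) = (M₂ : Matrix (Fin 2) (Fin 2) k) i j)
    (u₁ : IsUnit N₁.det) (u₂ : IsUnit N₂.det) (G₁ G₂ : GL (Fin 2) 𝔽)
    (hG₁ : (G₁ : Matrix (Fin 2) (Fin 2) 𝔽) = N₁.map π)
    (hG₂ : (G₂ : Matrix (Fin 2) (Fin 2) 𝔽) = N₂.map π) : PGL2.mk G₁ = PGL2.mk G₂ := by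
  obtain ⟨t, ht⟩ := (mk_eq_iff _ _).1 hM
  have hN : ∀ i j, (N₂ i j : k) = t * (N₁ i j : k) := fun i j => by rw [h₁, h₂, ht]
  have hdet : (N₂.det : k) = (t : k) ^ 2 * (N₁.det : k) := by
    simp only [Matrix.det_fin_two, AddSubgroupClass.coe_sub, Subring.coe_mul, hN]
    ring
  have hvt : v (t : k) = 1 := by
    have := congrArg v hdet
    rw [map_mul, map_pow, (val_isUnit_iff _).1 u₁, (val_isUnit_iff _).1 u₂, mul_one] at this
    exact (pow_eq_one_iff_of_nonneg (v.nonneg _) two_ne_zero).1 this.symm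
  let τ : ValSubring v hv := ⟨t, hvt.le⟩
  have hτ : IsUnit τ := (val_isUnit_iff τ).2 hvt
  have hN' : ∀ i j, N₂ i j = τ * N₁ i j := fun i j => Subtype.ext (hN i j)
  rw [mk_eq_iff]
  refine ⟨(hτ.map π).unit, fun i j => ?_⟩
  rw [hG₁, hG₂]
  simp [hN']

theorem reduce (π : ValSubring v hv →+* 𝔽)
    (hker : ∀ x : ValSubring v hv, π x = 0 ↔ v (x : k) < 1)
    (d : ℕ) (hd : 2 ≤ d)
    (Φ Ψ : Fin 2 → MvPolynomial (Fin 2) k)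
    (cΦ : kˣ) (A : Fin 2 → MvPolynomial (Fin 2) (ValSubring v hv))
    (hA : ∀ i, MvPolynomial.map (ValSubring v hv).subtype (A i) = (cΦ : k) • Φ i)
    (hAred : IsRelPrime (MvPolynomial.map π (A 0)) (MvPolynomial.map π (A 1)))
    (cΨ : kˣ) (B : Fin 2 → MvPolynomial (Fin 2) (ValSubring v hv))
    (hB : ∀ i, MvPolynomial.map (ValSubring v hv).subtype (B i) = (cΨ : k) • Ψ i)
    (hBred : IsRelPrime (MvPolynomial.map π (B 0)) (MvPolynomial.map π (B 1)))
    (hAh : ∀ i, (A i).IsHomogeneous d) (hBh : ∀ i, (B i).IsHomogeneous d)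
    (M : GL (Fin 2) k) (N : Matrix (Fin 2) (Fin 2) (ValSubring v hv))
    (hN : ∀ i j, (N i j : k) = (M : Matrix (Fin 2) (Fin 2) k) i j)
    (hprim : ∃ i j, π (N i j) ≠ 0) (hM : MatConj Φ Ψ M) :
    IsUnit N.det ∧ ∃ c : (ValSubring v hv)ˣ, ∀ i,
      bind₁ A (linForms N i) = C (c : ValSubring v hv) * bind₁ (linForms N) (B i) := by
  obtain ⟨c, hc⟩ := hM
  have hNM : N.map (ValSubring v hv).subtype = (M : Matrix (Fin 2) (Fin 2) k) := by
    ext i j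
    exact hN i j
  have hdetk : (N.det : k) = (M : Matrix (Fin 2) (Fin 2) k).det := by
    rw [← hNM]
    exact RingHom.map_det (ValSubring v hv).subtype N
  have hdet : N.det ≠ 0 := by
    intro h
    rw [h] at hdetk
    exact (M.isUnit.map Matrix.detMonoidHom).ne_zero hdetk.symm
  have key : ∀ i, bind₁ (fun i => MvPolynomial.map (ValSubring v hv).subtype (A i))
        (linForms (N.map (ValSubring v hv).subtype) i) =
      C ((cΦ : k) * c * (cΨ : k)⁻¹) * bind₁ (linForms (N.map (ValSubring v hv).subtype))
        (MvPolynomial.map (ValSubring v hv).subtype (B i)) := by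
    intro i
    rw [hNM, hB, map_smul, smul_eq_C_mul, ← mul_assoc, ← C_mul]
    have e : (cΦ : k) * c * (cΨ : k)⁻¹ * cΨ = cΦ * c := by
      rw [mul_assoc, inv_mul_cancel₀ cΨ.ne_zero, mul_one]
    rw [e, C_mul, mul_assoc, ← hc i, bind₁_linForms, bind₁_linForms, hA, hA, smul_eq_C_mul,
      smul_eq_C_mul]
    ring
  obtain ⟨hu, hvc⟩ := good_core π hker hd A B hAh hBh hAred hBred N hprim hdet _ key
  refine ⟨hu, ?_⟩
  generalize (cΦ : k) * c * (cΨ : k)⁻¹ = c' at *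
  have hcu : IsUnit (⟨c', hvc.le⟩ : ValSubring v hv) := (val_isUnit_iff _).2 hvc
  refine ⟨hcu.unit, fun i => ?_⟩
  apply MvPolynomial.map_injective (ValSubring v hv).subtype Subtype.val_injective
  have hlin : ∀ i, MvPolynomial.map (ValSubring v hv).subtype (linForms N i) =
      linForms (N.map (ValSubring v hv).subtype) i := by
    intro i
    simp [linForms]
  rw [map_bind₁, hlin, map_mul, map_bind₁, map_C]
  simp only [hlin]
  exact key i

theorem exists_pow (π : ValSubring v hv →+* 𝔽) (d : ℕ) (hd : 2 ≤ d)
    (Φ : Fin 2 → MvPolynomial (Fin 2) k)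
    (hhomΦ : ∀ i, (Φ i).IsHomogeneous d) (hrelΦ : IsRelPrime (Φ 0) (Φ 1))
    (hcard : ∀ p : ℕ, p.Prime → CharP 𝔽 p → ¬ p ∣ Nat.card ↥(AutSet Φ))
    (Q : GL (Fin 2) k) (hQ : MatConj Φ Φ Q) :
    ∃ n : ℕ, ((n + 1 : ℕ) : 𝔽) ≠ 0 ∧ ((Q : Matrix (Fin 2) (Fin 2) k) ^ (n + 1)) 0 1 = 0 ∧
      ((Q : Matrix (Fin 2) (Fin 2) k) ^ (n + 1)) 1 0 = 0 ∧
      ((Q : Matrix (Fin 2) (Fin 2) k) ^ (n + 1)) 0 0 =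
        ((Q : Matrix (Fin 2) (Fin 2) k) ^ (n + 1)) 1 1 := by
  obtain ⟨p, hp⟩ := CharP.exists 𝔽
  rcases CharP.char_is_prime_or_zero 𝔽 p with hpp | rfl
  · have hnd := hcard p hpp hp
    obtain ⟨n, hn⟩ : ∃ n, Nat.card ↥(AutSet Φ) = n + 1 := by
      refine Nat.exists_eq_succ_of_ne_zero ?_
      intro h
      rw [h] at hnd
      exact hnd (dvd_zero _)
    refine ⟨n, ?_, ?_⟩
    · rw [← hn, Ne, CharP.cast_eq_zero_iff 𝔽 p]
      exact hnd
    · have h1 : (⟨PGL2.mk Q, ⟨Q, rfl, hQ⟩⟩ : autSubgroup Φ hhomΦ) ^ Nat.card (autSubgroup Φ hhomΦ) = 1 :=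
        pow_card_eq_one'
      have h2 : Nat.card (autSubgroup Φ hhomΦ) = n + 1 := hn
      rw [h2] at h1
      have h3 : PGL2.mk (Q ^ (n + 1)) = PGL2.mk 1 := congrArg Subtype.val h1
      obtain ⟨t, ht⟩ := (mk_eq_iff _ _).1 h3.symm
      simp only [Units.val_pow_eq_pow_val, Units.val_one] at ht
      rw [ht, ht, ht, ht]
      simp
  · have : CharZero 𝔽 := CharP.charP_to_charZero 𝔽
    have : CharZero (ValSubring v hv) := ⟨fun a b h => by
      have := congrArg π h
      simpa using this⟩
    have : CharZero k := ⟨fun a b h => by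
      have : ((a : ValSubring v hv)) = b := Subtype.ext (by push_cast; exact h)
      exact_mod_cast this⟩
    have : CharZero (AlgebraicClosure k) :=
      charZero_of_injective_algebraMap (algebraMap k (AlgebraicClosure k)).injective
    obtain ⟨m, hm, t, ht⟩ := finite_order (algebraMap k (AlgebraicClosure k)) hd hhomΦ hrelΦ Q hQ
    obtain ⟨n, rfl⟩ : ∃ n, m = n + 1 := ⟨m - 1, by omega⟩
    refine ⟨n, Nat.cast_ne_zero.2 (by omega), ?_⟩
    have hinj := (algebraMap k (AlgebraicClosure k)).injective
    have hmap : ∀ i j, algebraMap k (AlgebraicClosure k)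
        (((Q : Matrix (Fin 2) (Fin 2) k) ^ (n + 1)) i j) =
          (t • (1 : Matrix (Fin 2) (Fin 2) (AlgebraicClosure k))) i j := by
      intro i j
      rw [← ht]
      exact congrFun (congrFun (map_pow (RingHom.mapMatrix (algebraMap k (AlgebraicClosure k)))
        (Q : Matrix (Fin 2) (Fin 2) k) (n + 1)) i) j
    refine ⟨hinj ?_, hinj ?_, hinj ?_⟩
    · rw [hmap]; simp
    · rw [hmap]; simp
    · rw [hmap, hmap]; simp

theorem red_inj (π : ValSubring v hv →+* 𝔽) (d : ℕ) (hd : 2 ≤ d)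
    (Φ Ψ : Fin 2 → MvPolynomial (Fin 2) k)
    (hhomΦ : ∀ i, (Φ i).IsHomogeneous d) (hrelΦ : IsRelPrime (Φ 0) (Φ 1))
    (hcard : ∀ p : ℕ, p.Prime → CharP 𝔽 p → ¬ p ∣ Nat.card ↥(AutSet Φ))
    (M₁ M₂ : GL (Fin 2) k) (hM₁ : MatConj Φ Ψ M₁) (hM₂ : MatConj Φ Ψ M₂)
    (G₁ G₂ : GL (Fin 2) (ValSubring v hv))
    (h₁ : M₁ = Matrix.GeneralLinearGroup.map (ValSubring v hv).subtype G₁)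
    (h₂ : M₂ = Matrix.GeneralLinearGroup.map (ValSubring v hv).subtype G₂)
    (h : PGL2.mk (Matrix.GeneralLinearGroup.map π G₁) =
      PGL2.mk (Matrix.GeneralLinearGroup.map π G₂)) : PGL2.mk M₁ = PGL2.mk M₂ := by
  have h' := QuotientGroup.eq.1 h
  rw [← map_inv, ← map_mul, Matrix.GeneralLinearGroup.center_eq_range_scalar] at h'
  obtain ⟨t, ht⟩ := h'
  set P := G₁⁻¹ * G₂ with hP
  have hQ : MatConj Φ Φ (M₁⁻¹ * M₂) := hM₂.mul hM₁.inv
  have hQP : M₁⁻¹ * M₂ = Matrix.GeneralLinearGroup.map (ValSubring v hv).subtype P := by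
    rw [hP, map_mul, map_inv, h₁, h₂]
  have hQP' : ((M₁⁻¹ * M₂ : GL (Fin 2) k) : Matrix (Fin 2) (Fin 2) k) =
      (ValSubring v hv).subtype.mapMatrix (P : Matrix (Fin 2) (Fin 2) (ValSubring v hv)) := by
    rw [hQP]; rfl
  obtain ⟨n, hn, h01, h10, h00⟩ := exists_pow π d hd Φ hhomΦ hrelΦ hcard _ hQ
  rw [hQP', ← map_pow] at h01 h10 h00
  obtain ⟨p01, p10, p00⟩ := scalar_of_pow π (P : Matrix (Fin 2) (Fin 2) (ValSubring v hv)) (t : 𝔽)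
    t.ne_zero (by
      have := congrArg (fun G : GL (Fin 2) 𝔽 => (G : Matrix (Fin 2) (Fin 2) 𝔽)) ht.symm
      have e : (P : Matrix (Fin 2) (Fin 2) (ValSubring v hv)).map π =
        ((Matrix.GeneralLinearGroup.map π P : GL (Fin 2) 𝔽) : Matrix (Fin 2) (Fin 2) 𝔽) := rfl
      rw [e]
      refine this.trans ?_
      ext i j
      simp [Matrix.smul_apply, Matrix.one_apply, Matrix.diagonal_apply]) n hn
    (Subtype.ext h01) (Subtype.ext h10) (Subtype.ext h00)
  refine QuotientGroup.eq.2 ?_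
  rw [Matrix.GeneralLinearGroup.mem_center_iff_val_mem_range_scalar]
  refine ⟨((P : Matrix (Fin 2) (Fin 2) (ValSubring v hv)) 0 0 : k), ?_⟩
  rw [hQP']
  ext i j
  obtain rfl | rfl : i = 0 ∨ i = 1 := by omega
  · obtain rfl | rfl : j = 0 ∨ j = 1 := by omega
    · simp
    · simp [p01]
  · obtain rfl | rfl : j = 0 ∨ j = 1 := by omega
    · simp [p10]
    · simp [p00]

end Val2

/-- Reduction Lemma, Part II, for conjugating sets. -/
theorem conj_reduction_lemma
    {k 𝔽 : Type*} [Field k] [Field 𝔽]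
    (v : AbsoluteValue k ℝ) (hv : IsNonarchimedean v)
    (π : ValSubring v hv →+* 𝔽) (hπ : Function.Surjective π)
    (hker : ∀ x : ValSubring v hv, π x = 0 ↔ v (x : k) < 1)
    (d : ℕ) (hd : 2 ≤ d)
    (Φ Ψ : Fin 2 → MvPolynomial (Fin 2) k)
    (hhomΦ : ∀ i, (Φ i).IsHomogeneous d) (hrelΦ : IsRelPrime (Φ 0) (Φ 1))
    (hhomΨ : ∀ i, (Ψ i).IsHomogeneous d) (hrelΨ : IsRelPrime (Ψ 0) (Ψ 1))
    -- good reduction data for φ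
    (cΦ : kˣ) (A : Fin 2 → MvPolynomial (Fin 2) (ValSubring v hv))
    (hA : ∀ i, MvPolynomial.map (ValSubring v hv).subtype (A i) = (cΦ : k) • Φ i)
    (hAred : IsRelPrime (MvPolynomial.map π (A 0)) (MvPolynomial.map π (A 1)))
    -- good reduction data for ψ
    (cΨ : kˣ) (B : Fin 2 → MvPolynomial (Fin 2) (ValSubring v hv))
    (hB : ∀ i, MvPolynomial.map (ValSubring v hv).subtype (B i) = (cΨ : k) • Ψ i)
    (hBred : IsRelPrime (MvPolynomial.map π (B 0)) (MvPolynomial.map π (B 1))) :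
    (∀ s ∈ ConjSet Φ Ψ, MatGoodRed v hv s) ∧
    ∃ red : PGL2 k → PGL2 𝔽,
      -- red maps Conj_{φ,ψ}(k) into Conj_{φ̃,ψ̃}(𝔽)
      (∀ s ∈ ConjSet Φ Ψ,
        red s ∈ ConjSet (fun i => MvPolynomial.map π (A i))
          (fun i => MvPolynomial.map π (B i))) ∧
      -- red is induced by reduction of matrix entries
      (∀ s ∈ ConjSet Φ Ψ, ∀ (M : GL (Fin 2) k)
          (N : Matrix (Fin 2) (Fin 2) (ValSubring v hv)),
        PGL2.mk M = s →
        (∀ i j, (N i j : k) = (M : Matrix (Fin 2) (Fin 2) k) i j) →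
        IsUnit N.det →
        ∀ N' : GL (Fin 2) 𝔽, (N' : Matrix (Fin 2) (Fin 2) 𝔽) = N.map π →
          red s = PGL2.mk N') ∧
      -- if the order of Aut_φ(k) is prime to char 𝔽, red is injective
      ((∀ p : ℕ, p.Prime → CharP 𝔽 p → ¬ p ∣ Nat.card ↥(AutSet Φ)) →
        Set.InjOn red (ConjSet Φ Ψ)) := by
  have hinjS : Function.Injective (ValSubring v hv).subtype := Subtype.val_injective
  have hAh : ∀ i, (A i).IsHomogeneous d := fun i =>
    IsHomogeneous.of_map hinjS (by rw [hA i, smul_eq_C_mul]; exact (hhomΦ i).C_mul _)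
  have hBh : ∀ i, (B i).IsHomogeneous d := fun i =>
    IsHomogeneous.of_map hinjS (by rw [hB i, smul_eq_C_mul]; exact (hhomΨ i).C_mul _)
  have main := reduce π hker d hd Φ Ψ cΦ A hA hAred cΨ B hB hBred hAh hBh
  -- good representatives
  have rep : ∀ s ∈ ConjSet Φ Ψ, ∃ (M : GL (Fin 2) k)
      (N : Matrix (Fin 2) (Fin 2) (ValSubring v hv)), PGL2.mk M = s ∧
      (∀ i j, (N i j : k) = (M : Matrix (Fin 2) (Fin 2) k) i j) ∧ MatConj Φ Ψ M ∧
      IsUnit N.det ∧ ∃ c : (ValSubring v hv)ˣ, ∀ i,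
        bind₁ A (linForms N i) = C (c : ValSubring v hv) * bind₁ (linForms N) (B i) := by
    rintro s hs
    obtain ⟨M₀, rfl, -⟩ := id hs
    obtain ⟨M, N, hM, hN, hp⟩ := exists_scale π hker M₀
    rw [← hM] at hs
    have hc := conjSet_rep hhomΦ M hs
    exact ⟨M, N, hM, hN, hc, main M N hN hp hc⟩
  have good : ∀ s ∈ ConjSet Φ Ψ, MatGoodRed v hv s := by
    intro s hs
    obtain ⟨M, N, hM, hN, -, hu, -⟩ := rep s hs
    exact ⟨M, N, hM, hN, hu⟩
  refine ⟨good, ?_⟩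
  have hred : ∀ s : PGL2 k, ∃ r : PGL2 𝔽, ∀ (M : GL (Fin 2) k)
      (N : Matrix (Fin 2) (Fin 2) (ValSubring v hv)), PGL2.mk M = s →
      (∀ i j, (N i j : k) = (M : Matrix (Fin 2) (Fin 2) k) i j) → IsUnit N.det →
      ∀ N' : GL (Fin 2) 𝔽, (N' : Matrix (Fin 2) (Fin 2) 𝔽) = N.map π → r = PGL2.mk N' := by
    intro s
    by_cases hs : MatGoodRed v hv s
    · obtain ⟨M, N, hM, hN, hu⟩ := hs
      have huM : IsUnit N := (Matrix.isUnit_iff_isUnit_det N).2 hu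
      refine ⟨PGL2.mk (Matrix.GeneralLinearGroup.map π huM.unit), ?_⟩
      intro M₂ N₂ hM₂ hN₂ hu₂ N' hN'
      exact red_wd π M M₂ N N₂ (hM.trans hM₂.symm) hN hN₂ hu hu₂ _ _ rfl hN'
    · exact ⟨1, fun M N hM hN hu => absurd ⟨M, N, hM, hN, hu⟩ hs⟩
  choose red hr using hred
  refine ⟨red, ?_, fun s _ => hr s, ?_⟩
  · intro s hs
    obtain ⟨M, N, hM, hN, -, hu, c, hc⟩ := rep s hs
    have huM : IsUnit N := (Matrix.isUnit_iff_isUnit_det N).2 hu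
    refine ⟨Matrix.GeneralLinearGroup.map π huM.unit, (hr s M N hM hN hu _ rfl).symm,
      Units.map π.toMonoidHom c, fun i => ?_⟩
    have hlin : ∀ i, MvPolynomial.map π (linForms N i) = linForms (N.map π) i := by
      intro i
      simp [linForms]
    have e := congrArg (MvPolynomial.map π) (hc i)
    rw [map_bind₁, hlin, map_mul, map_bind₁, map_C] at e
    simp only [hlin] at e
    exact e
  · intro hcard s₁ hs₁ s₂ hs₂ h
    obtain ⟨M₁, N₁, hM₁, hN₁, hc₁, hu₁, -⟩ := rep s₁ hs₁
    obtain ⟨M₂, N₂, hM₂, hN₂, hc₂, hu₂, -⟩ := rep s₂ hs₂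
    have huM₁ : IsUnit N₁ := (Matrix.isUnit_iff_isUnit_det N₁).2 hu₁
    have huM₂ : IsUnit N₂ := (Matrix.isUnit_iff_isUnit_det N₂).2 hu₂
    rw [← hM₁, ← hM₂]
    refine red_inj π d hd Φ Ψ hhomΦ hrelΦ hcard M₁ M₂ hc₁ hc₂ huM₁.unit huM₂.unit ?_ ?_ ?_
    · ext i j
      exact (hN₁ i j).symm
    · ext i j
      exact (hN₂ i j).symm
    · rw [← hr s₁ M₁ N₁ hM₁ hN₁ hu₁ _ rfl, ← hr s₂ M₂ N₂ hM₂ hN₂ hu₂ _ rfl, h]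
end
end

section
/- Let K be a number field and let φ, ψ ∈ K(z) be rational functions of degree d ≥ 2. Define S₀ = {2} ∪ {p odd prime : (p − 1)/2 divides [K : ℚ] and p divides d(d² − 1)}, and let S be the finite set of places of K consisting of the places of bad reduction for φ or for ψ together with the places dividing a prime in S₀. If Conj_{φ,ψ}(K) is nonempty, then for every finite place v of K outside S, the reduction map red_v : Conj_{φ,ψ}(K) → Conj_{φ,ψ}(𝔽_v) is a well-defined injection of sets. -/
open MvPolynomial

noncomputable section

open NumberField IsDedekindDomain

/-- Homogeneous polynomials scale. -/
lemma hom_scale {R S : Type*} [CommRing R] [CommRing S] [Algebra R S] {d : ℕ}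
    {F : MvPolynomial (Fin 2) R} (hF : F.IsHomogeneous d) (a : S) (x : Fin 2 → S) :
    aeval (a • x) F = a ^ d * aeval x F := by
  rw [aeval_def, aeval_def, eval₂_eq', eval₂_eq', Finset.mul_sum]
  refine Finset.sum_congr rfl fun m hm => ?_
  have hm' := hF (mem_support_iff.mp hm)
  simp only [Pi.smul_apply, smul_eq_mul, mul_pow, Finset.prod_mul_distrib]
  have : m 0 + m 1 = d := by
    rw [← hm', Finsupp.weight_apply, Finsupp.sum_fintype _ _ (by simp)]; simp
  rw [Fin.prod_univ_two, Fin.prod_univ_two, ← pow_add, this]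
  ring

lemma dehom_natDegree {k : Type*} [Field k] {d : ℕ} {F : MvPolynomial (Fin 2) k}
    (hF : F.IsHomogeneous d) :
    (aeval ![Polynomial.X, 1] F : Polynomial k).natDegree ≤ d := by
  rw [aeval_def, eval₂_eq']
  refine Polynomial.natDegree_sum_le_of_forall_le _ _ fun m hm => ?_
  have hm' := hF (mem_support_iff.mp hm)
  have : m 0 + m 1 = d := by
    rw [← hm', Finsupp.weight_apply, Finsupp.sum_fintype _ _ (by simp)]; simp
  rw [Fin.prod_univ_two, ← Polynomial.C_eq_algebraMap]
  simp only [Matrix.cons_val_zero, Matrix.cons_val_one, one_pow, mul_one]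
  exact (Polynomial.natDegree_C_mul_X_pow_le _ _).trans (by omega)

/-- Coprime binary forms have no common zero over an algebraic extension. -/
lemma relprime_ne_zero {k L : Type*} [Field k] [Field L] [Algebra k L] [Algebra.IsAlgebraic k L]
    {d : ℕ} {F : Fin 2 → MvPolynomial (Fin 2) k} (hF : ∀ i, (F i).IsHomogeneous d)
    (hrel : IsRelPrime (F 0) (F 1)) (x : Fin 2 → L) (hx : x ≠ 0) :
    ∃ i, aeval x (F i) ≠ 0 := by
  by_contra! hcon
  obtain ⟨D, hDu, hD⟩ : ∃ D : MvPolynomial (Fin 2) k, ¬ IsUnit D ∧ ∀ i, D ∣ F i := by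
    by_cases hb : x 1 = 0
    · refine ⟨X 1, ?_, fun i => ?_⟩
      · intro h
        have := h.map (constantCoeff (R := k) (σ := Fin 2))
        simp at this
      · have ha : x 0 ≠ 0 := fun ha => hx (by ext j; fin_cases j <;> simp [ha, hb])
        have hxt : x = x 0 • ![1, 0] := by
          ext j; fin_cases j <;> simp [hb]
        have h3 := hcon i
        rw [hxt, hom_scale (hF i)] at h3
        have h4 := (mul_eq_zero.mp h3).resolve_left (pow_ne_zero _ ha)
        have hdeg := dehom_natDegree (hF i)
        set f : Polynomial k := aeval ![Polynomial.X, 1] (F i) with hf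
        have h1 : f.homogenize d = F i := Polynomial.homogenize_eq_of_isHomogeneous (hF i) hf.symm
        have h5 : f.coeff d = 0 := by
          rw [← h1, Polynomial.homogenize, map_sum, Finset.sum_eq_single (d, 0)] at h4
          · simpa [aeval_monomial, Finsupp.update_eq_add_single] using h4
          · rintro ⟨a, b⟩ hab hne
            rw [Finset.HasAntidiagonal.mem_antidiagonal] at hab
            have : b ≠ 0 := by rintro rfl; simp at hab; simp [hab] at hne
            simp [aeval_monomial, Finsupp.update_eq_add_single, Finsupp.prod_add_index', pow_add, this]
          · simp
        by_cases hf0 : f = 0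
        · rw [← h1, hf0]; simp
        have hlt : f.natDegree < d := lt_of_le_of_ne hdeg (by
          rintro h; rw [← h] at h5; simp [hf0] at h5)
        have h6 := Polynomial.homogenize_mul (1 : Polynomial k) f (m := 1) (n := d - 1)
          (by simp) (by omega)
        rw [one_mul, Nat.add_sub_cancel' (by omega), h1] at h6
        rw [h6]; simp
    · set t : L := x 0 / x 1 with ht
      have hintg : IsIntegral k t := Algebra.IsIntegral.isIntegral t
      have hxt : x = x 1 • ![t, 1] := by
        ext j; fin_cases j <;> simp [ht]; field_simp
      refine ⟨(minpoly k t).homogenize (minpoly k t).natDegree, ?_, fun i => ?_⟩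
      · intro h
        have h2 := h.map (aeval ![t, 1] : MvPolynomial (Fin 2) k →ₐ[k] L)
        rw [Polynomial.aeval_homogenize_of_eq_one le_rfl _ (by simp)] at h2
        simp at h2
      · have hdeg := dehom_natDegree (hF i)
        set f : Polynomial k := aeval ![Polynomial.X, 1] (F i) with hf
        have h1 : f.homogenize d = F i := Polynomial.homogenize_eq_of_isHomogeneous (hF i) hf.symm
        have h2 : Polynomial.aeval t f = 0 := by
          have h3 := hcon i
          rw [hxt, hom_scale (hF i)] at h3
          have h4 := (mul_eq_zero.mp h3).resolve_left (pow_ne_zero _ hb)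
          rw [← h1, Polynomial.aeval_homogenize_of_eq_one hdeg _ (by simp)] at h4
          simpa using h4
        obtain ⟨r, hr⟩ := minpoly.dvd k t h2
        by_cases hf0 : f = 0
        · rw [← h1, hf0]; simp
        have hm0 : minpoly k t ≠ 0 := minpoly.ne_zero hintg
        have hr0 : r ≠ 0 := by rintro rfl; simp at hr; exact hf0 hr
        have hdd : (minpoly k t).natDegree + r.natDegree ≤ d := by
          rw [← Polynomial.natDegree_mul hm0 hr0, ← hr]; exact hdeg
        have h6 := Polynomial.homogenize_mul (minpoly k t) r (m := (minpoly k t).natDegree)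
          (n := d - (minpoly k t).natDegree) le_rfl (by omega)
        rw [← hr, Nat.add_sub_cancel' (by omega), h1] at h6
        exact ⟨_, h6⟩
  exact hDu (hrel (hD 0) (hD 1))

/-- Evaluation of a pair of forms at a vector. -/
def evv {R S : Type*} [CommRing R] [CommRing S] [Algebra R S]
    (Φ : Fin 2 → MvPolynomial (Fin 2) R) (x : Fin 2 → S) : Fin 2 → S :=
  fun i => aeval x (Φ i)

lemma evv_smul {R S : Type*} [CommRing R] [CommRing S] [Algebra R S] {d : ℕ}
    {Φ : Fin 2 → MvPolynomial (Fin 2) R} (hΦ : ∀ i, (Φ i).IsHomogeneous d) (a : S)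
    (x : Fin 2 → S) : evv Φ (a • x) = a ^ d • evv Φ x := by
  ext i; simp [evv, hom_scale (hΦ i)]

lemma unip_false {K L : Type*} [Field K] [Field L] [CharZero L] [Algebra K L]
    {d : ℕ} (hd : 2 ≤ d)
    {Φ : Fin 2 → MvPolynomial (Fin 2) K} (hΦ : ∀ i, (Φ i).IsHomogeneous d)
    (hnz : ∀ x : Fin 2 → L, x ≠ 0 → evv Φ x ≠ 0)
    (U : Matrix (Fin 2) (Fin 2) L) (hU : (U - 1) * (U - 1) = 0) (hU1 : U ≠ 1)
    (c : L) (hc : ∀ x : Fin 2 → L, U.mulVec (evv Φ x) = c • evv Φ (U.mulVec x)) : False := by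
  obtain ⟨q, hq⟩ : ∃ q : Fin 2 → L, (U - 1).mulVec q ≠ 0 := by
    by_contra! h
    apply hU1
    have : U - 1 = 0 := Matrix.ext_of_mulVec_single fun i => by rw [h, Matrix.zero_mulVec]
    exact sub_eq_zero.mp this
  set p := (U - 1).mulVec q with hp
  have key : ∀ w : Fin 2 → L, (U - 1).mulVec ((U - 1).mulVec w) = 0 := fun w => by
    rw [Matrix.mulVec_mulVec, hU, Matrix.zero_mulVec]
  have hUw : ∀ w : Fin 2 → L, U.mulVec w = w + (U - 1).mulVec w := fun w => by
    rw [Matrix.sub_mulVec, Matrix.one_mulVec]; abel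
  have hUp : U.mulVec p = p := by rw [hUw, hp, key, add_zero]
  have hc1 : c = 1 := by
    have h1 := hc p
    rw [hUp, hUw] at h1
    have h2 : (U - 1).mulVec (evv Φ p) = (c - 1) • evv Φ p := by
      rw [sub_smul, one_smul, ← h1]; abel
    have h3 := key (evv Φ p)
    rw [h2, Matrix.mulVec_smul, h2, smul_smul] at h3
    have h4 := (smul_eq_zero.mp h3).resolve_right (hnz p hq)
    exact sub_eq_zero.mp (mul_self_eq_zero.mp h4)
  subst hc1
  simp only [one_smul] at hc
  set r := (U - 1).mulVec (evv Φ q) with hr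
  have hn : ∀ n : ℕ, evv Φ (q + (n : L) • p) = evv Φ q + (n : L) • r := by
    intro n
    induction n with
    | zero => simp
    | succ n ih =>
      have h1 : q + ((n + 1 : ℕ) : L) • p = U.mulVec (q + (n : L) • p) := by
        rw [Matrix.mulVec_add, Matrix.mulVec_smul, hUp, hUw q, ← hp]
        push_cast; rw [add_smul, one_smul]; abel
      rw [h1, ← hc, ih, Matrix.mulVec_add, Matrix.mulVec_smul, hUw, hUw r, ← hr, hr, key]
      push_cast; rw [add_smul, one_smul]; abel
  apply hnz p hq
  ext i
  let f : Polynomial L := aeval (fun j => Polynomial.X * Polynomial.C (q j) + Polynomial.C (p j)) (Φ i)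
    - Polynomial.X ^ d * Polynomial.C (evv Φ q i) - Polynomial.X ^ (d - 1) * Polynomial.C (r i)
  have hf : ∀ s : L, f.eval s = evv Φ (s • q + p) i - s ^ d * evv Φ q i - s ^ (d - 1) * r i := by
    intro s
    have : Polynomial.eval s (aeval (fun j => Polynomial.X * Polynomial.C (q j) + Polynomial.C (p j)) (Φ i))
       = aeval (s • q + p) (Φ i) := by
      have h := MvPolynomial.map_aeval (fun j => Polynomial.X * Polynomial.C (q j) + Polynomial.C (p j))
        (Polynomial.evalRingHom s) (Φ i)
      rw [Polynomial.coe_evalRingHom] at h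
      rw [h, aeval_def, coe_eval₂Hom]
      congr 1
      · ext a; simp [Polynomial.algebraMap_apply]
      · ext j; simp; ring
    simp only [f, Polynomial.eval_sub, Polynomial.eval_mul, Polynomial.eval_pow, Polynomial.eval_X,
      Polynomial.eval_C, this, evv]
  have hf0 : f = 0 := by
    refine Polynomial.eq_zero_of_infinite_isRoot f
      (Set.Infinite.mono (s := Set.range fun n : ℕ => ((n + 1 : ℕ) : L)⁻¹) ?_
        (Set.infinite_range_of_injective ?_))
    · rintro _ ⟨n, rfl⟩
      have hne : ((n + 1 : ℕ) : L) ≠ 0 := by exact_mod_cast Nat.succ_ne_zero n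
      set m : L := ((n + 1 : ℕ) : L) with hm
      have h1 : m⁻¹ • q + p = m⁻¹ • (q + m • p) := by
        rw [smul_add, smul_smul, inv_mul_cancel₀ hne, one_smul]
      have hdd : d = (d - 1) + 1 := by omega
      simp only [Set.mem_ofPred_eq, Polynomial.IsRoot, hf]
      rw [h1, evv_smul hΦ, hm, hn, ← hm]
      simp only [Pi.smul_apply, Pi.add_apply, smul_eq_mul]
      have : (m⁻¹) ^ d = m⁻¹ ^ (d - 1) * m⁻¹ := by rw [← pow_succ, ← hdd]
      rw [this]
      field_simp
      ring
    · intro a b hab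
      simpa using hab
  have := hf 0
  rw [hf0] at this
  simp only [Polynomial.eval_zero, zero_smul, zero_add] at this
  rw [zero_pow (by omega), zero_pow (by omega)] at this
  simpa using this.symm

/-- The eigenvalues of a nontrivial automorphism. -/
lemma eigen_root {K L : Type*} [Field K] [Field L] [CharZero L] [IsAlgClosed L] [Algebra K L]
    {d : ℕ} (hd : 2 ≤ d)
    {Φ : Fin 2 → MvPolynomial (Fin 2) K} (hΦ : ∀ i, (Φ i).IsHomogeneous d)
    (hnz : ∀ x : Fin 2 → L, x ≠ 0 → evv Φ x ≠ 0)
    (P : Matrix (Fin 2) (Fin 2) L) (hP : P.det ≠ 0) (hPs : ∀ a : L, P ≠ a • 1)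
    (c : L) (hc : ∀ x : Fin 2 → L, P.mulVec (evv Φ x) = c • evv Φ (P.mulVec x)) :
    ∃ α β : L, α ≠ β ∧ α + β = P.trace ∧ α * β = P.det ∧
      ∃ n, 0 < n ∧ n ∣ d * (d ^ 2 - 1) ∧ (β / α) ^ n = 1 := by
  obtain ⟨α, hα⟩ : ∃ α : L, α * α - P.trace * α + P.det = 0 := by
    obtain ⟨s, hs⟩ := IsAlgClosed.exists_eq_mul_self (P.trace * P.trace - 4 * P.det)
    refine ⟨(P.trace + s) / 2, ?_⟩
    field_simp
    linear_combination -hs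
  obtain ⟨β, hβ⟩ : ∃ β, β = P.trace - α := ⟨_, rfl⟩
  have hsum : α + β = P.trace := by rw [hβ]; ring
  have hprod : α * β = P.det := by rw [hβ]; linear_combination -hα
  have hα0 : α ≠ 0 := fun h => hP (by rw [← hprod, h, zero_mul])
  have hβ0 : β ≠ 0 := fun h => hP (by rw [← hprod, h, mul_zero])
  have hCH : (P - α • 1) * (P - β • 1) = 0 := by
    rw [Matrix.trace_fin_two] at hsum
    rw [Matrix.det_fin_two] at hprod
    ext i j
    fin_cases i <;> fin_cases j <;> simp [Matrix.mul_apply, Fin.sum_univ_two]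
    · linear_combination (P 0 0) * (-hsum) + hprod
    · linear_combination (P 0 1) * (-hsum)
    · linear_combination (P 1 0) * (-hsum)
    · linear_combination (P 1 1) * (-hsum) + hprod
  have hCH' : (P - β • 1) * (P - α • 1) = 0 := by
    rw [← hCH]; simp only [mul_sub, sub_mul, mul_smul_comm, smul_mul_assoc, mul_one, one_mul]
    module
  have heig : ∀ (γ : L) (x : Fin 2 → L), x ≠ 0 → P.mulVec x = γ • x → γ = α ∨ γ = β := by
    intro γ x hx hγ
    have h := congrArg (fun M => M.mulVec x) hCH
    simp only [← Matrix.mulVec_mulVec, Matrix.sub_mulVec, Matrix.smul_mulVec, Matrix.one_mulVec,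
      hγ, Matrix.zero_mulVec, Matrix.mulVec_sub, Matrix.mulVec_smul] at h
    have h' : ((γ - α) * (γ - β)) • x = 0 := by
      rw [← h]; module
    rcases mul_eq_zero.mp ((smul_eq_zero.mp h').resolve_right hx) with h | h
    · left; exact sub_eq_zero.mp h
    · right; exact sub_eq_zero.mp h
  have hvec : ∀ a b : L, (P - a • 1) * (P - b • 1) = 0 →
      ∃ p : Fin 2 → L, p ≠ 0 ∧ P.mulVec p = a • p := by
    intro a b hab
    by_contra! h
    apply hPs b
    rw [← sub_eq_zero]
    refine Matrix.ext_of_mulVec_single fun i => ?_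
    rw [Matrix.zero_mulVec]
    by_contra hne
    apply h _ hne
    have := congrArg (fun M => M.mulVec (Pi.single i 1)) hab
    simp only [← Matrix.mulVec_mulVec, Matrix.zero_mulVec] at this
    rw [Matrix.sub_mulVec, Matrix.smul_mulVec, Matrix.one_mulVec] at this
    exact sub_eq_zero.mp this
  have hab : α ≠ β := by
    intro hab
    refine unip_false hd hΦ hnz (α⁻¹ • P) ?_ ?_ (c * α⁻¹ * (α ^ d)) ?_
    · have : α⁻¹ • P - 1 = α⁻¹ • (P - α • 1) := by
        rw [smul_sub, smul_smul, inv_mul_cancel₀ hα0, one_smul]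
      rw [this, smul_mul_smul_comm]
      rw [← hab] at hCH
      rw [hCH, smul_zero]
    · intro h
      apply hPs α
      rw [← h, smul_smul, mul_inv_cancel₀ hα0, one_smul]
    · intro x
      rw [Matrix.smul_mulVec, Matrix.smul_mulVec, evv_smul hΦ, hc, smul_smul, smul_smul]
      congr 1
      rw [mul_comm c, mul_assoc, mul_assoc, ← mul_pow, mul_inv_cancel₀ hα0]
      simp
  refine ⟨α, β, hab, hsum, hprod, ?_⟩
  have hev : ∀ (γ : L) (x : Fin 2 → L), x ≠ 0 → P.mulVec x = γ • x →
      c * γ ^ d = α ∨ c * γ ^ d = β := by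
    intro γ x hx hγ
    refine heig _ (evv Φ x) (hnz x hx) ?_
    rw [hc, hγ, evv_smul hΦ, smul_smul]
  obtain ⟨p, hp, hPp⟩ := hvec α β hCH
  obtain ⟨q, hq, hPq⟩ := hvec β α hCH'
  have e1 := hev α p hp hPp
  have e2 := hev β q hq hPq
  have hc0 : c ≠ 0 := by
    rintro rfl
    simp [hα0.symm, hβ0.symm] at e1
  have hfac : d * (d ^ 2 - 1) = d * ((d + 1) * (d - 1)) := by
    rw [← Nat.sq_sub_sq d 1]
  rw [hfac]
  have hdiv : (β / α) ^ d = (c * β ^ d) / (c * α ^ d) := by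
    rw [div_pow]; field_simp
  have hddd : d = (d - 1) + 1 := by omega
  rcases e1 with e1 | e1 <;> rcases e2 with e2 | e2
  · exact ⟨d, by omega, Dvd.intro _ rfl, by rw [hdiv, e1, e2, div_self hα0]⟩
  · refine ⟨d - 1, by omega, ⟨d * (d + 1), by ring⟩, ?_⟩
    rw [e1, e2, hddd, pow_succ] at hdiv
    exact mul_right_cancel₀ (div_ne_zero hβ0 hα0) (by simpa using hdiv)
  · refine ⟨d + 1, by omega, ⟨d * (d - 1), by ring⟩, ?_⟩
    rw [pow_succ, hdiv, e1, e2]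
    field_simp
  · exact ⟨d, by omega, Dvd.intro _ rfl, by rw [hdiv, e1, e2, div_self hβ0]⟩

/-- A root of unity congruent to one modulo a prime above `v` contradicts `v ∉ S`. -/
lemma root_case {K : Type*} [Field K] [NumberField K] {L : Type*} [Field L]
    [Algebra K L] [Algebra.IsAlgebraic K L] (d : ℕ)
    (v : HeightOneSpectrum (𝓞 K))
    (hS₀ : ¬ (ringChar (𝓞 K ⧸ v.asIdeal) = 2 ∨
      ((ringChar (𝓞 K ⧸ v.asIdeal)).Prime ∧ Odd (ringChar (𝓞 K ⧸ v.asIdeal)) ∧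
        (ringChar (𝓞 K ⧸ v.asIdeal) - 1) / 2 ∣ Module.finrank ℚ K ∧
        ringChar (𝓞 K ⧸ v.asIdeal) ∣ d * (d ^ 2 - 1))))
    (P : Matrix (Fin 2) (Fin 2) (𝓞 K)) (hPdet : P.det ∉ v.asIdeal)
    (z : 𝓞 K) (hPz : ∀ i j, P i j - (z • (1 : Matrix (Fin 2) (Fin 2) (𝓞 K))) i j ∈ v.asIdeal)
    (α β : L) (hne : α ≠ β)
    (hsum : α + β = algebraMap (𝓞 K) (L) P.trace)
    (hprod : α * β = algebraMap (𝓞 K) (L) P.det)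
    (n : ℕ) (hn : 0 < n) (hnd : n ∣ d * (d ^ 2 - 1)) (hroot : (β / α) ^ n = 1) : False := by
  have hdet0 : P.det ≠ 0 := fun h => hPdet (h ▸ v.asIdeal.zero_mem)
  have hinj : Function.Injective (algebraMap (𝓞 K) L) := by
    rw [IsScalarTower.algebraMap_eq (𝓞 K) K L]
    exact (algebraMap K L).injective.comp RingOfIntegers.coe_injective
  have hα0 : α ≠ 0 := by
    rintro rfl
    rw [zero_mul] at hprod
    exact hdet0 (hinj (by rw [← hprod, map_zero]))
  set l : L := β / α with hl
  have hβ : β = l * α := by rw [hl]; field_simp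
  have hl1 : l ≠ 1 := by
    intro h; rw [h, one_mul] at hβ; exact hne hβ.symm
  -- primitive root of prime order
  have hfin : IsOfFinOrder l := isOfFinOrder_iff_pow_eq_one.mpr ⟨n, hn, hroot⟩
  set o := orderOf l with ho
  have ho1 : o ≠ 1 := by rw [ho, Ne, orderOf_eq_one_iff]; exact hl1
  obtain ⟨q, hq, hqo⟩ := Nat.exists_prime_and_dvd ho1
  have hopos : 0 < o := hfin.orderOf_pos
  set ζ := l ^ (o / q) with hζ
  have hprim : IsPrimitiveRoot ζ q := by
    have h := IsPrimitiveRoot.orderOf l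
    exact h.pow hopos (Nat.div_mul_cancel hqo).symm
  have hqd : q ∣ d * (d ^ 2 - 1) :=
    (hqo.trans (orderOf_dvd_of_pow_eq_one hroot)).trans hnd
  -- integrality
  have hαeq : α * α - algebraMap (𝓞 K) L P.trace * α + algebraMap (𝓞 K) L P.det = 0 := by
    rw [← hsum, ← hprod]; ring
  have hαint : IsIntegral ℤ α := by
    have h1 : IsIntegral (𝓞 K) α := by
      refine ⟨Polynomial.X ^ 2 - Polynomial.C P.trace * Polynomial.X + Polynomial.C P.det, ?_, ?_⟩
      · monicity!
      · simp only [Polynomial.eval₂_add, Polynomial.eval₂_sub, Polynomial.eval₂_mul,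
          Polynomial.eval₂_X, Polynomial.eval₂_C, Polynomial.eval₂_X_pow]
        rw [← hαeq]; ring
    exact isIntegral_trans α h1
  have hlint : IsIntegral ℤ l := by
    refine IsIntegral.of_pow hn ?_
    rw [hroot]; exact isIntegral_one
  let α' : 𝓞 L := ⟨α, hαint⟩
  let l' : 𝓞 L := ⟨l, hlint⟩
  obtain ⟨Q, -, hQp, hQ⟩ := Ideal.exists_ideal_over_prime_of_isIntegral (S := 𝓞 L) v.asIdeal ⊥ (by
    rw [← RingHom.ker_eq_comap_bot, RingOfIntegers.ker_algebraMap_eq_bot]; exact bot_le)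
  have hmem : ∀ x : 𝓞 K, algebraMap (𝓞 K) (𝓞 L) x ∈ Q ↔ x ∈ v.asIdeal := fun x => by
    rw [← hQ]; rfl
  let π := Ideal.Quotient.mk Q
  let ρ : 𝓞 K →+* 𝓞 L ⧸ Q := π.comp (algebraMap (𝓞 K) (𝓞 L))
  have hρ : ∀ x, ρ x = 0 ↔ x ∈ v.asIdeal := fun x => by
    rw [← hmem]; exact Ideal.Quotient.eq_zero_iff_mem
  have hρP : ∀ i j, ρ (P i j) = ρ ((z • (1 : Matrix (Fin 2) (Fin 2) (𝓞 K))) i j) := fun i j => by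
    rw [← sub_eq_zero, ← map_sub, hρ]; exact hPz i j
  have htr : ρ P.trace = 2 * ρ z := by
    rw [Matrix.trace_fin_two, map_add, hρP, hρP]; simp; ring
  have hdt : ρ P.det = ρ z * ρ z := by
    rw [Matrix.det_fin_two]; simp only [map_sub, map_mul, hρP]; simp
  have hz : ρ z ≠ 0 := by
    intro h; rw [h, zero_mul, hρ] at hdt; exact hPdet hdt
  have e1 : l' * α' + α' = algebraMap (𝓞 K) (𝓞 L) P.trace := by
    apply RingOfIntegers.ext
    change l * α + α = algebraMap (𝓞 L) L (algebraMap (𝓞 K) (𝓞 L) P.trace)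
    rw [← IsScalarTower.algebraMap_apply, ← hsum, ← hβ, add_comm]
  have e2 : α' * (l' * α') = algebraMap (𝓞 K) (𝓞 L) P.det := by
    apply RingOfIntegers.ext
    change α * (l * α) = algebraMap (𝓞 L) L (algebraMap (𝓞 K) (𝓞 L) P.det)
    rw [← IsScalarTower.algebraMap_apply, ← hprod, ← hβ]
  have f1 : π l' * π α' + π α' = 2 * ρ z := by
    rw [← htr, ← map_mul, ← map_add, e1]; rfl
  have f2 : π α' * (π l' * π α') = ρ z * ρ z := by
    rw [← hdt, ← map_mul, ← map_mul, e2]; rfl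
  have g1 : π α' = ρ z := by
    rw [← sub_eq_zero, ← mul_self_eq_zero (M₀ := 𝓞 L ⧸ Q)]
    linear_combination π α' * f1 - f2
  have g2 : π l' = 1 := by
    rw [g1] at f1
    apply mul_right_cancel₀ hz
    linear_combination f1
  -- q ∈ v
  have hqv : (q : 𝓞 K) ∈ v.asIdeal := by
    have h1 : ∑ i ∈ Finset.range q, (l' ^ (o / q)) ^ i = 0 := by
      apply RingOfIntegers.coe_injective
      simp only [map_sum, map_pow, map_zero]
      exact hprim.geom_sum_eq_zero hq.one_lt
    have h2 := congrArg π h1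
    simp only [map_sum, map_pow, g2, one_pow, map_zero, Finset.sum_const, Finset.card_range,
      nsmul_eq_mul, mul_one] at h2
    rw [← hρ, map_natCast]; exact h2
  have hchar : ringChar (𝓞 K ⧸ v.asIdeal) = q := by
    have h1 : ringChar (𝓞 K ⧸ v.asIdeal) ∣ q := by
      apply ringChar.dvd
      rw [← map_natCast (Ideal.Quotient.mk v.asIdeal), Ideal.Quotient.eq_zero_iff_mem]
      exact hqv
    rcases (Nat.dvd_prime hq).mp h1 with h | h
    · exfalso
      have h3 := ringChar.spec (𝓞 K ⧸ v.asIdeal) 1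
      rw [h] at h3
      have h4 : Ideal.Quotient.mk v.asIdeal 1 = 0 := by simpa using h3.mpr dvd_rfl
      rw [Ideal.Quotient.eq_zero_iff_mem] at h4
      exact v.isPrime.ne_top ((Ideal.eq_top_iff_one _).mpr h4)
    · exact h
  rw [hchar] at hS₀
  push Not at hS₀
  obtain ⟨hq2, hS⟩ := hS₀
  have hodd := hq.odd_of_ne_two hq2
  refine hS hq hodd ?_ hqd
  -- degree
  have hαK : IsIntegral K α := Algebra.IsIntegral.isIntegral α
  have hdeg : Module.finrank K (IntermediateField.adjoin K {α}) ≤ 2 := by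
    rw [IntermediateField.adjoin.finrank hαK]
    let f : Polynomial K := Polynomial.X ^ 2 - Polynomial.C (algebraMap (𝓞 K) K P.trace) * Polynomial.X +
      Polynomial.C (algebraMap (𝓞 K) K P.det)
    have hfm : f.Monic := by simp only [f]; monicity!
    have hfd : f.natDegree = 2 := by simp only [f]; compute_degree!
    rw [← hfd]
    refine Polynomial.natDegree_le_of_dvd (minpoly.dvd K α ?_) hfm.ne_zero
    simp only [f, map_add, map_sub, map_mul, Polynomial.aeval_X, Polynomial.aeval_C, map_pow]
    rw [← IsScalarTower.algebraMap_apply, ← IsScalarTower.algebraMap_apply, ← hαeq]; ring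
  set E := IntermediateField.adjoin K {α} with hE
  have hαE : α ∈ E := IntermediateField.mem_adjoin_simple_self K α
  have hβE : β ∈ E := by
    have : β = algebraMap K L (algebraMap (𝓞 K) K P.trace) - α := by
      rw [← IsScalarTower.algebraMap_apply, ← hsum]; ring
    rw [this]; exact E.sub_mem (E.algebraMap_mem _) hαE
  have hζE : ζ ∈ E := by
    rw [hζ, hl]; exact _root_.pow_mem (E.div_mem hβE hαE) _
  have : FiniteDimensional K E := IntermediateField.adjoin.finiteDimensional hαK
  have : FiniteDimensional ℚ E := FiniteDimensional.trans ℚ K E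
  have hprimE : IsPrimitiveRoot (⟨ζ, hζE⟩ : E) q :=
    IsPrimitiveRoot.of_map_of_injective (f := E.val) hprim E.val.injective
  have hmin : (minpoly ℚ (⟨ζ, hζE⟩ : E)).natDegree = q - 1 := by
    rw [← Polynomial.cyclotomic_eq_minpoly_rat hprimE hq.pos, Polynomial.natDegree_cyclotomic,
      Nat.totient_prime hq]
  have hdvd : q - 1 ∣ Module.finrank ℚ E := by
    rw [← hmin]
    exact minpoly.degree_dvd (Algebra.IsIntegral.isIntegral _)
  rw [← Module.finrank_mul_finrank ℚ K E] at hdvd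
  have hpos : 0 < Module.finrank K E := Module.finrank_pos
  obtain ⟨k, hk⟩ := hodd
  have hk' : q - 1 = 2 * k := by omega
  have : (q - 1) / 2 = k := by omega
  rw [this]
  rw [hk'] at hdvd
  interval_cases h : Module.finrank K E
  · rw [mul_one] at hdvd; exact (Dvd.intro_left _ rfl).trans hdvd
  · rw [mul_comm] at hdvd; exact Nat.dvd_of_mul_dvd_mul_left two_pos (by rwa [mul_comm k 2, mul_comm _ 2] at hdvd)

lemma PGL2_mk_eq_iff {R : Type*} [CommRing R] (M M' : GL (Fin 2) R) :
    PGL2.mk M = PGL2.mk M' ↔ ∃ a : R, (M' : Matrix (Fin 2) (Fin 2) R) = a • (M : Matrix _ _ R) := by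
  unfold PGL2.mk
  rw [QuotientGroup.eq, Matrix.GeneralLinearGroup.mem_center_iff_val_mem_range_scalar]
  constructor
  · rintro ⟨a, ha⟩
    refine ⟨a, ?_⟩
    have h1 : (M' : Matrix (Fin 2) (Fin 2) R) = M * (M⁻¹ * M' : GL (Fin 2) R).val := by
      rw [← Units.val_mul, mul_inv_cancel_left]
    rw [h1, ← ha]
    ext i j; simp [Matrix.mul_diagonal, mul_comm]
  · rintro ⟨a, ha⟩
    refine ⟨a, ?_⟩
    rw [Units.val_mul, ha, Matrix.mul_smul, ← Units.val_mul, inv_mul_cancel]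
    ext i j; simp [Matrix.diagonal_apply, Matrix.one_apply]

/-- Homogeneous form of conjugation, for a matrix and a given scalar. -/
def PolyConj {R : Type*} [CommRing R] (Φ Ψ : Fin 2 → MvPolynomial (Fin 2) R)
    (M : Matrix (Fin 2) (Fin 2) R) (c : R) : Prop :=
  ∀ i, bind₁ Φ (linForms M i) = C c * bind₁ (linForms M) (Ψ i)

lemma PolyConj.ev {R S : Type*} [CommRing R] [CommRing S] [Algebra R S]
    {Φ Ψ : Fin 2 → MvPolynomial (Fin 2) R} {M : Matrix (Fin 2) (Fin 2) R} {c : R}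
    (h : PolyConj Φ Ψ M c) (x : Fin 2 → S) :
    (M.map (algebraMap R S)).mulVec (evv Φ x) =
      algebraMap R S c • evv Ψ ((M.map (algebraMap R S)).mulVec x) := by
  ext i
  have h1 := congrArg (aeval x) (h i)
  rw [aeval_bind₁, map_mul, aeval_bind₁] at h1
  simp only [linForms, map_add, map_mul, aeval_X, aeval_C] at h1
  simp only [Matrix.mulVec, dotProduct, Fin.sum_univ_two, Matrix.map_apply, evv, Pi.smul_apply,
    smul_eq_mul]
  rw [h1]
  congr 3
  ext j
  simp [Matrix.mulVec, dotProduct, Fin.sum_univ_two]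

lemma map_linForms {R S : Type*} [CommRing R] [CommRing S] (f : R →+* S)
    (M : Matrix (Fin 2) (Fin 2) R) (i : Fin 2) :
    map f (linForms M i) = linForms (M.map f) i := by
  simp [linForms]

lemma linForms_smul {R : Type*} [CommRing R] (M : Matrix (Fin 2) (Fin 2) R) (u : R) :
    linForms (u • M) = (C u : MvPolynomial (Fin 2) R) • linForms M := by
  ext1 i; simp [linForms]; ring

lemma PolyConj.scale {K : Type*} [Field K] {d : ℕ} {Φ Ψ : Fin 2 → MvPolynomial (Fin 2) K}
    (hΨ : ∀ i, (Ψ i).IsHomogeneous d)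
    {M : Matrix (Fin 2) (Fin 2) K} {c : K} (hc : c ≠ 0) (h : PolyConj Φ Ψ M c)
    (a b u : Kˣ) : ∃ c' : K, c' ≠ 0 ∧
      PolyConj (fun i => (a : K) • Φ i) (fun i => (b : K) • Ψ i) ((u : K) • M) c' := by
  refine ⟨u * a * c * (b : K)⁻¹ * ((u : K) ^ d)⁻¹, ?_, fun i => ?_⟩
  · simp [hc]
  · have h1 := h i
    have h2 : bind₁ (linForms ((u : K) • M)) (Ψ i) = C (u : K) ^ d * bind₁ (linForms M) (Ψ i) := by
      rw [linForms_smul]; exact hom_scale (hΨ i) _ _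
    have h3 : bind₁ (linForms ((u : K) • M)) ((b : K) • Ψ i) =
        C (b : K) * (C (u : K) ^ d * bind₁ (linForms M) (Ψ i)) := by
      rw [smul_eq_C_mul, map_mul, bind₁_C_right, h2]
    change bind₁ (fun i => (a : K) • Φ i) (linForms ((u : K) • M) i) = C _ *
      bind₁ (linForms ((u : K) • M)) ((b : K) • Ψ i)
    rw [h3]
    clear h2 h3
    generalize bind₁ (linForms M) (Ψ i) = T at h1 ⊢
    simp only [linForms, map_add, map_mul, bind₁_C_right, bind₁_X_right, Matrix.smul_apply,
      smul_eq_mul, smul_eq_C_mul] at h1 ⊢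
    have hb : C (b : K)⁻¹ * C (b : K) = (1 : MvPolynomial (Fin 2) K) := by
      rw [← C_mul]; simp
    have hu : C ((u : K) ^ d)⁻¹ * C (u : K) ^ d = (1 : MvPolynomial (Fin 2) K) := by
      rw [← C_pow, ← C_mul, inv_mul_cancel₀ (by simp)]; simp
    linear_combination C (u : K) * C (a : K) * h1 -
      C (u : K) * C (a : K) * C c * T * (C (b : K)⁻¹ * C (b : K)) * hu -
      C (u : K) * C (a : K) * C c * T * hb

section local_part

variable {K : Type*} [Field K] [NumberField K] (v : HeightOneSpectrum (𝓞 K))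

lemma residue_unit {x : 𝓞 K} (hx : x ∉ v.asIdeal) : IsUnit (Ideal.Quotient.mk v.asIdeal x) := by
  let _ := Ideal.Quotient.field v.asIdeal
  rw [isUnit_iff_ne_zero, Ne, Ideal.Quotient.eq_zero_iff_mem]
  exact hx

lemma prim_evv {d : ℕ} {A : Fin 2 → MvPolynomial (Fin 2) (𝓞 K)}
    (hA : ∀ i, (A i).IsHomogeneous d)
    (hAred : IsRelPrime
      (MvPolynomial.map (Ideal.Quotient.mk v.asIdeal) (A 0))
      (MvPolynomial.map (Ideal.Quotient.mk v.asIdeal) (A 1)))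
    (x : Fin 2 → 𝓞 K) (hx : ∃ j, x j ∉ v.asIdeal) : ∃ i, evv A x i ∉ v.asIdeal := by
  let _ := Ideal.Quotient.field v.asIdeal
  obtain ⟨j, hj⟩ := hx
  obtain ⟨i, hi⟩ := relprime_ne_zero (k := 𝓞 K ⧸ v.asIdeal) (L := 𝓞 K ⧸ v.asIdeal)
    (F := fun i => MvPolynomial.map (Ideal.Quotient.mk v.asIdeal) (A i))
    (fun i => (hA i).map _) hAred (fun j => Ideal.Quotient.mk v.asIdeal (x j)) (by
      intro h
      exact hj (Ideal.Quotient.eq_zero_iff_mem.mp (congrFun h j)))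
  refine ⟨i, fun h => hi ?_⟩
  rw [← Ideal.Quotient.eq_zero_iff_mem] at h
  rw [← h, evv, aeval_def, aeval_def, eval₂_map, ← coe_eval₂Hom, ← coe_eval₂Hom, map_eval₂Hom]
  rfl

lemma normalize_matrix (M : GL (Fin 2) K) : ∃ (N : Matrix (Fin 2) (Fin 2) (𝓞 K)) (u : Kˣ),
    (∀ i j, algebraMap (𝓞 K) K (N i j) = (u : K) * (M : Matrix (Fin 2) (Fin 2) K) i j) ∧
    ∃ i j, N i j ∉ v.asIdeal := by
  obtain ⟨⟨i₀, j₀⟩, hmax⟩ := Finite.exists_max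
    (fun ij : Fin 2 × Fin 2 => v.valuation K ((M : Matrix (Fin 2) (Fin 2) K) ij.1 ij.2))
  set m := (M : Matrix (Fin 2) (Fin 2) K) i₀ j₀ with hm
  have hm0 : m ≠ 0 := by
    intro h
    have h0 : (M : Matrix (Fin 2) (Fin 2) K) = 0 := by
      ext i j
      have := hmax (i, j)
      simp only [h, map_zero] at this
      simpa using this
    exact M.ne_zero h0
  have hle : ∀ ij : Fin 2 × Fin 2, ∃ (n : 𝓞 K) (e : v.asIdeal.primeCompl),
      ((M : Matrix (Fin 2) (Fin 2) K) ij.1 ij.2 / m) * algebraMap (𝓞 K) K e =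
        algebraMap (𝓞 K) K n := by
    intro ij
    apply v.exists_primeCompl_mul_eq_of_integer
    rw [map_div₀]
    exact div_le_one_of_le₀ (hmax ij) zero_le
  choose n e hne using hle
  set D : v.asIdeal.primeCompl := ∏ ij, e ij with hD
  have hD0 : algebraMap (𝓞 K) K D ≠ 0 := by
    rw [RingOfIntegers.coe_ne_zero_iff]
    intro h; exact D.2 (h ▸ v.asIdeal.zero_mem)
  have hex : ∀ i j, ∃ N : 𝓞 K, algebraMap (𝓞 K) K N =
      (algebraMap (𝓞 K) K D / m) * (M : Matrix (Fin 2) (Fin 2) K) i j := by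
    intro i j
    obtain ⟨r, hr⟩ := Finset.dvd_prod_of_mem e (Finset.mem_univ (i, j))
    refine ⟨n (i, j) * r, ?_⟩
    rw [map_mul, ← hne (i, j), hD, hr]
    simp only [Submonoid.coe_mul, map_mul]
    ring
  choose N hN using hex
  refine ⟨N, Units.mk0 (algebraMap (𝓞 K) K D / m) (div_ne_zero hD0 hm0), hN, i₀, j₀, ?_⟩
  have : N i₀ j₀ = D := by
    apply RingOfIntegers.coe_injective
    rw [hN, ← hm]; field_simp
  rw [this]; exact D.2

lemma evv_coe {R S : Type*} [CommRing R] [CommRing S] [Algebra R S]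
    (A : Fin 2 → MvPolynomial (Fin 2) R) (x : Fin 2 → R) (i : Fin 2) :
    evv A (fun j => algebraMap R S (x j)) i = algebraMap R S (evv A x i) := by
  simp only [evv]
  exact aeval_algebraMap_apply S x (A i)

lemma good_red {d : ℕ} (hd : 2 ≤ d) {A B : Fin 2 → MvPolynomial (Fin 2) (𝓞 K)}
    (hB : ∀ i, (B i).IsHomogeneous d)
    (hAp : ∀ x : Fin 2 → 𝓞 K, (∃ j, x j ∉ v.asIdeal) → ∃ i, evv A x i ∉ v.asIdeal)
    (hBp : ∀ x : Fin 2 → 𝓞 K, (∃ j, x j ∉ v.asIdeal) → ∃ i, evv B x i ∉ v.asIdeal)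
    (N : Matrix (Fin 2) (Fin 2) (𝓞 K)) (hN : ∃ i j, N i j ∉ v.asIdeal) (hN0 : N.det ≠ 0)
    (c : K) (h : ∀ (x : Fin 2 → 𝓞 K) i, algebraMap (𝓞 K) K (N.mulVec (evv A x) i) =
      c * algebraMap (𝓞 K) K (evv B (N.mulVec x) i)) :
    N.det ∉ v.asIdeal ∧ v.valuation K c = 1 := by
  obtain ⟨i₀, j₀, h0⟩ := hN
  have hC : v.valuation K c ≤ 1 := by
    obtain ⟨i, hi⟩ := hBp (N.mulVec (Pi.single j₀ 1)) ⟨i₀, by simpa using h0⟩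
    have h1 := congrArg (v.valuation K) (h (Pi.single j₀ 1) i)
    rw [map_mul, v.valuation_eq_one_iff_notMem.mpr hi, mul_one] at h1
    rw [← h1]; exact v.valuation_le_one _
  obtain ⟨i, j, hij⟩ : ∃ i j, N.adjugate j i ∉ v.asIdeal := by
    rw [Matrix.adjugate_fin_two]
    fin_cases i₀ <;> fin_cases j₀
    · exact ⟨1, 1, by simpa using h0⟩
    · exact ⟨1, 0, by simpa using h0⟩
    · exact ⟨0, 1, by simpa using h0⟩
    · exact ⟨0, 0, by simpa using h0⟩
  set p : Fin 2 → 𝓞 K := N.adjugate.mulVec (Pi.single i 1) with hp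
  have hpp : ∃ j, p j ∉ v.asIdeal := ⟨j, by simpa [hp] using hij⟩
  have hNp : N.mulVec p = N.det • Pi.single i 1 := by
    rw [hp, Matrix.mulVec_mulVec, Matrix.mul_adjugate, Matrix.smul_mulVec, Matrix.one_mulVec]
  obtain ⟨k, hk⟩ := hAp p hpp
  set w := N.adjugate.mulVec (evv B (Pi.single i 1)) k with hw
  have key : algebraMap (𝓞 K) K (N.det * evv A p k) =
      c * (algebraMap (𝓞 K) K N.det ^ d * algebraMap (𝓞 K) K w) := by
    have e1 : N.det * evv A p k = N.adjugate.mulVec (N.mulVec (evv A p)) k := by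
      rw [Matrix.mulVec_mulVec, Matrix.adjugate_mul, Matrix.smul_mulVec, Matrix.one_mulVec]; rfl
    rw [e1, hw]
    simp only [Matrix.mulVec, dotProduct, map_sum, map_mul]
    rw [Finset.mul_sum, Finset.mul_sum]
    refine Finset.sum_congr rfl fun t _ => ?_
    have := h p t
    rw [hNp, evv_smul hB] at this
    simp only [Matrix.mulVec, dotProduct, map_sum, map_mul, Pi.smul_apply, smul_eq_mul,
      map_pow] at this
    rw [this]; ring
  have kv := congrArg (v.valuation K) key
  rw [map_mul, map_mul, v.valuation_eq_one_iff_notMem.mpr hk, mul_one, map_mul, map_mul,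
    map_pow] at kv
  have hw1 : v.valuation K (algebraMap (𝓞 K) K w) ≤ 1 := v.valuation_le_one _
  have hD1 : v.valuation K (algebraMap (𝓞 K) K N.det) ≤ 1 := v.valuation_le_one _
  have hD0 : v.valuation K (algebraMap (𝓞 K) K N.det) ≠ 0 := by
    rw [Valuation.ne_zero_iff, RingOfIntegers.coe_ne_zero_iff]; exact hN0
  rw [← v.valuation_eq_one_iff_notMem (K := K)]
  set D := v.valuation K (algebraMap (𝓞 K) K N.det)
  set W := v.valuation K (algebraMap (𝓞 K) K w)
  set c' := v.valuation K c
  have k2 : 1 = c' * (D ^ (d - 1) * W) := by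
    apply mul_left_cancel₀ hD0
    rw [mul_one]
    conv_lhs => rw [kv]
    have : D ^ d = D * D ^ (d - 1) := by rw [← pow_succ']; congr 1; omega
    rw [this]; ac_rfl
  have hDp : D ^ (d - 1) ≤ D := pow_le_of_le_one zero_le hD1 (by omega)
  have hDp1 : D ^ (d - 1) * W ≤ D := (mul_le_of_le_one_right' hw1).trans hDp
  constructor
  · refine le_antisymm hD1 ?_
    rw [k2]; exact (mul_le_of_le_one_left' hC).trans hDp1
  · refine le_antisymm hC ?_
    conv_lhs => rw [k2]
    exact mul_le_of_le_one_right' (hDp1.trans hD1)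

end local_part

section final_part

variable {K : Type*} [Field K] [NumberField K] (v : HeightOneSpectrum (𝓞 K))

lemma unit_frac {c : K} (hc : v.valuation K c = 1) : ∃ a b : 𝓞 K, a ∉ v.asIdeal ∧ b ∉ v.asIdeal ∧
    c * algebraMap (𝓞 K) K b = algebraMap (𝓞 K) K a := by
  obtain ⟨a, b, hab⟩ := v.exists_primeCompl_mul_eq_of_integer c hc.le
  refine ⟨a, b, ?_, b.2, hab⟩
  have h := congrArg (v.valuation K) hab
  rw [map_mul, hc, one_mul, v.valuation_eq_one_iff_notMem.mpr b.2] at h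
  exact v.valuation_eq_one_iff_notMem.mp h.symm

lemma map_conj_left {R S : Type*} [CommRing R] [CommRing S] (f : R →+* S)
    (A : Fin 2 → MvPolynomial (Fin 2) R) (N : Matrix (Fin 2) (Fin 2) R) (i : Fin 2) :
    map f (bind₁ A (linForms N i)) = bind₁ (fun i => map f (A i)) (linForms (N.map f) i) := by
  rw [map_bind₁, map_linForms]

lemma map_conj_right {R S : Type*} [CommRing R] [CommRing S] (f : R →+* S)
    (p : MvPolynomial (Fin 2) R) (N : Matrix (Fin 2) (Fin 2) R) :
    map f (bind₁ (linForms N) p) = bind₁ (linForms (N.map f)) (map f p) := by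
  rw [map_bind₁]
  congr 2
  ext1 i
  rw [map_linForms]

lemma poly_reduce {A B : Fin 2 → MvPolynomial (Fin 2) (𝓞 K)} {N : Matrix (Fin 2) (Fin 2) (𝓞 K)}
    {c : K} (hc : v.valuation K c = 1)
    (h : PolyConj (fun i => map (algebraMap (𝓞 K) K) (A i)) (fun i => map (algebraMap (𝓞 K) K) (B i))
      (N.map (algebraMap (𝓞 K) K)) c)
    (N' : GL (Fin 2) (𝓞 K ⧸ v.asIdeal))
    (hN' : (N' : Matrix (Fin 2) (Fin 2) (𝓞 K ⧸ v.asIdeal)) = N.map (Ideal.Quotient.mk v.asIdeal)) :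
    MatConj (fun i => map (Ideal.Quotient.mk v.asIdeal) (A i))
      (fun i => map (Ideal.Quotient.mk v.asIdeal) (B i)) N' := by
  obtain ⟨a, b, ha, hb, hab⟩ := unit_frac v hc
  obtain ⟨ua, hua⟩ := residue_unit v ha
  obtain ⟨ub, hub⟩ := residue_unit v hb
  have hO : ∀ i, C b * bind₁ A (linForms N i) = C a * bind₁ (linForms N) (B i) := by
    intro i
    apply map_injective _ (RingOfIntegers.coe_injective (K := K))
    rw [map_mul, map_mul, map_conj_left, map_conj_right, h i, map_C, map_C, ← hab, C_mul]
    ring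
  refine ⟨ub⁻¹ * ua, fun i => ?_⟩
  have h1 := congrArg (map (Ideal.Quotient.mk v.asIdeal)) (hO i)
  rw [map_mul, map_mul, map_conj_left, map_conj_right, map_C, map_C, ← hua, ← hub] at h1
  rw [hN', Units.val_mul, C_mul, mul_assoc, ← h1, ← mul_assoc, ← C_mul, Units.inv_mul, C_1, one_mul]

/-- Everything needed about one element of the conjugation set. -/
lemma local_main {d : ℕ} (hd : 2 ≤ d)
    {Φ Ψ : Fin 2 → MvPolynomial (Fin 2) K}
    (hhomΦ : ∀ i, (Φ i).IsHomogeneous d) (hhomΨ : ∀ i, (Ψ i).IsHomogeneous d)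
    (cΦ : Kˣ) (A : Fin 2 → MvPolynomial (Fin 2) (𝓞 K))
    (hA : ∀ i, MvPolynomial.map (algebraMap (𝓞 K) K) (A i) = (cΦ : K) • Φ i)
    (hAred : IsRelPrime
      (MvPolynomial.map (Ideal.Quotient.mk v.asIdeal) (A 0))
      (MvPolynomial.map (Ideal.Quotient.mk v.asIdeal) (A 1)))
    (cΨ : Kˣ) (B : Fin 2 → MvPolynomial (Fin 2) (𝓞 K))
    (hB : ∀ i, MvPolynomial.map (algebraMap (𝓞 K) K) (B i) = (cΨ : K) • Ψ i)
    (hBred : IsRelPrime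
      (MvPolynomial.map (Ideal.Quotient.mk v.asIdeal) (B 0))
      (MvPolynomial.map (Ideal.Quotient.mk v.asIdeal) (B 1)))
    (s : PGL2 K) (hs : s ∈ ConjSet Φ Ψ) :
    ∃ (M : GL (Fin 2) K) (N : Matrix (Fin 2) (Fin 2) (𝓞 K)) (u : Kˣ)
      (N' : GL (Fin 2) (𝓞 K ⧸ v.asIdeal)) (c : K),
      PGL2.mk M = s ∧
      (∀ i j, algebraMap (𝓞 K) K (N i j) = (u : K) * (M : Matrix (Fin 2) (Fin 2) K) i j) ∧
      N.det ∉ v.asIdeal ∧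
      (N' : Matrix (Fin 2) (Fin 2) (𝓞 K ⧸ v.asIdeal)) = N.map (Ideal.Quotient.mk v.asIdeal) ∧
      MatConj (fun i => map (Ideal.Quotient.mk v.asIdeal) (A i))
        (fun i => map (Ideal.Quotient.mk v.asIdeal) (B i)) N' ∧ c ≠ 0 ∧
      PolyConj (fun i => map (algebraMap (𝓞 K) K) (A i)) (fun i => map (algebraMap (𝓞 K) K) (B i))
        (N.map (algebraMap (𝓞 K) K)) c := by
  obtain ⟨M, hM, c₀, hc₀⟩ := hs
  obtain ⟨N, u, hN, hprim⟩ := normalize_matrix v M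
  have hNM : N.map (algebraMap (𝓞 K) K) = (u : K) • (M : Matrix (Fin 2) (Fin 2) K) := by
    ext i j; simp [hN]
  obtain ⟨c, hc, hconj⟩ := PolyConj.scale hhomΨ (c := (c₀ : K)) c₀.ne_zero hc₀ cΦ cΨ u
  have hAh : ∀ i, (A i).IsHomogeneous d := fun i => by
    refine IsHomogeneous.of_map (RingOfIntegers.coe_injective (K := K)) ?_
    rw [hA, smul_eq_C_mul]; simpa using (isHomogeneous_C _ (cΦ : K)).mul (hhomΦ i)
  have hBh : ∀ i, (B i).IsHomogeneous d := fun i => by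
    refine IsHomogeneous.of_map (RingOfIntegers.coe_injective (K := K)) ?_
    rw [hB, smul_eq_C_mul]; simpa using (isHomogeneous_C _ (cΨ : K)).mul (hhomΨ i)
  have hpc : PolyConj (fun i => map (algebraMap (𝓞 K) K) (A i))
      (fun i => map (algebraMap (𝓞 K) K) (B i)) (N.map (algebraMap (𝓞 K) K)) c := by
    simp only [hA, hB, hNM]; exact hconj
  have hN0 : N.det ≠ 0 := by
    intro h
    have h1 : (N.map (algebraMap (𝓞 K) K)).det = 0 := by
      have := RingHom.map_det (algebraMap (𝓞 K) K) N
      rw [h, map_zero] at this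
      exact this.symm
    rw [hNM, Matrix.det_smul] at h1
    have h2 : (M : Matrix (Fin 2) (Fin 2) K).det ≠ 0 :=
      ((Matrix.isUnit_iff_isUnit_det _).mp M.isUnit).ne_zero
    simp [h2] at h1
  have hev : ∀ (C : Fin 2 → MvPolynomial (Fin 2) (𝓞 K)) (x : Fin 2 → K),
      evv (fun i => map (algebraMap (𝓞 K) K) (C i)) x = evv C x := fun C x => by
    ext i; simp [evv, aeval_map_algebraMap]
  obtain ⟨hdet, hval⟩ := good_red v hd hBh (prim_evv v hAh hAred) (prim_evv v hBh hBred) N hprim hN0 c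
    (by
      intro x i
      have h1 := congrFun (hpc.ev (S := K) (fun j => algebraMap (𝓞 K) K (x j))) i
      simp only [hev, Algebra.algebraMap_self, RingHom.id_apply] at h1
      have h2 : ((N.map (algebraMap (𝓞 K) K)).map (RingHom.id K)) = N.map (algebraMap (𝓞 K) K) := by
        ext; simp
      have h3 : (N.map (algebraMap (𝓞 K) K)).mulVec (fun j => algebraMap (𝓞 K) K (x j)) =
          fun j => algebraMap (𝓞 K) K (N.mulVec x j) := by
        ext j; simp [Matrix.mulVec, dotProduct]
      rw [h2, h3, Pi.smul_apply, smul_eq_mul, evv_coe] at h1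
      rw [← h1]
      simp [Matrix.mulVec, dotProduct, evv_coe])
  have hunit : IsUnit (N.map (Ideal.Quotient.mk v.asIdeal)) := by
    rw [Matrix.isUnit_iff_isUnit_det]
    have := RingHom.map_det (Ideal.Quotient.mk v.asIdeal) N
    rw [RingHom.mapMatrix_apply] at this
    rw [← this]; exact residue_unit v hdet
  obtain ⟨N', hN'⟩ := hunit
  exact ⟨M, N, u, N', c, hM, hN, hdet, hN', poly_reduce v hval hpc N' hN', hc, hpc⟩

/-- Independence of the chosen integral model. -/
lemma red_unique (M₁ M₂ : GL (Fin 2) K) (N₁ N₂ : Matrix (Fin 2) (Fin 2) (𝓞 K)) (u₁ u₂ : Kˣ)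
    (hM : PGL2.mk M₁ = PGL2.mk M₂)
    (h₁ : ∀ i j, algebraMap (𝓞 K) K (N₁ i j) = (u₁ : K) * (M₁ : Matrix (Fin 2) (Fin 2) K) i j)
    (h₂ : ∀ i j, algebraMap (𝓞 K) K (N₂ i j) = (u₂ : K) * (M₂ : Matrix (Fin 2) (Fin 2) K) i j)
    (hd₁ : N₁.det ∉ v.asIdeal) (hd₂ : N₂.det ∉ v.asIdeal)
    (N₁' N₂' : GL (Fin 2) (𝓞 K ⧸ v.asIdeal))
    (hN₁ : (N₁' : Matrix (Fin 2) (Fin 2) (𝓞 K ⧸ v.asIdeal)) = N₁.map (Ideal.Quotient.mk v.asIdeal))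
    (hN₂ : (N₂' : Matrix (Fin 2) (Fin 2) (𝓞 K ⧸ v.asIdeal)) = N₂.map (Ideal.Quotient.mk v.asIdeal)) :
    PGL2.mk N₁' = PGL2.mk N₂' := by
  rw [PGL2_mk_eq_iff] at hM ⊢
  obtain ⟨a, ha⟩ := hM
  set w : K := u₂ * a * (u₁ : K)⁻¹ with hw
  have hent : ∀ i j, algebraMap (𝓞 K) K (N₂ i j) = w * algebraMap (𝓞 K) K (N₁ i j) := by
    intro i j
    rw [h₁, h₂, ha, hw, Matrix.smul_apply, smul_eq_mul]
    field_simp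
  have hval : v.valuation K w = 1 := by
    have hdd : algebraMap (𝓞 K) K N₂.det = w ^ 2 * algebraMap (𝓞 K) K N₁.det := by
      rw [Matrix.det_fin_two, Matrix.det_fin_two]
      simp only [map_sub, map_mul, hent]; ring
    have := congrArg (v.valuation K) hdd
    rw [map_mul, v.valuation_eq_one_iff_notMem.mpr hd₁, v.valuation_eq_one_iff_notMem.mpr hd₂,
      mul_one, map_pow] at this
    exact (pow_eq_one_iff.mp this.symm).resolve_right (by norm_num)
  obtain ⟨n, e, hn, he, hne⟩ := unit_frac v hval
  obtain ⟨ue, hue⟩ := residue_unit v he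
  refine ⟨(ue⁻¹ : (𝓞 K ⧸ v.asIdeal)ˣ) * Ideal.Quotient.mk v.asIdeal n, ?_⟩
  rw [hN₁, hN₂]
  ext i j
  have h3 : e * N₂ i j = n * N₁ i j := by
    apply RingOfIntegers.coe_injective
    rw [map_mul, map_mul, hent, ← hne]; ring
  have h4 := congrArg (Ideal.Quotient.mk v.asIdeal) h3
  rw [map_mul, map_mul, ← hue] at h4
  simp only [Matrix.map_apply, Matrix.smul_apply, smul_eq_mul]
  rw [mul_assoc, ← h4, Units.inv_mul_cancel_left]

lemma inj_main {d : ℕ} (hd : 2 ≤ d)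
    {Φ Ψ : Fin 2 → MvPolynomial (Fin 2) K}
    (hhomΦ : ∀ i, (Φ i).IsHomogeneous d) (hrelΦ : IsRelPrime (Φ 0) (Φ 1))
    (hhomΨ : ∀ i, (Ψ i).IsHomogeneous d)
    (cΦ cΨ : Kˣ)
    (hS₀ : ¬ (ringChar (𝓞 K ⧸ v.asIdeal) = 2 ∨
      ((ringChar (𝓞 K ⧸ v.asIdeal)).Prime ∧ Odd (ringChar (𝓞 K ⧸ v.asIdeal)) ∧
        (ringChar (𝓞 K ⧸ v.asIdeal) - 1) / 2 ∣ Module.finrank ℚ K ∧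
        ringChar (𝓞 K ⧸ v.asIdeal) ∣ d * (d ^ 2 - 1))))
    (M₁ M₂ : GL (Fin 2) K) (N₁ N₂ : Matrix (Fin 2) (Fin 2) (𝓞 K)) (u₁ u₂ : Kˣ)
    (h₁ : ∀ i j, algebraMap (𝓞 K) K (N₁ i j) = (u₁ : K) * (M₁ : Matrix (Fin 2) (Fin 2) K) i j)
    (h₂ : ∀ i j, algebraMap (𝓞 K) K (N₂ i j) = (u₂ : K) * (M₂ : Matrix (Fin 2) (Fin 2) K) i j)
    (hd₁ : N₁.det ∉ v.asIdeal) (hd₂ : N₂.det ∉ v.asIdeal)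
    (N₁' N₂' : GL (Fin 2) (𝓞 K ⧸ v.asIdeal))
    (hN₁ : (N₁' : Matrix (Fin 2) (Fin 2) (𝓞 K ⧸ v.asIdeal)) = N₁.map (Ideal.Quotient.mk v.asIdeal))
    (hN₂ : (N₂' : Matrix (Fin 2) (Fin 2) (𝓞 K ⧸ v.asIdeal)) = N₂.map (Ideal.Quotient.mk v.asIdeal))
    (c₁ c₂ : K) (hc₁ : c₁ ≠ 0) (hc₂ : c₂ ≠ 0)
    (hp₁ : PolyConj (fun i => (cΦ : K) • Φ i) (fun i => (cΨ : K) • Ψ i)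
        (N₁.map (algebraMap (𝓞 K) K)) c₁)
    (hp₂ : PolyConj (fun i => (cΦ : K) • Φ i) (fun i => (cΨ : K) • Ψ i)
        (N₂.map (algebraMap (𝓞 K) K)) c₂)
    (hmk : PGL2.mk N₁' = PGL2.mk N₂') : PGL2.mk M₁ = PGL2.mk M₂ := by
  by_contra hMM
  let L := AlgebraicClosure K
  have : CharZero L := charZero_of_injective_algebraMap (algebraMap K L).injective
  have hinj : Function.Injective (algebraMap (𝓞 K) L) := by
    rw [IsScalarTower.algebraMap_eq (𝓞 K) K L]
    exact (algebraMap K L).injective.comp RingOfIntegers.coe_injective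
  set P : Matrix (Fin 2) (Fin 2) (𝓞 K) := N₁.adjugate * N₂ with hP
  have hPdet : P.det = N₁.det * N₂.det := by
    rw [hP, Matrix.det_mul, Matrix.det_adjugate]; simp
  have hPdv : P.det ∉ v.asIdeal := by
    rw [hPdet]; intro h
    exact (v.isPrime.mem_or_mem h).elim hd₁ hd₂
  have hne₁ : N₁.det ≠ 0 := fun h => hd₁ (h ▸ v.asIdeal.zero_mem)
  have hP0 : P.det ≠ 0 := fun h => hPdv (h ▸ v.asIdeal.zero_mem)
  -- P is congruent to a scalar
  obtain ⟨z, hz⟩ : ∃ z : 𝓞 K, ∀ i j,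
      P i j - (z • (1 : Matrix (Fin 2) (Fin 2) (𝓞 K))) i j ∈ v.asIdeal := by
    obtain ⟨a, ha⟩ := (PGL2_mk_eq_iff _ _).mp hmk
    obtain ⟨z₀, rfl⟩ := Ideal.Quotient.mk_surjective a
    rw [hN₁, hN₂] at ha
    refine ⟨z₀ * N₁.det, fun i j => ?_⟩
    rw [← Ideal.Quotient.eq_zero_iff_mem, map_sub, sub_eq_zero]
    have hij : ∀ i j, Ideal.Quotient.mk v.asIdeal (N₂ i j) =
        Ideal.Quotient.mk v.asIdeal (z₀ * N₁ i j) := fun i j => by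
      have := congrFun (congrFun ha i) j
      simpa using this
    have e1 : Ideal.Quotient.mk v.asIdeal (P i j) =
        Ideal.Quotient.mk v.asIdeal ((N₁.adjugate * (z₀ • N₁)) i j) := by
      rw [hP, Matrix.mul_apply, Matrix.mul_apply, map_sum, map_sum]
      refine Finset.sum_congr rfl fun k _ => ?_
      rw [map_mul, map_mul, hij]; rfl
    rw [e1, Matrix.mul_smul, Matrix.adjugate_mul, smul_smul]
  set PL : Matrix (Fin 2) (Fin 2) L := P.map (algebraMap (𝓞 K) L) with hPL
  have hPLdet : PL.det = algebraMap (𝓞 K) L P.det := (RingHom.map_det _ P).symm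
  have hPLtr : PL.trace = algebraMap (𝓞 K) L P.trace := by
    simp [hPL, Matrix.trace_fin_two]
  have hPns : ∀ a : L, PL ≠ a • 1 := by
    intro a ha
    apply hMM
    have ha0 : a = algebraMap (𝓞 K) L (P 0 0) := by
      have := congrFun (congrFun ha 0) 0
      simpa [hPL] using this.symm
    have hPP : P = P 0 0 • 1 := by
      ext1 i j
      apply hinj
      have := congrFun (congrFun ha i) j
      rw [hPL, Matrix.map_apply, ha0] at this
      rw [this]
      simp only [Matrix.smul_apply, smul_eq_mul, map_mul, Matrix.one_apply]
      split_ifs <;> simp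
    have hNN : N₁.det • N₂ = P 0 0 • N₁ := by
      have h3 : N₁ * P = N₁.det • N₂ := by
        rw [hP, ← mul_assoc, Matrix.mul_adjugate, smul_mul_assoc, one_mul]
      rw [← h3, hPP]; simp
    rw [PGL2_mk_eq_iff]
    refine ⟨(u₂ : K)⁻¹ * (algebraMap (𝓞 K) K N₁.det)⁻¹ * algebraMap (𝓞 K) K (P 0 0) * u₁, ?_⟩
    ext i j
    have h4 := congrArg (algebraMap (𝓞 K) K) (congrFun (congrFun hNN i) j)
    simp only [Matrix.smul_apply, smul_eq_mul, map_mul, h₁, h₂] at h4 ⊢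
    have hne₁' : algebraMap (𝓞 K) K N₁.det ≠ 0 := RingOfIntegers.coe_ne_zero_iff.mpr hne₁
    have hu₂ : (u₂ : K) ≠ 0 := u₂.ne_zero
    field_simp
    linear_combination h4
  have hnz : ∀ x : Fin 2 → L, x ≠ 0 → evv Φ x ≠ 0 := by
    intro x hx h
    obtain ⟨i, hi⟩ := relprime_ne_zero hhomΦ hrelΦ x hx
    exact hi (congrFun h i)
  -- conjugation identities over L
  have hmapL : ∀ N : Matrix (Fin 2) (Fin 2) (𝓞 K),
      (N.map (algebraMap (𝓞 K) K)).map (algebraMap K L) = N.map (algebraMap (𝓞 K) L) := fun N => by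
    ext i j; simp [← IsScalarTower.algebraMap_apply]
  have hsm : ∀ (c : Kˣ) (Θ : Fin 2 → MvPolynomial (Fin 2) K) (x : Fin 2 → L),
      evv (fun i => (c : K) • Θ i) x = algebraMap K L c • evv Θ x := fun c Θ x => by
    ext i; simp [evv, Algebra.smul_def]
  set Q₁ := N₁.map (algebraMap (𝓞 K) L) with hQ₁
  set Q₂ := N₂.map (algebraMap (𝓞 K) L) with hQ₂
  have hPQ : PL = Q₁.adjugate * Q₂ := by
    have h3 := RingHom.map_adjugate (algebraMap (𝓞 K) L) N₁
    rw [RingHom.mapMatrix_apply, RingHom.mapMatrix_apply] at h3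
    rw [hPL, hP, Matrix.map_mul, h3]
  have hQd : Q₁.det ≠ 0 := by
    have : Q₁.det = algebraMap (𝓞 K) L N₁.det := (RingHom.map_det _ N₁).symm
    rw [this]; intro h; exact hne₁ (hinj (by rw [h, map_zero]))
  have conv : ∀ (N : Matrix (Fin 2) (Fin 2) (𝓞 K)) (c : K), c ≠ 0 →
      PolyConj (fun i => (cΦ : K) • Φ i) (fun i => (cΨ : K) • Ψ i)
        (N.map (algebraMap (𝓞 K) K)) c → ∃ k : L, k ≠ 0 ∧ ∀ x : Fin 2 → L,
        (N.map (algebraMap (𝓞 K) L)).mulVec (evv Φ x) =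
          k • evv Ψ ((N.map (algebraMap (𝓞 K) L)).mulVec x) := by
    intro N c hc hp
    refine ⟨(algebraMap K L cΦ)⁻¹ * (algebraMap K L c * algebraMap K L cΨ), by simp [hc], fun x => ?_⟩
    have h3 := hp.ev x
    rw [hmapL, hsm, hsm, Matrix.mulVec_smul, smul_smul] at h3
    rw [mul_smul, ← h3, smul_smul, inv_mul_cancel₀ (by simp), one_smul]
  obtain ⟨k₁, hk₁, e₁⟩ := conv N₁ c₁ hc₁ hp₁
  obtain ⟨k₂, hk₂, e₂⟩ := conv N₂ c₂ hc₂ hp₂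
  rw [← hQ₁] at e₁
  rw [← hQ₂] at e₂
  have hcP : ∀ x : Fin 2 → L, PL.mulVec (evv Φ x) =
      (k₂ * Q₁.det * (k₁ * Q₁.det ^ d)⁻¹) • evv Φ (PL.mulVec x) := by
    intro x
    have s1 : Q₁.mulVec (PL.mulVec x) = Q₁.det • Q₂.mulVec x := by
      rw [hPQ, Matrix.mulVec_mulVec, ← mul_assoc, Matrix.mul_adjugate, smul_mul_assoc, one_mul,
        Matrix.smul_mulVec]
    have s2 := e₁ (PL.mulVec x)
    rw [s1, evv_smul hhomΨ, smul_smul] at s2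
    have s3 : Q₁.det • evv Φ (PL.mulVec x) = (k₁ * Q₁.det ^ d) • Q₁.adjugate.mulVec
        (evv Ψ (Q₂.mulVec x)) := by
      rw [← Matrix.mulVec_smul, ← s2, Matrix.mulVec_mulVec, Matrix.adjugate_mul,
        Matrix.smul_mulVec, Matrix.one_mulVec]
    have s4 : PL.mulVec (evv Φ x) = k₂ • Q₁.adjugate.mulVec (evv Ψ (Q₂.mulVec x)) := by
      rw [hPQ, ← Matrix.mulVec_mulVec, e₂, Matrix.mulVec_smul]
    have hkd : k₁ * Q₁.det ^ d ≠ 0 := mul_ne_zero hk₁ (pow_ne_zero _ hQd)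
    have s5 : k₂ * Q₁.det * (k₁ * Q₁.det ^ d)⁻¹ = k₂ * (k₁ * Q₁.det ^ d)⁻¹ * Q₁.det := by ring
    rw [s4, s5, mul_smul _ Q₁.det, s3, smul_smul, mul_assoc, inv_mul_cancel₀ hkd, mul_one]
  obtain ⟨α, β, hαβ, hsum, hprod, n, hn, hnd, hroot⟩ := eigen_root hd hhomΦ hnz PL
    (by rw [hPLdet]; intro h; exact hP0 (hinj (by rw [h, map_zero]))) hPns _ hcP
  exact root_case d v hS₀ P hPdv z hz α β hαβ (hsum.trans hPLtr) (hprod.trans hPLdet) n hn hnd hroot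

end final_part

/-- for rational functions `φ, ψ` of degree `d ≥ 2` over a number
field `K` with `Conj_{φ,ψ}(K)` nonempty, the reduction map
`Conj_{φ,ψ}(K) → Conj_{φ,ψ}(𝔽_v)` is a well-defined injection at every place `v`
of good reduction for both maps whose residue characteristic is not in `S₀`. -/
theorem reduction_injective_on_conj
    {K : Type*} [Field K] [NumberField K]
    (d : ℕ) (hd : 2 ≤ d)
    (Φ Ψ : Fin 2 → MvPolynomial (Fin 2) K)
    (hhomΦ : ∀ i, (Φ i).IsHomogeneous d) (hrelΦ : IsRelPrime (Φ 0) (Φ 1))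
    (hhomΨ : ∀ i, (Ψ i).IsHomogeneous d) (hrelΨ : IsRelPrime (Ψ 0) (Ψ 1))
    (v : HeightOneSpectrum (𝓞 K))
    -- φ has good reduction at v
    (cΦ : Kˣ) (A : Fin 2 → MvPolynomial (Fin 2) (𝓞 K))
    (hA : ∀ i, MvPolynomial.map (algebraMap (𝓞 K) K) (A i) = (cΦ : K) • Φ i)
    (hAred : IsRelPrime
      (MvPolynomial.map (Ideal.Quotient.mk v.asIdeal) (A 0))
      (MvPolynomial.map (Ideal.Quotient.mk v.asIdeal) (A 1)))
    -- ψ has good reduction at v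
    (cΨ : Kˣ) (B : Fin 2 → MvPolynomial (Fin 2) (𝓞 K))
    (hB : ∀ i, MvPolynomial.map (algebraMap (𝓞 K) K) (B i) = (cΨ : K) • Ψ i)
    (hBred : IsRelPrime
      (MvPolynomial.map (Ideal.Quotient.mk v.asIdeal) (B 0))
      (MvPolynomial.map (Ideal.Quotient.mk v.asIdeal) (B 1)))
    -- v does not divide any prime of S₀
    (hS₀ : ¬ (ringChar (𝓞 K ⧸ v.asIdeal) = 2 ∨
      ((ringChar (𝓞 K ⧸ v.asIdeal)).Prime ∧ Odd (ringChar (𝓞 K ⧸ v.asIdeal)) ∧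
        (ringChar (𝓞 K ⧸ v.asIdeal) - 1) / 2 ∣ Module.finrank ℚ K ∧
        ringChar (𝓞 K ⧸ v.asIdeal) ∣ d * (d ^ 2 - 1))))
    (hne : (ConjSet Φ Ψ).Nonempty) :
    ∃ red : PGL2 K → PGL2 (𝓞 K ⧸ v.asIdeal),
      -- every element of Conj_{φ,ψ}(K) has good reduction at v
      (∀ s ∈ ConjSet Φ Ψ, ∃ (M : GL (Fin 2) K)
          (N : Matrix (Fin 2) (Fin 2) (𝓞 K)) (u : Kˣ),
        PGL2.mk M = s ∧
        (∀ i j, algebraMap (𝓞 K) K (N i j) =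
          (u : K) * (M : Matrix (Fin 2) (Fin 2) K) i j) ∧
        N.det ∉ v.asIdeal) ∧
      -- red maps Conj_{φ,ψ}(K) into Conj_{φ̃,ψ̃}(𝔽_v)
      (∀ s ∈ ConjSet Φ Ψ,
        red s ∈ ConjSet
          (fun i => MvPolynomial.map (Ideal.Quotient.mk v.asIdeal) (A i))
          (fun i => MvPolynomial.map (Ideal.Quotient.mk v.asIdeal) (B i))) ∧
      -- red is given by reduction of matrix entries
      (∀ s ∈ ConjSet Φ Ψ, ∀ (M : GL (Fin 2) K)
          (N : Matrix (Fin 2) (Fin 2) (𝓞 K)) (u : Kˣ),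
        PGL2.mk M = s →
        (∀ i j, algebraMap (𝓞 K) K (N i j) =
          (u : K) * (M : Matrix (Fin 2) (Fin 2) K) i j) →
        N.det ∉ v.asIdeal →
        ∀ N' : GL (Fin 2) (𝓞 K ⧸ v.asIdeal),
          (N' : Matrix (Fin 2) (Fin 2) (𝓞 K ⧸ v.asIdeal)) =
            N.map (Ideal.Quotient.mk v.asIdeal) →
          red s = PGL2.mk N') ∧
      -- red is injective on Conj_{φ,ψ}(K)
      Set.InjOn red (ConjSet Φ Ψ) := by
  have hloc := fun s hs => local_main v hd hhomΦ hhomΨ cΦ A hA hAred cΨ B hB hBred s hs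
  classical
  let Good : PGL2 K → PGL2 (𝓞 K ⧸ v.asIdeal) → Prop := fun s r =>
    ∃ (M : GL (Fin 2) K) (N : Matrix (Fin 2) (Fin 2) (𝓞 K)) (u : Kˣ)
      (N' : GL (Fin 2) (𝓞 K ⧸ v.asIdeal)),
      PGL2.mk M = s ∧
      (∀ i j, algebraMap (𝓞 K) K (N i j) = (u : K) * (M : Matrix (Fin 2) (Fin 2) K) i j) ∧
      N.det ∉ v.asIdeal ∧
      (N' : Matrix (Fin 2) (Fin 2) (𝓞 K ⧸ v.asIdeal)) = N.map (Ideal.Quotient.mk v.asIdeal) ∧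
      PGL2.mk N' = r
  have huniq : ∀ s r r', Good s r → Good s r' → r = r' := by
    rintro s r r' ⟨M, N, u, N', h1, h2, h3, h4, rfl⟩ ⟨M₂, N₂, u₂, N₂', k1, k2, k3, k4, rfl⟩
    exact red_unique v M M₂ N N₂ u u₂ (h1.trans k1.symm) h2 k2 h3 k3 N' N₂' h4 k4
  let red : PGL2 K → PGL2 (𝓞 K ⧸ v.asIdeal) := fun s =>
    if h : ∃ r, Good s r then h.choose else PGL2.mk 1
  have hred : ∀ s r, Good s r → red s = r := by
    intro s r hr
    have hex : ∃ r, Good s r := ⟨r, hr⟩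
    have : red s = hex.choose := dif_pos hex
    rw [this]
    exact huniq s _ _ hex.choose_spec hr
  refine ⟨red, ?_, ?_, ?_, ?_⟩
  · intro s hs
    obtain ⟨M, N, u, N', c, h1, h2, h3, -⟩ := hloc s hs
    exact ⟨M, N, u, h1, h2, h3⟩
  · intro s hs
    obtain ⟨M, N, u, N', c, h1, h2, h3, h4, h5, -⟩ := hloc s hs
    exact ⟨N', (hred s _ ⟨M, N, u, N', h1, h2, h3, h4, rfl⟩).symm, h5⟩
  · intro s hs M N u h1 h2 h3 N' h4
    exact hred s _ ⟨M, N, u, N', h1, h2, h3, h4, rfl⟩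
  · intro s hs t ht hst
    obtain ⟨M, N, u, N', c, h1, h2, h3, h4, -, h6, h7⟩ := hloc s hs
    obtain ⟨M₂, N₂, u₂, N₂', c₂, k1, k2, k3, k4, -, k6, k7⟩ := hloc t ht
    rw [hred s _ ⟨M, N, u, N', h1, h2, h3, h4, rfl⟩,
      hred t _ ⟨M₂, N₂, u₂, N₂', k1, k2, k3, k4, rfl⟩] at hst
    simp only [hA, hB] at h7 k7
    rw [← h1, ← k1]
    exact inj_main v hd hhomΦ hrelΦ hhomΨ cΦ cΨ hS₀ M M₂ N N₂ u u₂ h2 k2 h3 k3 N' N₂' h4 k4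
      c c₂ h6 k6 h7 k7 hst
end
end

section
/- Let K be a number field, let s ∈ PGL₂(K), viewed as a point (α : β : γ : δ) ∈ ℙ³(K) via its matrix entries, and let τ₁, τ₂, τ₃ be three distinct points of ℙ¹(K̄) with images η_i = s(τ_i) for i = 1, 2, 3. Then H_K(s) ≤ 6^{[K:ℚ]} · ∏_{i=1}^{3} H_K(τ_i) · H_K(η_i). In particular, if T and T' are Galois-invariant subsets of ℙ¹(K̄) of cardinality at least 3 and s(T) = T', then H_K(s) ≤ 6^{[K:ℚ]} · (max_{τ∈T} H_K(τ))³ · (max_{η∈T'} H_K(η))³. -/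
open MvPolynomial

noncomputable section

open NumberField

/-- The relative multiplicative height `H_K` of a projective point with
coordinates in the ring of integers: the archimedean contribution divided by the
norm of the ideal generated by the coordinates (the non-archimedean
contribution). -/
noncomputable def heightVec {K : Type*} [Field K] [NumberField K]
    {ι : Type*} [Fintype ι] [Nonempty ι] (x : ι → 𝓞 K) : ℝ :=
  (∏ w : InfinitePlace K,
      (Finset.univ.sup' Finset.univ_nonempty
        fun i => w (algebraMap (𝓞 K) K (x i))) ^ w.mult) /
    (Ideal.absNorm (Ideal.span (Set.range x)) : ℝ)


section Helpers

open Finset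

/-- The archimedean maximum of the coordinates at a place. -/
def archMax {K : Type*} [Field K] {ι : Type*} [Fintype ι] [Nonempty ι]
    (w : InfinitePlace K) (x : ι → 𝓞 K) : ℝ :=
  Finset.univ.sup' Finset.univ_nonempty fun i => w (algebraMap (𝓞 K) K (x i))

lemma heightVec_eq {K : Type*} [Field K] [NumberField K] {ι : Type*} [Fintype ι] [Nonempty ι]
    (x : ι → 𝓞 K) : heightVec x = (∏ w : InfinitePlace K, archMax w x ^ w.mult) /
      (Ideal.absNorm (Ideal.span (Set.range x)) : ℝ) := rfl

lemma le_archMax {K : Type*} [Field K] {ι : Type*} [Fintype ι] [Nonempty ι]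
    (w : InfinitePlace K) (x : ι → 𝓞 K) (i : ι) :
    w (algebraMap (𝓞 K) K (x i)) ≤ archMax w x :=
  Finset.le_sup' (fun i => w (algebraMap (𝓞 K) K (x i))) (Finset.mem_univ i)

lemma archMax_nonneg {K : Type*} [Field K] {ι : Type*} [Fintype ι] [Nonempty ι]
    (w : InfinitePlace K) (x : ι → 𝓞 K) : 0 ≤ archMax w x :=
  (apply_nonneg w _).trans (le_archMax w x (Classical.arbitrary ι))

lemma archMax_le {K : Type*} [Field K] {ι : Type*} [Fintype ι] [Nonempty ι]
    (w : InfinitePlace K) (x : ι → 𝓞 K) (B : ℝ)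
    (h : ∀ i, w (algebraMap (𝓞 K) K (x i)) ≤ B) : archMax w x ≤ B :=
  Finset.sup'_le _ _ fun i _ => h i

lemma heightVec_nonneg {K : Type*} [Field K] [NumberField K] {ι : Type*} [Fintype ι] [Nonempty ι]
    (x : ι → 𝓞 K) : 0 ≤ heightVec x := by
  rw [heightVec_eq]
  have := fun w : InfinitePlace K => archMax_nonneg w x
  exact div_nonneg (Finset.prod_nonneg fun w _ => pow_nonneg (this w) _) (Nat.cast_nonneg _)

lemma archMax_smul {K : Type*} [Field K] {ι : Type*} [Fintype ι] [Nonempty ι]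
    (w : InfinitePlace K) (x : ι → 𝓞 K) (a : 𝓞 K) :
    archMax w (fun i => a * x i) = w (algebraMap (𝓞 K) K a) * archMax w x := by
  apply le_antisymm
  · apply archMax_le
    intro i
    rw [map_mul, map_mul]
    exact mul_le_mul_of_nonneg_left (le_archMax w x i) (apply_nonneg w _)
  · obtain ⟨i, -, hi⟩ := Finset.exists_mem_eq_sup' Finset.univ_nonempty
      (fun i => w (algebraMap (𝓞 K) K (x i)))
    have : archMax w x = w (algebraMap (𝓞 K) K (x i)) := hi
    rw [this, ← map_mul, ← map_mul]
    exact le_archMax w (fun i => a * x i) i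

lemma heightVec_smul {K : Type*} [Field K] [NumberField K] {ι : Type*} [Fintype ι] [Nonempty ι]
    (x : ι → 𝓞 K) (a : 𝓞 K) (ha : a ≠ 0) : heightVec (fun i => a * x i) = heightVec x := by
  rw [heightVec_eq, heightVec_eq]
  have h1 : Ideal.span (Set.range fun i => a * x i) =
      Ideal.span {a} * Ideal.span (Set.range x) := by
    rw [Ideal.span_mul_span', Set.singleton_mul, ← Set.range_comp]
    rfl
  have h2 : ∏ w : InfinitePlace K, archMax w (fun i => a * x i) ^ w.mult =
      (Ideal.absNorm (Ideal.span {a}) : ℝ) * ∏ w : InfinitePlace K, archMax w x ^ w.mult := by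
    simp_rw [archMax_smul, mul_pow, Finset.prod_mul_distrib]
    congr 1
    rw [InfinitePlace.prod_eq_abs_norm, Ideal.absNorm_span_singleton,
      ← Algebra.coe_norm_int]
    simp [Nat.cast_natAbs]
  rw [h1, h2, map_mul, Nat.cast_mul]
  apply mul_div_mul_left
  have : Ideal.absNorm (Ideal.span {a}) ≠ 0 := by
    rw [Ne, Ideal.absNorm_eq_zero_iff, Ideal.span_singleton_eq_bot]
    exact ha
  exact_mod_cast this

lemma prod_places_eq_prod_embeddings {K : Type*} [Field K] [NumberField K]
    (f : InfinitePlace K → ℝ) :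
    ∏ w : InfinitePlace K, f w ^ w.mult = ∏ φ : K →+* ℂ, f (InfinitePlace.mk φ) := by
  classical
  rw [← Finset.prod_fiberwise Finset.univ InfinitePlace.mk]
  refine Finset.prod_congr rfl fun w _ => ?_
  rw [← InfinitePlace.card_filter_mk_eq w, ← Finset.prod_const]
  refine Finset.prod_congr rfl fun φ hφ => ?_
  rw [(Finset.mem_filter.mp hφ).2]

lemma card_fiber_embeddings {K L : Type*} [Field K] [NumberField K] [Field L] [NumberField L]
    [Algebra K L] [DecidableEq (K →+* ℂ)] (ψ : K →+* ℂ) :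
    (Finset.univ.filter fun φ : L →+* ℂ => φ.comp (algebraMap K L) = ψ).card =
      Module.finrank K L := by
  let _ : Algebra K ℂ := ψ.toAlgebra
  rw [← AlgHom.card K L ℂ, ← Fintype.card_subtype]
  refine Fintype.card_congr ⟨fun φ => ⟨φ.1, fun r => by
      have := RingHom.congr_fun φ.2 r
      exact this⟩, fun φ => ⟨φ.toRingHom, ?_⟩, fun φ => rfl, fun φ => rfl⟩
  ext r
  exact φ.commutes r

lemma prod_places_ext {K L : Type*} [Field K] [NumberField K] [Field L] [NumberField L]
    [Algebra K L] (f : InfinitePlace K → ℝ) :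
    ∏ w : InfinitePlace L, f (w.comap (algebraMap K L)) ^ w.mult =
      (∏ v : InfinitePlace K, f v ^ v.mult) ^ Module.finrank K L := by
  classical
  rw [prod_places_eq_prod_embeddings (fun w : InfinitePlace L => f (w.comap (algebraMap K L))),
    prod_places_eq_prod_embeddings, ← Finset.prod_pow,
    ← Finset.prod_fiberwise Finset.univ (fun φ : L →+* ℂ => φ.comp (algebraMap K L))]
  refine Finset.prod_congr rfl fun ψ _ => ?_
  rw [← card_fiber_embeddings (L := L) ψ, ← Finset.prod_const]
  refine Finset.prod_congr rfl fun φ hφ => ?_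
  rw [InfinitePlace.comap_mk, (Finset.mem_filter.mp hφ).2]

lemma heightVec_ext {K L : Type*} [Field K] [NumberField K] [Field L] [NumberField L]
    [Algebra K L] {ι : Type*} [Fintype ι] [Nonempty ι] (x : ι → 𝓞 K) :
    heightVec x ^ Module.finrank K L = heightVec (fun i => algebraMap (𝓞 K) (𝓞 L) (x i)) := by
  rw [heightVec_eq, heightVec_eq, div_pow]
  congr 1
  · rw [← prod_places_ext]
    rfl
  · have : Ideal.span (Set.range fun i => algebraMap (𝓞 K) (𝓞 L) (x i)) =
        (Ideal.span (Set.range x)).map (algebraMap (𝓞 K) (𝓞 L)) := by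
      rw [Ideal.map_span, ← Set.range_comp]
      rfl
    rw [this, Ideal.absNorm_algebraMap, IsFractionRing.finrank_eq (𝓞 K) K (𝓞 L) L,
      Nat.cast_pow]

/-- 6-term multilinear expression. -/
def pform {R : Type*} [CommRing R] (t e : Fin 3 → Fin 2 → R) (i j : Fin 2) : R :=
  (e 2 0 * e 1 1 - e 1 0 * e 2 1) * (t 0 0 * t 2 1 - t 2 0 * t 0 1) * e 0 i * t 1 j -
  (e 0 0 * e 2 1 - e 2 0 * e 0 1) * (t 2 0 * t 1 1 - t 1 0 * t 2 1) * e 1 i * t 0 j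


/-- The monomial in which index `k` contributes the other coordinate. -/
def mono3 {R : Type*} [CommRing R] (t : Fin 3 → Fin 2 → R) (i : Fin 2) (k : Fin 3) : R :=
  ∏ l, t l (if l = k then 1 - i else i)

lemma pform_eq {R : Type*} [CommRing R] (t e : Fin 3 → Fin 2 → R) (i j : Fin 2) :
    ∃ ε : ℤˣ, pform t e i j = ((ε : ℤ) : R) *
      (mono3 e i 1 * mono3 t j 2 - mono3 e i 1 * mono3 t j 0 +
       (mono3 e i 2 * mono3 t j 0 - mono3 e i 2 * mono3 t j 1) +
       (mono3 e i 0 * mono3 t j 1 - mono3 e i 0 * mono3 t j 2)) := by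
  fin_cases i <;> fin_cases j
  · refine ⟨1, ?_⟩
    simp [pform, mono3, Fin.prod_univ_three]
    ring
  · refine ⟨-1, ?_⟩
    simp [pform, mono3, Fin.prod_univ_three]
    ring
  · refine ⟨-1, ?_⟩
    simp [pform, mono3, Fin.prod_univ_three]
    ring
  · refine ⟨1, ?_⟩
    simp [pform, mono3, Fin.prod_univ_three]
    ring

lemma mono3_place_le {L : Type*} [Field L] (w : InfinitePlace L) (t : Fin 3 → Fin 2 → 𝓞 L)
    (i : Fin 2) (k : Fin 3) :
    w (algebraMap (𝓞 L) L (mono3 t i k)) ≤ ∏ l, archMax w (t l) := by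
  rw [mono3, map_prod, map_prod]
  exact Finset.prod_le_prod (fun _ _ => apply_nonneg w _) fun l _ => le_archMax w (t l) _

lemma place_add_le {L : Type*} [Field L] (w : InfinitePlace L) (x y : L) :
    w (x + y) ≤ w x + w y := w.1.add_le x y

lemma place_sub_le {L : Type*} [Field L] (w : InfinitePlace L) (x y : L) :
    w (x - y) ≤ w x + w y := by
  rw [sub_eq_add_neg]
  refine (place_add_le w x (-y)).trans ?_
  have : w (-y) = w y := w.1.map_neg y
  rw [this]

lemma pform_place_le {L : Type*} [Field L] (w : InfinitePlace L) (t e : Fin 3 → Fin 2 → 𝓞 L)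
    (i j : Fin 2) :
    w (algebraMap (𝓞 L) L (pform t e i j)) ≤
      6 * ∏ l, (archMax w (t l) * archMax w (e l)) := by
  obtain ⟨ε, h⟩ := pform_eq t e i j
  have hm : ∀ a b, w (algebraMap (𝓞 L) L (mono3 e i a * mono3 t j b)) ≤
      ∏ l, (archMax w (t l) * archMax w (e l)) := by
    intro a b
    rw [map_mul, map_mul, Finset.prod_mul_distrib, mul_comm]
    exact mul_le_mul (mono3_place_le w t j b) (mono3_place_le w e i a) (apply_nonneg w _)
      (Finset.prod_nonneg fun l _ => archMax_nonneg w _)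
  have hε : w (algebraMap (𝓞 L) L ((ε : ℤ) : 𝓞 L)) = 1 := by
    rcases Int.units_eq_one_or ε with rfl | rfl
    · simp
    · have : w (-1) = w 1 := w.1.map_neg 1
      simp [this]
  rw [h, map_mul, map_mul, hε, one_mul]
  simp only [map_add, map_sub]
  refine (place_add_le w _ _).trans ?_
  refine (add_le_add (place_add_le w _ _) le_rfl).trans ?_
  refine (add_le_add (add_le_add (place_sub_le w _ _) (place_sub_le w _ _))
    (place_sub_le w _ _)).trans ?_
  linarith [hm 1 2, hm 1 0, hm 2 0, hm 2 1, hm 0 1, hm 0 2]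

lemma mono3_mem {R : Type*} [CommRing R] (t : Fin 3 → Fin 2 → R) (i : Fin 2) (k : Fin 3) :
    mono3 t i k ∈ ∏ l, Ideal.span (Set.range (t l)) :=
  Ideal.prod_mem_prod fun l _ => Ideal.subset_span ⟨_, rfl⟩

lemma pform_mem {R : Type*} [CommRing R] (t e : Fin 3 → Fin 2 → R) (i j : Fin 2) :
    pform t e i j ∈ ∏ l, (Ideal.span (Set.range (t l)) * Ideal.span (Set.range (e l))) := by
  obtain ⟨ε, h⟩ := pform_eq t e i j
  have hm : ∀ a b, mono3 e i a * mono3 t j b ∈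
      ∏ l, (Ideal.span (Set.range (t l)) * Ideal.span (Set.range (e l))) := by
    intro a b
    rw [Finset.prod_mul_distrib, mul_comm (mono3 e i a)]
    exact Ideal.mul_mem_mul (mono3_mem t j b) (mono3_mem e i a)
  rw [h]
  exact Ideal.mul_mem_left _ _ (add_mem (add_mem (sub_mem (hm _ _) (hm _ _))
    (sub_mem (hm _ _) (hm _ _))) (sub_mem (hm _ _) (hm _ _)))

/-- The explicit matrix sending the `t k` to multiples of the `e k`. -/
def pmat {R : Type*} [CommRing R] (t e : Fin 3 → Fin 2 → R) (p : Fin 2 × Fin 2) : R :=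
  if p.2 = 0 then pform t e p.1 1 else - pform t e p.1 0

lemma pmat_map {R S : Type*} [CommRing R] [CommRing S] (f : R →+* S) (t e : Fin 3 → Fin 2 → R)
    (p : Fin 2 × Fin 2) :
    f (pmat t e p) = pmat (fun k m => f (t k m)) (fun k m => f (e k m)) p := by
  unfold pmat pform
  split_ifs <;> simp

lemma heightVec_pmat_le {L : Type*} [Field L] [NumberField L] (t e : Fin 3 → Fin 2 → 𝓞 L) :
    heightVec (pmat t e) ≤ 6 ^ Module.finrank ℚ L * ∏ i, heightVec (t i) * heightVec (e i) := by
  have harch : ∀ w : InfinitePlace L, archMax w (pmat t e) ≤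
      6 * ∏ l, (archMax w (t l) * archMax w (e l)) := by
    intro w
    apply archMax_le
    rintro ⟨i, j⟩
    unfold pmat
    split_ifs
    · exact pform_place_le w t e i 1
    · rw [map_neg]
      have : ∀ y, w (-y) = w y := fun y => w.1.map_neg y
      rw [this]
      exact pform_place_le w t e i 0
  have hideal : Ideal.span (Set.range (pmat t e)) ≤
      ∏ l, (Ideal.span (Set.range (t l)) * Ideal.span (Set.range (e l))) := by
    rw [Ideal.span_le]
    rintro _ ⟨⟨i, j⟩, rfl⟩
    unfold pmat
    split_ifs
    · exact pform_mem t e i 1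
    · exact neg_mem (pform_mem t e i 0)
  have hdvd := Ideal.absNorm_dvd_absNorm_of_le hideal
  have hrhs : (6 : ℝ) ^ Module.finrank ℚ L * ∏ i, heightVec (t i) * heightVec (e i) =
      (∏ w : InfinitePlace L, (6 * ∏ l, (archMax w (t l) * archMax w (e l))) ^ w.mult) /
      (Ideal.absNorm (∏ l, (Ideal.span (Set.range (t l)) * Ideal.span (Set.range (e l)))) : ℝ) := by
    simp_rw [mul_pow, Finset.prod_mul_distrib]
    rw [Finset.prod_pow_eq_pow_sum, InfinitePlace.sum_mult_eq]
    simp_rw [heightVec_eq, Finset.prod_div_distrib, map_mul, map_prod, Nat.cast_mul,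
      Nat.cast_prod, mul_pow, Finset.prod_mul_distrib, ← Finset.prod_pow]
    rw [Finset.prod_comm, Finset.prod_comm (s := (Finset.univ : Finset (InfinitePlace L)))
      (f := fun w l => archMax w (e l) ^ w.mult)]
    ring
  by_cases h0 : Ideal.absNorm (Ideal.span (Set.range (pmat t e))) = 0
  · rw [heightVec_eq, h0, Nat.cast_zero, div_zero]
    exact mul_nonneg (by positivity) (Finset.prod_nonneg fun i _ =>
      mul_nonneg (heightVec_nonneg _) (heightVec_nonneg _))
  · rw [hrhs, heightVec_eq]
    have hpos : 0 < Ideal.absNorm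
        (∏ l, (Ideal.span (Set.range (t l)) * Ideal.span (Set.range (e l)))) :=
      Nat.pos_of_dvd_of_pos hdvd (Nat.pos_of_ne_zero h0)
    have hle := Nat.le_of_dvd (Nat.pos_of_ne_zero h0) hdvd
    apply div_le_div₀
    · exact Finset.prod_nonneg fun w _ => pow_nonneg ((archMax_nonneg w _).trans (harch w)) _
    · exact Finset.prod_le_prod (fun w _ => pow_nonneg (archMax_nonneg w _) _)
        fun w _ => pow_le_pow_left₀ (archMax_nonneg w _) (harch w) _
    · exact_mod_cast hpos
    · exact_mod_cast hle

lemma bracket_ne_zero {L : Type*} [Field L] (a b : Fin 2 → L) (hb : b ≠ 0)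
    (h : ¬ ∃ c : L, a = c • b) : a 0 * b 1 - a 1 * b 0 ≠ 0 := by
  intro h0
  apply h
  by_cases hb0 : b 0 = 0
  · have hb1 : b 1 ≠ 0 := by
      intro hb1
      apply hb
      ext m
      fin_cases m <;> simpa
    refine ⟨a 1 / b 1, ?_⟩
    ext m
    fin_cases m
    · simp only [Fin.zero_eta, Pi.smul_apply, smul_eq_mul]
      field_simp
      linear_combination h0
    · simp only [Fin.mk_one, Pi.smul_apply, smul_eq_mul]
      field_simp
  · refine ⟨a 0 / b 0, ?_⟩
    ext m
    fin_cases m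
    · simp only [Fin.zero_eta, Pi.smul_apply, smul_eq_mul]
      field_simp
    · simp only [Fin.mk_one, Pi.smul_apply, smul_eq_mul]
      field_simp
      linear_combination -h0

lemma pmat_eq {R : Type*} [CommRing R] (t e : Fin 3 → Fin 2 → R) (m : Matrix (Fin 2) (Fin 2) R)
    (c : Fin 3 → R) (h : ∀ k i, e k i = c k * (m i 0 * t k 0 + m i 1 * t k 1))
    (p : Fin 2 × Fin 2) :
    pmat t e p = c 0 * c 1 * c 2 * (m 0 0 * m 1 1 - m 0 1 * m 1 0) *
      (t 2 0 * t 1 1 - t 2 1 * t 1 0) * (t 0 0 * t 2 1 - t 0 1 * t 2 0) *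
      (t 0 0 * t 1 1 - t 0 1 * t 1 0) * m p.1 p.2 := by
  obtain ⟨i, j⟩ := p
  fin_cases i <;> fin_cases j <;> simp [pmat, pform, h] <;> ring

lemma part_one {K L : Type*} [Field K] [NumberField K] [Field L] [NumberField L]
    [Algebra K L]
    (M : GL (Fin 2) K)
    (N : Matrix (Fin 2) (Fin 2) (𝓞 K)) (u : Kˣ)
    (hN : ∀ i j, algebraMap (𝓞 K) K (N i j) =
      (u : K) * (M : Matrix (Fin 2) (Fin 2) K) i j)
    (τ η : Fin 3 → (Fin 2 → 𝓞 L))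
    (hτ0 : ∀ i, (fun m => algebraMap (𝓞 L) L (τ i m)) ≠ 0)
    (hdist : ∀ i j, i ≠ j → ¬ ∃ c : L,
      (fun m => algebraMap (𝓞 L) L (τ i m)) =
        c • fun m => algebraMap (𝓞 L) L (τ j m))
    (hη : ∀ i, ∃ c : Lˣ,
      (fun m => algebraMap (𝓞 L) L (η i m)) =
        c • (((M : Matrix (Fin 2) (Fin 2) K).map (algebraMap K L)).mulVec
          fun m => algebraMap (𝓞 L) L (τ i m))) :
    heightVec (fun p : Fin 2 × Fin 2 => N p.1 p.2) ^ Module.finrank K L ≤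
      (6 : ℝ) ^ (Module.finrank ℚ K * Module.finrank K L) *
        ∏ i, heightVec (τ i) * heightVec (η i) := by
  rw [heightVec_ext, Module.finrank_mul_finrank]
  refine le_trans (le_of_eq ?_) (heightVec_pmat_le τ η)
  choose c hc using hη
  have hbr : ∀ i j, i ≠ j → algebraMap (𝓞 L) L (τ i 0) * algebraMap (𝓞 L) L (τ j 1) -
      algebraMap (𝓞 L) L (τ i 1) * algebraMap (𝓞 L) L (τ j 0) ≠ 0 :=
    fun i j hij => bracket_ne_zero _ _ (hτ0 j) (hdist i j hij)
  let m : Matrix (Fin 2) (Fin 2) L := (M : Matrix (Fin 2) (Fin 2) K).map (algebraMap K L)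
  have hdet : m 0 0 * m 1 1 - m 0 1 * m 1 0 ≠ 0 := by
    rw [← Matrix.det_fin_two]
    have h1 : m.det = algebraMap K L (M : Matrix (Fin 2) (Fin 2) K).det := by
      rw [RingHom.map_det]
      rfl
    rw [h1]
    have h2 : IsUnit (M : Matrix (Fin 2) (Fin 2) K).det :=
      (Matrix.isUnit_iff_isUnit_det _).mp M.isUnit
    exact (map_ne_zero _).mpr h2.ne_zero
  have key := pmat_eq (fun k i => algebraMap (𝓞 L) L (τ k i))
    (fun k i => algebraMap (𝓞 L) L (η k i)) m (fun k => (c k : L)) (by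
      intro k i
      have := congrFun (hc k) i
      simp only [Pi.smul_apply, Units.smul_def, smul_eq_mul, Matrix.mulVec, dotProduct,
        Fin.sum_univ_two] at this
      exact this)
  set D : L := (c 0 : L) * c 1 * c 2 * (m 0 0 * m 1 1 - m 0 1 * m 1 0) *
      (algebraMap (𝓞 L) L (τ 2 0) * algebraMap (𝓞 L) L (τ 1 1) -
        algebraMap (𝓞 L) L (τ 2 1) * algebraMap (𝓞 L) L (τ 1 0)) *
      (algebraMap (𝓞 L) L (τ 0 0) * algebraMap (𝓞 L) L (τ 2 1) -
        algebraMap (𝓞 L) L (τ 0 1) * algebraMap (𝓞 L) L (τ 2 0)) *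
      (algebraMap (𝓞 L) L (τ 0 0) * algebraMap (𝓞 L) L (τ 1 1) -
        algebraMap (𝓞 L) L (τ 0 1) * algebraMap (𝓞 L) L (τ 1 0)) with hD
  have hD0 : D ≠ 0 := by
    have := hbr 2 1 (by decide)
    have := hbr 0 2 (by decide)
    have := hbr 0 1 (by decide)
    have := (c 0).ne_zero
    have := (c 1).ne_zero
    have := (c 2).ne_zero
    rw [hD]
    simp only [ne_eq, mul_eq_zero, not_or]
    tauto
  have hu : algebraMap K L (u : K) ≠ 0 := (map_ne_zero _).mpr u.ne_zero
  obtain ⟨a, b, hb, hab⟩ := IsFractionRing.div_surjective (A := 𝓞 L) (D / algebraMap K L (u : K))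
  have hb0 : b ≠ 0 := nonZeroDivisors.ne_zero hb
  have hb' : algebraMap (𝓞 L) L b ≠ 0 := by simpa using hb0
  have ha0 : a ≠ 0 := by
    rintro rfl
    rw [map_zero, zero_div] at hab
    exact div_ne_zero hD0 hu hab.symm
  rw [← heightVec_smul _ a ha0, ← heightVec_smul (pmat τ η) b hb0]
  congr 1
  funext p
  apply FaithfulSMul.algebraMap_injective (𝓞 L) L
  rw [map_mul, map_mul, pmat_map, key p]
  have h3 : algebraMap (𝓞 L) L (algebraMap (𝓞 K) (𝓞 L) (N p.1 p.2)) =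
      algebraMap K L u * m p.1 p.2 := by
    have : algebraMap (𝓞 L) L (algebraMap (𝓞 K) (𝓞 L) (N p.1 p.2)) =
      algebraMap K L (algebraMap (𝓞 K) K (N p.1 p.2)) := rfl
    rw [this, hN, map_mul]
    rfl
  rw [h3]
  have h4 : algebraMap (𝓞 L) L a * algebraMap K L u = algebraMap (𝓞 L) L b * D := by
    field_simp at hab
    linear_combination hab
  linear_combination m p.1 p.2 * h4

end Helpers

/-- height bound for an automorphism of `ℙ¹` moving three given
points.  Here `L/K` is a finite extension of number fields containing the
coordinates of the three points `τᵢ` and their images `ηᵢ = s(τᵢ)`, the matrix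
`N` is an integral representative of `s ∈ PGL₂(K) ⊂ ℙ³(K)`, and the height
`H_K = H_L^{1/[L:K]}` is expressed by raising both sides to the power `[L:K]`. -/
theorem height_bound_of_moving_three_points
    {K L : Type*} [Field K] [NumberField K] [Field L] [NumberField L]
    [Algebra K L]
    (M : GL (Fin 2) K)
    (N : Matrix (Fin 2) (Fin 2) (𝓞 K)) (u : Kˣ)
    (hN : ∀ i j, algebraMap (𝓞 K) K (N i j) =
      (u : K) * (M : Matrix (Fin 2) (Fin 2) K) i j)
    (τ η : Fin 3 → (Fin 2 → 𝓞 L))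
    (hτ0 : ∀ i, (fun m => algebraMap (𝓞 L) L (τ i m)) ≠ 0)
    (hη0 : ∀ i, (fun m => algebraMap (𝓞 L) L (η i m)) ≠ 0)
    (hdist : ∀ i j, i ≠ j → ¬ ∃ c : L,
      (fun m => algebraMap (𝓞 L) L (τ i m)) =
        c • fun m => algebraMap (𝓞 L) L (τ j m))
    (hη : ∀ i, ∃ c : Lˣ,
      (fun m => algebraMap (𝓞 L) L (η i m)) =
        c • (((M : Matrix (Fin 2) (Fin 2) K).map (algebraMap K L)).mulVec
          fun m => algebraMap (𝓞 L) L (τ i m))) :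
    (heightVec (fun p : Fin 2 × Fin 2 => N p.1 p.2) ^ Module.finrank K L ≤
      (6 : ℝ) ^ (Module.finrank ℚ K * Module.finrank K L) *
        ∏ i, heightVec (τ i) * heightVec (η i)) ∧
    -- In particular: if `T`, `T'` are Galois-invariant sets of at least three
    -- points with `s(T) = T'`, then
    -- `H_K(s) ≤ 6^{[K:ℚ]} (max_{τ∈T} H_K τ)³ (max_{η∈T'} H_K η)³`.
    (∀ (T T' : Finset (Fin 2 → 𝓞 L)) (hT : T.Nonempty) (hT' : T'.Nonempty),
      3 ≤ T.card → 3 ≤ T'.card →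
      (∀ w ∈ T, (fun m => algebraMap (𝓞 L) L (w m)) ≠ 0) →
      (∀ w ∈ T', (fun m => algebraMap (𝓞 L) L (w m)) ≠ 0) →
      (∀ w ∈ T, ∀ w' ∈ T, w ≠ w' → ¬ ∃ c : L,
        (fun m => algebraMap (𝓞 L) L (w m)) =
          c • fun m => algebraMap (𝓞 L) L (w' m)) →
      (∀ w ∈ T', ∀ w' ∈ T', w ≠ w' → ¬ ∃ c : L,
        (fun m => algebraMap (𝓞 L) L (w m)) =
          c • fun m => algebraMap (𝓞 L) L (w' m)) →
      -- Galois invariance of T and T'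
      (∀ (σ : L ≃ₐ[K] L), ∀ w ∈ T, ∃ w' ∈ T, ∃ c : Lˣ,
        (fun m => σ (algebraMap (𝓞 L) L (w m))) =
          c • fun m => algebraMap (𝓞 L) L (w' m)) →
      (∀ (σ : L ≃ₐ[K] L), ∀ w ∈ T', ∃ w' ∈ T', ∃ c : Lˣ,
        (fun m => σ (algebraMap (𝓞 L) L (w m))) =
          c • fun m => algebraMap (𝓞 L) L (w' m)) →
      -- s(T) = T'
      (∀ w ∈ T, ∃ w' ∈ T', ∃ c : Lˣ,
        (((M : Matrix (Fin 2) (Fin 2) K).map (algebraMap K L)).mulVec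
          fun m => algebraMap (𝓞 L) L (w m)) =
            c • fun m => algebraMap (𝓞 L) L (w' m)) →
      (∀ w' ∈ T', ∃ w ∈ T, ∃ c : Lˣ,
        (((M : Matrix (Fin 2) (Fin 2) K).map (algebraMap K L)).mulVec
          fun m => algebraMap (𝓞 L) L (w m)) =
            c • fun m => algebraMap (𝓞 L) L (w' m)) →
      heightVec (fun p : Fin 2 × Fin 2 => N p.1 p.2) ^ Module.finrank K L ≤
        (6 : ℝ) ^ (Module.finrank ℚ K * Module.finrank K L) *
          (T.sup' hT heightVec) ^ 3 * (T'.sup' hT' heightVec) ^ 3) := by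
  refine ⟨part_one M N u hN τ η hτ0 hdist hη, ?_⟩
  intro T T' hT hT' hcard _ hT0 _ hTd _ _ _ hTT' _
  obtain ⟨S, hST, hS⟩ := Finset.exists_subset_card_eq hcard
  let e : Fin 3 ≃ S := (Finset.equivFinOfCardEq hS).symm
  have hmem : ∀ k, (e k : Fin 2 → 𝓞 L) ∈ T := fun k => hST (e k).2
  choose f hf c hc using fun k => hTT' (e k) (hmem k)
  refine (part_one M N u hN (fun k => (e k : Fin 2 → 𝓞 L)) f (fun k => hT0 _ (hmem k)) ?_ ?_).trans ?_
  · intro i j hij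
    exact hTd _ (hmem i) _ (hmem j) fun h => hij (e.injective (Subtype.ext h))
  · intro k
    refine ⟨(c k)⁻¹, ?_⟩
    rw [hc k, inv_smul_smul]
  · rw [mul_assoc]
    refine mul_le_mul_of_nonneg_left ?_ (by positivity)
    rw [← mul_pow]
    have hle : ∀ k, heightVec (e k : Fin 2 → 𝓞 L) * heightVec (f k) ≤
        T.sup' hT heightVec * T'.sup' hT' heightVec := by
      intro k
      have h1 := Finset.le_sup' heightVec (hmem k)
      exact mul_le_mul h1 (Finset.le_sup' heightVec (hf k)) (heightVec_nonneg _)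
        ((heightVec_nonneg _).trans h1)
    refine (Finset.prod_le_prod (fun k _ => mul_nonneg (heightVec_nonneg _) (heightVec_nonneg _))
      fun k _ => hle k).trans ?_
    rw [Finset.prod_const, Finset.card_univ, Fintype.card_fin]
end
end
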